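/- Fix q ≥ 1 and λ > 0. For every θ ∈ [0,1], lim_{ε↓0} lim_{n→∞} (1/n) log φ_{n,λ,q}[ |V_{εn}| = ⌊θn⌋ ] = Φ(θ,λ,q) − sup_{θ'∈[0,1]} Φ(θ',λ,q); that is, for all sufficiently small ε > 0 the inner limit in n exists, and as ε ↓ 0 these limits converge to the stated value. -/

import Mathlib

open Filter Topology Set

noncomputable section

/-- Size of the connected component of `K_n(ω)` containing the vertex `v`. -/
def compSize {n : ℕ} (G : SimpleGraph (Fin n)) (v : Fin n) : ℕ :=
  (G.connectedComponentMk v).supp.ncard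

/-- Random cluster weight of a configuration `G` on the complete graph `K_m`,
with edge weight `p` and cluster weight `q`. -/
def rcW (m : ℕ) (p q : ℝ) (G : SimpleGraph (Fin m)) : ℝ :=
  p ^ G.edgeSet.ncard * (1 - p) ^ (m * (m - 1) / 2 - G.edgeSet.ncard) *
    q ^ Nat.card G.ConnectedComponent

/-- Total random-cluster weight of an event, with explicit edge weight `p`. -/
def ZP (m : ℕ) (p q : ℝ) (A : Set (SimpleGraph (Fin m))) : ℝ :=
  ∑ᶠ G ∈ A, rcW m p q G

/-- `Z_{n,λ,q}[A]`, i.e. the total weight of the event `A` with `p = λ/n`. -/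
def Zrc (n : ℕ) (lam q : ℝ) (A : Set (SimpleGraph (Fin n))) : ℝ :=
  ZP n (lam / n) q A

/-- The partition function `Z_{n,λ,q}`. -/
def Ztot (n : ℕ) (lam q : ℝ) : ℝ := Zrc n lam q Set.univ

/-- The random cluster probability `φ_{n,λ,q}[A]`. -/
def phiRC (n : ℕ) (lam q : ℝ) (A : Set (SimpleGraph (Fin n))) : ℝ :=
  Zrc n lam q A / Ztot n lam q

/-- The event `K` that the configuration is connected. -/
def Kev (n : ℕ) : Set (SimpleGraph (Fin n)) := {G | G.Connected}

/-- The event `B_r` that no connected component has size larger than `r`. -/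
def Bev (n : ℕ) (r : ℝ) : Set (SimpleGraph (Fin n)) :=
  {G | ∀ v, (compSize G v : ℝ) ≤ r}

/-- The event `L` that the configuration is acyclic. -/
def Lev (n : ℕ) : Set (SimpleGraph (Fin n)) := {G | G.IsAcyclic}

/-- The set `V_r` of vertices lying in components of size larger than `r`. -/
def Vbig {n : ℕ} (G : SimpleGraph (Fin n)) (r : ℝ) : Set (Fin n) :=
  {v | r < (compSize G v : ℝ)}

/-- The number `N_r` of connected components of size larger than `r`. -/
def Nbig {n : ℕ} (G : SimpleGraph (Fin n)) (r : ℝ) : ℕ :=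
  {C : G.ConnectedComponent | r < (C.supp.ncard : ℝ)}.ncard

def pi1 (x : ℝ) : ℝ := 1 - Real.exp (-x)

def Psi (x : ℝ) : ℝ := min (Real.log x - (x - 1/x) / 2) 0

def Sent (θ : ℝ) : ℝ := θ * Real.log θ + (1 - θ) * Real.log (1 - θ)

def Phi (θ lam q : ℝ) : ℝ :=
  -Sent θ + (1 - θ) * Real.log (1 - pi1 (lam * θ)) + θ * Real.log (pi1 (lam * θ)) +
    (1 - θ) * (Psi (lam * (1 - θ) / q) - ((q - 1) / (2 * q)) * (lam * (1 - θ)) + Real.log q)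

-- PART 1

/-- Edge weight of a graph on a finite type. -/
def ew {V : Type} (p : ℝ) (G : SimpleGraph V) : ℝ :=
  p ^ G.edgeSet.ncard * (1 - p) ^ (Nat.card V * (Nat.card V - 1) / 2 - G.edgeSet.ncard)

/-- Product over components. -/
def cw {V : Type} (ρ : ℕ → ℝ) (G : SimpleGraph V) : ℝ :=
  ∏ᶠ C : G.ConnectedComponent, ρ C.supp.ncard

lemma iso_edge_ncard {V W : Type} {G : SimpleGraph V} {H : SimpleGraph W} (f : G ≃g H) :
    G.edgeSet.ncard = H.edgeSet.ncard := by
  rw [← Nat.card_coe_set_eq, ← Nat.card_coe_set_eq]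
  exact Nat.card_congr f.mapEdgeSet

lemma ew_iso {V W : Type} (p : ℝ) {G : SimpleGraph V} {H : SimpleGraph W} (f : G ≃g H) :
    ew p G = ew p H := by
  unfold ew
  rw [iso_edge_ncard f, Nat.card_congr f.toEquiv]

lemma cw_iso {V W : Type} (ρ : ℕ → ℝ) {G : SimpleGraph V} {H : SimpleGraph W} (f : G ≃g H) :
    cw ρ G = cw ρ H := by
  unfold cw
  refine finprod_eq_of_bijective f.connectedComponentEquiv f.connectedComponentEquiv.bijective ?_
  intro C
  congr 1
  rw [← Nat.card_coe_set_eq, ← Nat.card_coe_set_eq]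
  exact Nat.card_congr (SimpleGraph.ConnectedComponent.isoEquivSupp f C)

lemma edge_ncard_le {V : Type} [Finite V] (G : SimpleGraph V) :
    G.edgeSet.ncard ≤ Nat.card V * (Nat.card V - 1) / 2 := by
  classical
  have := Fintype.ofFinite V
  have h := SimpleGraph.card_edgeFinset_le_card_choose_two (G := G)
  rw [← Nat.choose_two_right, Nat.card_eq_fintype_card]
  rw [← SimpleGraph.coe_edgeFinset, Set.ncard_coe_finset]
  exact h

lemma sum_choose (a b : ℕ) :
    (a + b) * (a + b - 1) / 2 = a * (a - 1) / 2 + b * (b - 1) / 2 + a * b := by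
  rw [← Nat.choose_two_right, ← Nat.choose_two_right, ← Nat.choose_two_right]
  induction b with
  | zero => simp
  | succ b ih =>
    rw [← add_assoc, Nat.choose_succ_succ' (a+b) 1, Nat.choose_succ_succ' b 1, ih]
    simp; ring

lemma ew_sum {α β : Type} [Finite α] [Finite β] (p : ℝ) (A : SimpleGraph α) (B : SimpleGraph β) :
    ew p (A ⊕g B) = ew p A * ew p B * (1 - p) ^ (Nat.card α * Nat.card β) := by
  unfold ew
  have h1 : (A ⊕g B).edgeSet.ncard = A.edgeSet.ncard + B.edgeSet.ncard := by
    rw [← Nat.card_coe_set_eq, ← Nat.card_coe_set_eq, ← Nat.card_coe_set_eq,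
      Nat.card_congr SimpleGraph.edgeSetSumEquiv, Nat.card_sum]
  have hA := edge_ncard_le A
  have hB := edge_ncard_le B
  rw [h1, Nat.card_sum, sum_choose]
  have : Nat.card α * (Nat.card α - 1) / 2 + Nat.card β * (Nat.card β - 1) / 2 +
      Nat.card α * Nat.card β - (A.edgeSet.ncard + B.edgeSet.ncard) =
      (Nat.card α * (Nat.card α - 1) / 2 - A.edgeSet.ncard) +
      (Nat.card β * (Nat.card β - 1) / 2 - B.edgeSet.ncard) + Nat.card α * Nat.card β := by omega
  rw [this, pow_add, pow_add, pow_add]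
  ring

lemma sum_reach_inl {α β : Type} (A : SimpleGraph α) (B : SimpleGraph β) (x y : α) :
    (A ⊕g B).Reachable (Sum.inl x) (Sum.inl y) ↔ A.Reachable x y := by
  constructor
  · rintro ⟨w⟩
    have key : ∀ (u v : α ⊕ β), (A ⊕g B).Walk u v → ∀ x y, u = Sum.inl x → v = Sum.inl y →
        A.Reachable x y := by
      intro u v w
      induction w with
      | nil => intro x y hx hy; subst hx; cases hy; exact SimpleGraph.Reachable.refl _
      | @cons u v w h p ih =>
        intro x y hx hy
        subst hx
        cases v with
        | inl v => exact (SimpleGraph.Adj.reachable (by simpa using h)).trans (ih v y rfl hy)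
        | inr v => simp at h
    exact key _ _ w x y rfl rfl
  · intro h
    exact h.map (SimpleGraph.Embedding.sumInl (G := A) (H := B)).toHom

lemma sum_reach_inr {α β : Type} (A : SimpleGraph α) (B : SimpleGraph β) (x y : β) :
    (A ⊕g B).Reachable (Sum.inr x) (Sum.inr y) ↔ B.Reachable x y := by
  have := sum_reach_inl B A x y
  rw [← this]
  exact (SimpleGraph.Iso.reachable_iff (φ := (SimpleGraph.Iso.sumComm (G := A) (H := B)))
    (u := Sum.inr x) (v := Sum.inr y)).symm

lemma cw_sum {α β : Type} [Finite α] [Finite β] (ρ : ℕ → ℝ) (A : SimpleGraph α)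
    (B : SimpleGraph β) : cw ρ (A ⊕g B) = cw ρ A * cw ρ B := by
  classical
  have := Fintype.ofFinite α
  have := Fintype.ofFinite β
  have := Fintype.ofFinite A.ConnectedComponent
  have := Fintype.ofFinite B.ConnectedComponent
  have := Fintype.ofFinite (A ⊕g B).ConnectedComponent
  unfold cw
  rw [finprod_eq_prod_of_fintype, finprod_eq_prod_of_fintype, finprod_eq_prod_of_fintype]
  rw [← Fintype.prod_sumElim]
  symm
  let f : A.ConnectedComponent ⊕ B.ConnectedComponent → (A ⊕g B).ConnectedComponent :=
    Sum.elim (SimpleGraph.ConnectedComponent.map (SimpleGraph.Embedding.sumInl).toHom)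
      (SimpleGraph.ConnectedComponent.map (SimpleGraph.Embedding.sumInr).toHom)
  have hl : ∀ x : α, f (Sum.inl (A.connectedComponentMk x)) =
      (A ⊕g B).connectedComponentMk (Sum.inl x) := fun x => rfl
  have hr : ∀ x : β, f (Sum.inr (B.connectedComponentMk x)) =
      (A ⊕g B).connectedComponentMk (Sum.inr x) := fun x => rfl
  refine Fintype.prod_bijective f ⟨?_, ?_⟩ _ _ ?_
  · rintro (C | C) (D | D)
    · induction C using SimpleGraph.ConnectedComponent.ind with | _ x =>
      induction D using SimpleGraph.ConnectedComponent.ind with | _ y =>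
      rw [hl, hl, SimpleGraph.ConnectedComponent.eq, sum_reach_inl]
      intro h
      rw [SimpleGraph.ConnectedComponent.eq.2 h]
    · induction C using SimpleGraph.ConnectedComponent.ind with | _ x =>
      induction D using SimpleGraph.ConnectedComponent.ind with | _ y =>
      rw [hl, hr, SimpleGraph.ConnectedComponent.eq]
      intro h
      exact absurd h (SimpleGraph.not_reachable_sum_inl_inr x y)
    · induction C using SimpleGraph.ConnectedComponent.ind with | _ x =>
      induction D using SimpleGraph.ConnectedComponent.ind with | _ y =>
      rw [hl, hr, SimpleGraph.ConnectedComponent.eq]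
      intro h
      exact absurd h.symm (SimpleGraph.not_reachable_sum_inl_inr y x)
    · induction C using SimpleGraph.ConnectedComponent.ind with | _ x =>
      induction D using SimpleGraph.ConnectedComponent.ind with | _ y =>
      rw [hr, hr, SimpleGraph.ConnectedComponent.eq, sum_reach_inr]
      intro h
      rw [SimpleGraph.ConnectedComponent.eq.2 h]
  · intro C
    induction C using SimpleGraph.ConnectedComponent.ind with | _ x =>
    cases x with
    | inl x => exact ⟨_, hl x⟩
    | inr x => exact ⟨_, hr x⟩
  · rintro (C | C)
    · induction C using SimpleGraph.ConnectedComponent.ind with | _ x =>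
      rw [hl]
      simp only [Sum.elim_inl]
      congr 1
      rw [← Set.ncard_image_of_injective _ (Sum.inl_injective (β := β))]
      congr 1
      ext z
      cases z with
      | inl z => simp [SimpleGraph.ConnectedComponent.eq, sum_reach_inl]
      | inr z =>
        simp only [Set.mem_image, SimpleGraph.ConnectedComponent.mem_supp_iff,
          SimpleGraph.ConnectedComponent.eq, reduceCtorEq, and_false, exists_false, false_iff]
        exact fun h => SimpleGraph.not_reachable_sum_inl_inr x z h.symm
    · induction C using SimpleGraph.ConnectedComponent.ind with | _ x =>
      rw [hr]
      simp only [Sum.elim_inr]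
      congr 1
      rw [← Set.ncard_image_of_injective _ (Sum.inr_injective (α := α))]
      congr 1
      ext z
      cases z with
      | inr z => simp [SimpleGraph.ConnectedComponent.eq, sum_reach_inr]
      | inl z =>
        simp only [Set.mem_image, SimpleGraph.ConnectedComponent.mem_supp_iff,
          SimpleGraph.ConnectedComponent.eq, reduceCtorEq, and_false, exists_false, false_iff]
        exact fun h => SimpleGraph.not_reachable_sum_inl_inr z x h

-- PART 2

/-- Total weighted sum. -/
def Pf (p : ℝ) (ρ : ℕ → ℝ) (V : Type) : ℝ := ∑ᶠ G : SimpleGraph V, ew p G * cw ρ G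

/-- Connected weighted sum. -/
def Cf (p : ℝ) (V : Type) : ℝ := ∑ᶠ G : {G : SimpleGraph V // G.Connected}, ew p G.1

lemma Pf_congr (p : ℝ) (ρ : ℕ → ℝ) {V W : Type} (e : V ≃ W) : Pf p ρ V = Pf p ρ W := by
  unfold Pf
  refine finsum_eq_of_bijective (Equiv.simpleGraph e) (Equiv.simpleGraph e).bijective ?_
  intro G
  have f : G ≃g (Equiv.simpleGraph e G) := by
    refine ⟨e, ?_⟩
    intro a b
    simp [Equiv.simpleGraph]
  rw [ew_iso p f, cw_iso ρ f]

lemma Cf_congr (p : ℝ) {V W : Type} (e : V ≃ W) : Cf p V = Cf p W := by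
  unfold Cf
  have f : ∀ G : SimpleGraph V, G ≃g (Equiv.simpleGraph e G) := by
    intro G
    refine ⟨e, ?_⟩
    intro a b
    simp [Equiv.simpleGraph]
  refine finsum_eq_of_bijective
    ((Equiv.simpleGraph e).subtypeEquiv (fun G => (f G).connected_iff)) (Equiv.bijective _) ?_
  intro G
  exact ew_iso p (f G.1)

/-- Glue graphs on `S` and its complement. -/
def glue {V : Type} (S : Set V) (A : SimpleGraph S) (B : SimpleGraph (Sᶜ : Set V)) :
    SimpleGraph V := by
  classical
  exact (A ⊕g B).map (Equiv.Set.sumCompl S).toEmbedding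

def glueIso {V : Type} (S : Set V) (A : SimpleGraph S) (B : SimpleGraph (Sᶜ : Set V)) :
    (A ⊕g B) ≃g glue S A B := by
  classical
  exact SimpleGraph.Iso.map (Equiv.Set.sumCompl S) (A ⊕g B)

lemma glueIso_inl {V : Type} (S : Set V) (A : SimpleGraph S) (B : SimpleGraph (Sᶜ : Set V))
    (x : S) : glueIso S A B (Sum.inl x) = x.1 := rfl

lemma glueIso_inr {V : Type} (S : Set V) (A : SimpleGraph S) (B : SimpleGraph (Sᶜ : Set V))
    (x : (Sᶜ : Set V)) : glueIso S A B (Sum.inr x) = x.1 := rfl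

lemma glue_adj_l {V : Type} (S : Set V) (A : SimpleGraph S) (B : SimpleGraph (Sᶜ : Set V))
    (x y : S) : (glue S A B).Adj x.1 y.1 ↔ A.Adj x y := by
  rw [← glueIso_inl S A B x, ← glueIso_inl S A B y, (glueIso S A B).map_adj_iff]; simp

lemma glue_adj_r {V : Type} (S : Set V) (A : SimpleGraph S) (B : SimpleGraph (Sᶜ : Set V))
    (x y : (Sᶜ : Set V)) : (glue S A B).Adj x.1 y.1 ↔ B.Adj x y := by
  rw [← glueIso_inr S A B x, ← glueIso_inr S A B y, (glueIso S A B).map_adj_iff]; simp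

lemma glue_adj_lr {V : Type} (S : Set V) (A : SimpleGraph S) (B : SimpleGraph (Sᶜ : Set V))
    (x : S) (y : (Sᶜ : Set V)) : ¬ (glue S A B).Adj x.1 y.1 := by
  rw [← glueIso_inl S A B x, ← glueIso_inr S A B y, (glueIso S A B).map_adj_iff]; simp

lemma glue_supp {V : Type} (S : Set V) (A : SimpleGraph S) (B : SimpleGraph (Sᶜ : Set V))
    (hA : A.Connected) (v : S) : ((glue S A B).connectedComponentMk v.1).supp = S := by
  ext x
  rw [SimpleGraph.ConnectedComponent.mem_supp_iff, SimpleGraph.ConnectedComponent.eq]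
  by_cases hx : x ∈ S
  · simp only [hx, iff_true]
    have := (sum_reach_inl A B ⟨x, hx⟩ v).2 (hA.preconnected _ _)
    exact this.map (glueIso S A B).toHom
  · simp only [hx, iff_false]
    intro h
    have h2 := (SimpleGraph.Iso.reachable_iff (φ := glueIso S A B) (u := Sum.inr ⟨x, hx⟩)
      (v := Sum.inl v)).1 h
    exact SimpleGraph.not_reachable_sum_inl_inr _ _ h2.symm

lemma glue_induce {V : Type} (G : SimpleGraph V) (S : Set V) (v : V)
    (h : (G.connectedComponentMk v).supp = S) : glue S (G.induce S) (G.induce Sᶜ) = G := by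
  have hc : ∀ x y, G.Adj x y → (x ∈ S ↔ y ∈ S) := by
    intro x y hxy
    rw [← h]
    exact SimpleGraph.ConnectedComponent.mem_supp_congr_adj _ hxy
  ext x y
  by_cases hx : x ∈ S <;> by_cases hy : y ∈ S
  · rw [glue_adj_l S _ _ ⟨x, hx⟩ ⟨y, hy⟩]; simp
  · have h1 := glue_adj_lr S (G.induce S) (G.induce Sᶜ) ⟨x, hx⟩ ⟨y, hy⟩
    simp only [h1, false_iff]
    intro h2; exact hy ((hc x y h2).1 hx)
  · have h1 := glue_adj_lr S (G.induce S) (G.induce Sᶜ) ⟨y, hy⟩ ⟨x, hx⟩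
    rw [SimpleGraph.adj_comm]
    simp only [h1, false_iff]
    intro h2; exact hx ((hc x y h2).2 hy)
  · rw [glue_adj_r S _ _ ⟨x, hx⟩ ⟨y, hy⟩]; simp

lemma cw_connected {V : Type} (ρ : ℕ → ℝ) (G : SimpleGraph V) (h : G.Connected) :
    cw ρ G = ρ (Nat.card V) := by
  unfold cw
  have := h.preconnected.subsingleton_connectedComponent
  obtain ⟨v⟩ := h.nonempty
  rw [finprod_eq_single _ (G.connectedComponentMk v) (fun x hx => absurd (Subsingleton.elim _ _) hx)]
  congr 1
  rw [← Set.ncard_univ]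
  congr 1
  ext x
  simp [h.preconnected x v]

lemma fiber_sum {V : Type} [Finite V] (p : ℝ) (ρ : ℕ → ℝ) (S : Set V) (v : V) (hv : v ∈ S) :
    ∑ᶠ G : {G : SimpleGraph V // (G.connectedComponentMk v).supp = S}, ew p G.1 * cw ρ G.1 =
      Cf p S * ρ (Nat.card S) * (1 - p) ^ (Nat.card S * Nat.card (Sᶜ : Set V)) *
        Pf p ρ (Sᶜ : Set V) := by
  classical
  let e : ({A : SimpleGraph S // A.Connected} × SimpleGraph (Sᶜ : Set V)) ≃
      {G : SimpleGraph V // (G.connectedComponentMk v).supp = S} :=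
    { toFun := fun X => ⟨glue S X.1.1 X.2, glue_supp S X.1.1 X.2 X.1.2 ⟨v, hv⟩⟩
      invFun := fun G => (⟨G.1.induce S, by
        have := (G.1.connectedComponentMk v).connected_toSimpleGraph
        unfold SimpleGraph.ConnectedComponent.toSimpleGraph at this
        have h2 : ∀ T : Set V, T = S → (G.1.induce T).Connected → (G.1.induce S).Connected := by
          rintro T rfl h; exact h
        exact h2 _ G.2 this⟩, G.1.induce Sᶜ)
      left_inv := by
        rintro ⟨⟨A, hA⟩, B⟩
        simp only [Prod.mk.injEq, Subtype.mk.injEq]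
        constructor
        · ext x y; simp [glue_adj_l]
        · ext x y; simp only [SimpleGraph.comap_adj]; exact glue_adj_r S A B x y
      right_inv := by
        rintro ⟨G, hG⟩
        simp only [Subtype.mk.injEq]
        exact glue_induce G S v hG }
  rw [← finsum_comp_equiv e]
  have : ∀ X, ew p (e X).1 * cw ρ (e X).1 = (ew p X.1.1 * (ρ (Nat.card S) *
      (1 - p) ^ (Nat.card S * Nat.card (Sᶜ : Set V)))) * (ew p X.2 * cw ρ X.2) := by
    intro X
    change ew p (glue S X.1.1 X.2) * cw ρ (glue S X.1.1 X.2) = _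
    rw [← ew_iso p (glueIso S X.1.1 X.2), ← cw_iso ρ (glueIso S X.1.1 X.2), ew_sum, cw_sum,
      cw_connected ρ X.1.1 X.1.2]
    ring
  simp_rw [this]
  have := Fintype.ofFinite {A : SimpleGraph S // A.Connected}
  have := Fintype.ofFinite (SimpleGraph (Sᶜ : Set V))
  unfold Cf Pf
  rw [finsum_eq_sum_of_fintype, finsum_eq_sum_of_fintype, finsum_eq_sum_of_fintype,
    Fintype.sum_prod_type]
  simp_rw [← Finset.mul_sum]
  rw [← Finset.sum_mul, ← Finset.sum_mul]
  ring

lemma Pf_rec (p : ℝ) (ρ : ℕ → ℝ) (n : ℕ) :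
    Pf p ρ (Fin (n + 1)) = ∑ k ∈ Finset.range (n + 1), (n.choose k : ℝ) * Cf p (Fin (k + 1)) *
      ρ (k + 1) * (1 - p) ^ ((k + 1) * (n - k)) * Pf p ρ (Fin (n - k)) := by
  classical
  let v : Fin (n + 1) := 0
  let U : Finset (Fin (n + 1)) := Finset.univ.erase v
  have hU : U.card = n := by simp [U]
  have := Fintype.ofFinite (SimpleGraph (Fin (n + 1)))
  have h1 : Pf p ρ (Fin (n + 1)) = ∑ T ∈ U.powerset, ∑ G ∈ Finset.univ.filter
      (fun G : SimpleGraph (Fin (n + 1)) => (G.connectedComponentMk v).supp.toFinset.erase v = T),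
      ew p G * cw ρ G := by
    unfold Pf
    rw [finsum_eq_sum_of_fintype, Finset.sum_fiberwise_of_maps_to]
    intro G _
    simp only [Finset.mem_powerset, U]
    exact Finset.erase_subset_erase _ (Finset.subset_univ _)
  rw [h1]
  have h2 : ∀ T ∈ U.powerset, ∑ G ∈ Finset.univ.filter
      (fun G : SimpleGraph (Fin (n + 1)) => (G.connectedComponentMk v).supp.toFinset.erase v = T),
      ew p G * cw ρ G = Cf p (Fin (T.card + 1)) * ρ (T.card + 1) *
        (1 - p) ^ ((T.card + 1) * (n - T.card)) * Pf p ρ (Fin (n - T.card)) := by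
    intro T hT
    have hvT : v ∉ T := by
      intro h
      have := Finset.mem_powerset.1 hT h
      simp [U] at this
    let S : Set (Fin (n + 1)) := (insert v T : Finset (Fin (n+1)))
    have hvS : v ∈ S := by simp [S]
    have cS : Nat.card S = T.card + 1 := by
      rw [Nat.card_coe_set_eq, Set.ncard_coe_finset, Finset.card_insert_of_notMem hvT]
    have cSc : Nat.card (Sᶜ : Set (Fin (n+1))) = n - T.card := by
      rw [Nat.card_coe_set_eq, Set.ncard_compl, ← Nat.card_coe_set_eq, cS]
      simp
    have key := fiber_sum p ρ S v hvS
    rw [cS, cSc] at key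
    have e1 : S ≃ Fin (T.card + 1) := cS ▸ Finite.equivFin S
    have e2 : (Sᶜ : Set (Fin (n+1))) ≃ Fin (n - T.card) := cSc ▸ Finite.equivFin _
    rw [Cf_congr p e1, Pf_congr p ρ e2] at key
    rw [← key, finsum_subtype_eq_finsum_cond (f := fun G => ew p G * cw ρ G)
      (fun G => (G.connectedComponentMk v).supp = S)]
    symm
    change (∑ᶠ G ∈ {G : SimpleGraph (Fin (n + 1)) | (G.connectedComponentMk v).supp = S},
      ew p G * cw ρ G) = _
    have hset : {G : SimpleGraph (Fin (n + 1)) | (G.connectedComponentMk v).supp = S} =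
        ((Finset.univ.filter (fun G : SimpleGraph (Fin (n + 1)) =>
          (G.connectedComponentMk v).supp.toFinset.erase v = T) :
          Finset (SimpleGraph (Fin (n + 1)))) : Set (SimpleGraph (Fin (n + 1)))) := by
      ext G
      simp only [Finset.coe_filter, Finset.mem_univ, true_and, Set.mem_setOf_eq]
      have hm : v ∈ (G.connectedComponentMk v).supp.toFinset := by simp
      constructor
      · intro h
        have : (G.connectedComponentMk v).supp.toFinset = insert v T := by
          ext x
          rw [Set.mem_toFinset, h]
          simp [S]
        rw [this, Finset.erase_insert hvT]
      · intro h
        simp only [S]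
        rw [← h, Finset.insert_erase hm]; simp
    rw [hset, finsum_mem_coe_finset]
  rw [Finset.sum_congr rfl h2, Finset.sum_powerset_apply_card (fun j => Cf p (Fin (j + 1)) *
    ρ (j + 1) * (1 - p) ^ ((j + 1) * (n - j)) * Pf p ρ (Fin (n - j))), hU]
  refine Finset.sum_congr rfl (fun k _ => ?_)
  rw [nsmul_eq_mul]; ring

-- PART 3

lemma cw_one {V : Type} (G : SimpleGraph V) : cw (fun _ => 1) G = 1 := by
  unfold cw; simp

lemma Pf_one (p : ℝ) (n : ℕ) : Pf p (fun _ => 1) (Fin n) = 1 := by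
  classical
  have := Fintype.ofFinite (SimpleGraph (Fin n))
  unfold Pf
  simp only [cw_one, mul_one]
  rw [finsum_eq_sum_of_fintype]
  have key := Finset.sum_pow_mul_eq_add_pow p (1 - p) ((⊤ : SimpleGraph (Fin n)).edgeFinset)
  rw [add_sub_cancel, one_pow] at key
  rw [← key]
  refine Finset.sum_bij' (fun G _ => G.edgeFinset)
    (fun T _ => SimpleGraph.fromEdgeSet (T : Set (Sym2 (Fin n)))) ?_ ?_ ?_ ?_ ?_
  · intro G _
    rw [Finset.mem_powerset]
    exact SimpleGraph.edgeFinset_mono le_top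
  · simp
  · intro G _
    simp
  · intro T hT
    rw [Finset.mem_powerset] at hT
    ext e
    simp only [SimpleGraph.mem_edgeFinset, SimpleGraph.edgeSet_fromEdgeSet, Set.mem_diff,
      Finset.mem_coe]
    constructor
    · exact fun h => h.1
    · intro h
      refine ⟨h, ?_⟩
      have h2 := hT h
      rw [SimpleGraph.mem_edgeFinset] at h2
      exact SimpleGraph.not_isDiag_of_mem_edgeSet _ h2
  · intro G _
    unfold ew
    rw [SimpleGraph.card_edgeFinset_top_eq_card_choose_two, Nat.choose_two_right,
      ← SimpleGraph.coe_edgeFinset, Set.ncard_coe_finset]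
    simp

/-- probability of connectedness -/
def cc (p : ℝ) (k : ℕ) : ℝ := Cf p (Fin k)

lemma cc_nonneg {p : ℝ} (h0 : 0 ≤ p) (h1 : p ≤ 1) (k : ℕ) : 0 ≤ cc p k := by
  unfold cc Cf
  refine finsum_nonneg (fun G => ?_)
  unfold ew
  have : 0 ≤ 1 - p := by linarith
  positivity

lemma cc_sum (p : ℝ) (n : ℕ) : ∑ k ∈ Finset.range (n + 1), (n.choose k : ℝ) * cc p (k + 1) *
      (1 - p) ^ ((k + 1) * (n - k)) = 1 := by
  have := Pf_rec p (fun _ => 1) n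
  simp only [Pf_one, mul_one] at this
  exact this.symm

lemma cc_one (p : ℝ) : cc p 1 = 1 := by
  have := cc_sum p 0
  simpa using this

lemma cc_zero (p : ℝ) : cc p 0 = 0 := by
  unfold cc Cf
  have : IsEmpty {G : SimpleGraph (Fin 0) // G.Connected} := by
    constructor
    rintro ⟨G, hG⟩
    obtain ⟨v⟩ := hG.nonempty
    exact v.elim0
  exact finsum_of_isEmpty _

/-- Coefficients of the exponential of a power series. -/
def expC (a : ℕ → ℝ) : ℕ → ℝ
  | 0 => 1
  | n + 1 => (∑ k : Fin (n + 1), ((k : ℕ) + 1 : ℝ) * a (k + 1) * expC a (n - k)) / (n + 1)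

lemma expC_zero (a : ℕ → ℝ) : expC a 0 = 1 := by rw [expC]

lemma expC_succ (a : ℕ → ℝ) (n : ℕ) : ((n : ℝ) + 1) * expC a (n + 1) =
    ∑ k ∈ Finset.range (n + 1), ((k : ℝ) + 1) * a (k + 1) * expC a (n - k) := by
  rw [expC, Finset.sum_range]
  field_simp

lemma expC_unique (a f : ℕ → ℝ) (h0 : f 0 = 1) (hs : ∀ n : ℕ, ((n : ℝ) + 1) * f (n + 1) =
    ∑ k ∈ Finset.range (n + 1), ((k : ℝ) + 1) * a (k + 1) * f (n - k)) (n : ℕ) :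
    f n = expC a n := by
  induction n using Nat.strong_induction_on with
  | _ n ih =>
    cases n with
    | zero => rw [h0, expC_zero]
    | succ n =>
      have h1 := hs n
      have h2 := expC_succ a n
      have h3 : ((n : ℝ) + 1) ≠ 0 := by positivity
      apply mul_left_cancel₀ h3
      rw [h1, h2]
      refine Finset.sum_congr rfl (fun k _ => ?_)
      rw [ih (n - k) (by omega)]

lemma expC_congr {a b : ℕ → ℝ} (h : ∀ k, 1 ≤ k → a k = b k) (n : ℕ) : expC a n = expC b n := by
  apply expC_unique
  · exact expC_zero a
  · intro n
    rw [expC_succ]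
    refine Finset.sum_congr rfl (fun k _ => ?_)
    rw [h (k+1) (by omega)]

lemma expC_scale (a : ℕ → ℝ) (t : ℝ) (n : ℕ) :
    t ^ n * expC a n = expC (fun k => t ^ k * a k) n := by
  apply expC_unique (f := fun n => t ^ n * expC a n)
  · simp [expC_zero]
  · intro n
    rw [show ((n : ℝ) + 1) * (t ^ (n + 1) * expC a (n + 1)) =
      t ^ (n+1) * (((n : ℝ) + 1) * expC a (n + 1)) by ring, expC_succ, Finset.mul_sum]
    refine Finset.sum_congr rfl (fun k hk => ?_)
    have : n + 1 = (k + 1) + (n - k) := by have := Finset.mem_range.1 hk; omega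
    rw [this, pow_add]
    have : k + 1 + (n - k) - 1 - k = n - k := by omega
    ring

lemma expC_nonneg {a : ℕ → ℝ} (h : ∀ k, 0 ≤ a k) (n : ℕ) : 0 ≤ expC a n := by
  induction n using Nat.strong_induction_on with
  | _ n ih =>
    cases n with
    | zero => rw [expC_zero]; norm_num
    | succ n =>
      rw [expC]
      apply div_nonneg _ (by positivity)
      refine Finset.sum_nonneg (fun k _ => ?_)
      have := ih (n - k) (by omega)
      have := h (k + 1)
      positivity

lemma expC_mono {a b : ℕ → ℝ} (ha : ∀ k, 0 ≤ a k) (h : ∀ k, a k ≤ b k) (n : ℕ) :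
    expC a n ≤ expC b n := by
  induction n using Nat.strong_induction_on with
  | _ n ih =>
    cases n with
    | zero => rw [expC_zero, expC_zero]
    | succ n =>
      rw [expC, expC]
      gcongr with k _
      · exact expC_nonneg ha _
      · have := (ha (k+1)).trans (h (k + 1))
        positivity
      · exact h _
      · exact ih _ (by omega)

open PowerSeries in
lemma expC_deriv (a : ℕ → ℝ) : derivative ℝ (mk (expC a)) =
    mk (fun k => ((k : ℝ) + 1) * a (k + 1)) * mk (expC a) := by
  ext n
  rw [coeff_derivative, coeff_mul, coeff_mk, mul_comm, expC_succ,
    Finset.Nat.sum_antidiagonal_eq_sum_range_succ_mk]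
  simp

open PowerSeries in
lemma expC_of_deriv (a : ℕ → ℝ) (F : PowerSeries ℝ) (h0 : coeff 0 F = 1)
    (h : derivative ℝ F = mk (fun k => ((k : ℝ) + 1) * a (k + 1)) * F) (n : ℕ) :
    coeff n F = expC a n := by
  apply expC_unique a (fun n => coeff n F) h0
  intro n
  have := congrArg (coeff n) h
  rw [coeff_derivative, coeff_mul, mul_comm,
    Finset.Nat.sum_antidiagonal_eq_sum_range_succ_mk] at this
  simpa using this

open PowerSeries in
lemma expC_add (a b : ℕ → ℝ) (n : ℕ) : expC (fun k => a k + b k) n =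
    ∑ k ∈ Finset.range (n + 1), expC a k * expC b (n - k) := by
  rw [← expC_of_deriv (fun k => a k + b k) (mk (expC a) * mk (expC b))]
  · rw [coeff_mul, Finset.Nat.sum_antidiagonal_eq_sum_range_succ_mk]
    simp
  · simp [expC_zero]
  · rw [Derivation.leibniz, expC_deriv, expC_deriv]
    simp only [smul_eq_mul]
    have : (mk (fun k => ((k : ℝ) + 1) * (a (k + 1) + b (k + 1)))) =
      mk (fun k => ((k : ℝ) + 1) * a (k + 1)) + mk (fun k => ((k : ℝ) + 1) * b (k + 1)) := by
      ext n; simp; ring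
    rw [this]; ring

/-- `(1-p)^{-k^2/2}` -/
def eh (p : ℝ) (k : ℕ) : ℝ := Real.exp (-Real.log (1 - p) * (k : ℝ) ^ 2 / 2)

lemma eh_pos (p : ℝ) (k : ℕ) : 0 < eh p k := Real.exp_pos _

lemma eh_add {p : ℝ} (h1 : p < 1) (i j : ℕ) :
    eh p (i + j) * (1 - p) ^ (i * j) = eh p i * eh p j := by
  have : 0 < 1 - p := by linarith
  unfold eh
  rw [← Real.exp_log this, ← Real.exp_nat_mul, ← Real.exp_add, ← Real.exp_add, Real.log_exp]
  congr 1
  push_cast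
  ring

/-- normalized connected weights -/
def al (p : ℝ) (k : ℕ) : ℝ := cc p k * eh p k / (k.factorial : ℝ)

lemma al_nonneg {p : ℝ} (h0 : 0 ≤ p) (h1 : p ≤ 1) (k : ℕ) : 0 ≤ al p k := by
  have := cc_nonneg h0 h1 k
  have := (eh_pos p k).le
  unfold al; positivity

lemma Pf_expC {p : ℝ} (h1 : p < 1) (ρ : ℕ → ℝ) (n : ℕ) :
    Pf p ρ (Fin n) * eh p n / (n.factorial : ℝ) = expC (fun k => al p k * ρ k) n := by
  have hP0 : Pf p ρ (Fin 0) = 1 := by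
    unfold Pf
    rw [finsum_eq_single _ (⊥ : SimpleGraph (Fin 0))
      (fun x hx => absurd (Subsingleton.elim _ _) hx)]
    have : ∀ f : (⊥ : SimpleGraph (Fin 0)).ConnectedComponent → ℝ, ∏ᶠ C, f C = 1 := by
      intro f
      have : IsEmpty (⊥ : SimpleGraph (Fin 0)).ConnectedComponent := by
        constructor
        intro C
        obtain ⟨v, _⟩ := C.nonempty_supp
        exact v.elim0
      exact finprod_of_isEmpty _
    unfold ew cw
    rw [this]
    simp
  apply expC_unique (f := fun n => Pf p ρ (Fin n) * eh p n / (n.factorial : ℝ))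
  · simp [hP0, eh]
  · intro n
    rw [Pf_rec]
    have : ((n : ℝ) + 1) * (∑ k ∈ Finset.range (n + 1), (n.choose k : ℝ) * Cf p (Fin (k + 1)) *
      ρ (k + 1) * (1 - p) ^ ((k + 1) * (n - k)) * Pf p ρ (Fin (n - k)) * eh p (n + 1) /
      ((n+1).factorial : ℝ))
      = ((n : ℝ) + 1) * ((∑ k ∈ Finset.range (n + 1), (n.choose k : ℝ) * Cf p (Fin (k + 1)) *
      ρ (k + 1) * (1 - p) ^ ((k + 1) * (n - k)) * Pf p ρ (Fin (n - k))) * eh p (n + 1) /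
      ((n+1).factorial : ℝ)) := by
      rw [Finset.sum_mul, Finset.sum_div]
    rw [← this, Finset.mul_sum]
    refine Finset.sum_congr rfl (fun k hk => ?_)
    have hk' : k ≤ n := by have := Finset.mem_range.1 hk; omega
    have e1 := eh_add h1 (k + 1) (n - k)
    rw [show k + 1 + (n - k) = n + 1 by omega] at e1
    rw [Nat.cast_choose ℝ hk', al, ← cc, Nat.factorial_succ, Nat.factorial_succ]
    have hf1 : (n.factorial : ℝ) ≠ 0 := by positivity
    have hf2 : (k.factorial : ℝ) ≠ 0 := by positivity
    have hf3 : ((n - k).factorial : ℝ) ≠ 0 := by positivity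
    push_cast
    field_simp
    linear_combination (cc p (k+1) * ρ (k+1) * Pf p ρ (Fin (n-k))) * e1

lemma al_expC {p : ℝ} (h1 : p < 1) (n : ℕ) :
    expC (al p) n = eh p n / (n.factorial : ℝ) := by
  have := Pf_expC h1 (fun _ => 1) n
  rw [Pf_one, one_mul] at this
  simpa using this.symm

open PowerSeries in
lemma al_rec {p : ℝ} (h1 : p < 1) (n : ℕ) :
    ((n : ℝ) + 1) * ((n : ℝ) + 2) * al p (n + 2) = ∑ i ∈ Finset.range (n + 1),
      (((1 - p)⁻¹) ^ (i + 1) - 1) * (((i : ℝ) + 1) * al p (i + 1)) *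
        ((((n - i : ℕ) : ℝ) + 1) * al p (n - i + 1)) := by
  set u : ℝ := (1 - p)⁻¹ with hu
  have hp : 0 < 1 - p := by linarith
  set D : PowerSeries ℝ := mk (fun k => ((k : ℝ) + 1) * al p (k + 1)) with hD
  set E : PowerSeries ℝ := mk (expC (al p)) with hE
  have d1 : derivative ℝ E = D * E := expC_deriv (al p)
  have hrs : ∀ f : PowerSeries ℝ, derivative ℝ (rescale u f) =
      C u * rescale u (derivative ℝ f) := by
    intro f
    ext m
    simp only [coeff_derivative, coeff_rescale, coeff_C_mul]
    ring
  have d2 : derivative ℝ E = C (eh p 1) * rescale u E := by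
    ext m
    simp only [coeff_derivative, coeff_rescale, coeff_C_mul, hE, coeff_mk]
    rw [al_expC h1, al_expC h1, Nat.factorial_succ]
    have e1 := eh_add h1 m 1
    have hf1 : (m.factorial : ℝ) ≠ 0 := by positivity
    rw [hu]
    push_cast
    rw [inv_pow]
    field_simp
    rw [mul_one] at e1
    linear_combination e1
  have d3 : derivative ℝ (derivative ℝ E) = C u * rescale u D * derivative ℝ E := by
    conv_lhs => rw [d2]
    rw [Derivation.leibniz, hrs, d1]
    have : derivative ℝ (C (eh p 1)) = 0 := by simp
    rw [this]
    simp only [smul_eq_mul, mul_zero, add_zero]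
    rw [map_mul, ← d1, d2]; ring
  have d4 : derivative ℝ (derivative ℝ E) = derivative ℝ D * E + D * derivative ℝ E := by
    conv_lhs => rw [d1]
    rw [Derivation.leibniz]
    simp only [smul_eq_mul]; ring
  have hE0 : E ≠ 0 := by
    intro h
    have := congrArg (coeff 0) h
    simp [hE, expC_zero] at this
  have d5 : derivative ℝ D = (C u * rescale u D - D) * D := by
    apply mul_right_cancel₀ hE0
    have : derivative ℝ D * E + D * derivative ℝ E = C u * rescale u D * derivative ℝ E := by
      rw [← d4, d3]
    rw [d1] at this
    linear_combination this
  have := congrArg (coeff n) d5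
  rw [coeff_derivative, coeff_mul, Finset.Nat.sum_antidiagonal_eq_sum_range_succ_mk] at this
  simp only [hD, coeff_mk, map_sub, coeff_C_mul, coeff_rescale] at this
  push_cast at this
  rw [show ((n : ℝ) + 1) * ((n : ℝ) + 2) * al p (n + 2) =
    ((n : ℝ) + 1 + 1) * al p (n + 1 + 1) * ((n : ℝ) + 1) by ring_nf, this]
  refine Finset.sum_congr rfl (fun k hk => ?_)
  ring

lemma cc_rec {p : ℝ} (h1 : p < 1) (n : ℕ) :
    cc p (n + 2) / (n.factorial : ℝ) = ∑ i ∈ Finset.range (n + 1),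
      (1 - (1 - p) ^ (i + 1)) * (1 - p) ^ ((i + 1) * (n - i)) * (cc p (i + 1) / (i.factorial : ℝ))
        * (cc p (n - i + 1) / ((n - i).factorial : ℝ)) := by
  have hp : 0 < 1 - p := by linarith
  have key := al_rec h1 n
  have e0 : eh p (n + 2) ≠ 0 := (eh_pos _ _).ne'
  apply mul_right_cancel₀ e0
  have l1 : cc p (n + 2) / (n.factorial : ℝ) * eh p (n + 2) =
      ((n : ℝ) + 1) * ((n : ℝ) + 2) * al p (n + 2) := by
    rw [al, Nat.factorial_succ, Nat.factorial_succ]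
    push_cast
    field_simp
    ring
  rw [l1, key, Finset.sum_mul]
  refine Finset.sum_congr rfl (fun i hi => ?_)
  have hi' : i ≤ n := by have := Finset.mem_range.1 hi; omega
  have e1 := eh_add h1 (i + 1) (n - i + 1)
  rw [show i + 1 + (n - i + 1) = n + 2 by omega] at e1
  have e2 : (1 - p) ^ ((i + 1) * (n - i + 1)) = (1 - p) ^ ((i + 1) * (n - i)) * (1 - p) ^ (i + 1) := by
    rw [← pow_add]; congr 1
  rw [e2] at e1
  rw [al, al, Nat.factorial_succ, Nat.factorial_succ, inv_pow]
  push_cast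
  have hq : (1 - p) ^ (i + 1) ≠ 0 := by positivity
  field_simp
  linear_combination (-((1 - (1-p)^(i+1)) * cc p (i+1) * cc p (n-i+1))) * e1

lemma cc_mono {p : ℝ} (h0 : 0 ≤ p) (h1 : p < 1) (n : ℕ) (hn : 1 ≤ n) :
    cc p n * (1 - (1 - p) ^ n) ≤ cc p (n + 1) := by
  obtain ⟨m, rfl⟩ : ∃ m, n = m + 1 := ⟨n - 1, by omega⟩
  have hp : 0 < 1 - p := by linarith
  have key := cc_rec h1 m
  have hm : (0 : ℝ) < (m.factorial : ℝ) := by positivity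
  have h2 : cc p (m + 1) * (1 - (1 - p) ^ (m + 1)) / (m.factorial : ℝ) ≤
      cc p (m + 2) / (m.factorial : ℝ) := by
    rw [key]
    have := Finset.single_le_sum (s := Finset.range (m + 1)) (f := fun i =>
      (1 - (1 - p) ^ (i + 1)) * (1 - p) ^ ((i + 1) * (m - i)) * (cc p (i + 1) / (i.factorial : ℝ))
        * (cc p (m - i + 1) / ((m - i).factorial : ℝ))) (fun i _ => ?_) (a := m) (by simp)
    · refine le_trans (le_of_eq ?_) this
      simp [cc_one]
      ring
    · have a1 := cc_nonneg h0 h1.le (i + 1)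
      have a2 := cc_nonneg h0 h1.le (m - i + 1)
      have a3 : 0 ≤ 1 - (1 - p) ^ (i + 1) := by
        have : (1 - p) ^ (i + 1) ≤ 1 := pow_le_one₀ hp.le (by linarith)
        linarith
      positivity
  rwa [div_le_div_iff_of_pos_right hm] at h2

lemma cc_pos {p : ℝ} (h0 : 0 < p) (h1 : p < 1) (n : ℕ) (hn : 1 ≤ n) : 0 < cc p n := by
  induction n, hn using Nat.le_induction with
  | base => rw [cc_one]; norm_num
  | succ n hn ih =>
    refine lt_of_lt_of_le ?_ (cc_mono h0.le h1 n hn)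
    have : (1 - p) ^ n < 1 := pow_lt_one₀ (by linarith) (by linarith) (by omega)
    exact mul_pos ih (by linarith)

-- PART 4

lemma cw_event {n : ℕ} (q t r : ℝ) (G : SimpleGraph (Fin n)) :
    cw (fun k => if r < (k : ℝ) then t ^ k * q else q) G =
      q ^ Nat.card G.ConnectedComponent * t ^ (Vbig G r).ncard := by
  classical
  have := Fintype.ofFinite G.ConnectedComponent
  unfold cw
  rw [finprod_eq_prod_of_fintype]
  have h1 : ∀ C : G.ConnectedComponent, (if r < (C.supp.ncard : ℝ) then t ^ C.supp.ncard * q else q)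
      = q * t ^ (if r < (C.supp.ncard : ℝ) then C.supp.ncard else 0) := by
    intro C; split_ifs <;> simp [mul_comm]
  simp only [h1]
  rw [Finset.prod_mul_distrib, Finset.prod_const, Finset.prod_pow_eq_pow_sum, Finset.card_univ,
    Nat.card_eq_fintype_card]
  congr 2
  rw [Set.ncard_eq_toFinset_card', Finset.card_eq_sum_card_fiberwise
    (f := fun v => G.connectedComponentMk v) (t := Finset.univ) (by intro x _; simp)]
  refine Finset.sum_congr rfl (fun C _ => ?_)
  split_ifs with h
  · rw [Set.ncard_eq_toFinset_card']
    congr 1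
    ext v
    simp only [Set.mem_toFinset, SimpleGraph.ConnectedComponent.mem_supp_iff, Finset.mem_filter,
      Vbig, compSize]
    constructor
    · intro hv
      refine ⟨?_, hv⟩
      apply Set.mem_toFinset.2
      show r < ((G.connectedComponentMk v).supp.ncard : ℝ)
      rw [hv]; exact h
    · exact fun hv => hv.2
  · symm
    rw [Finset.card_eq_zero, Finset.filter_eq_empty_iff]
    intro v hv hC
    apply h
    rw [← hC]
    rw [Set.mem_toFinset] at hv
    exact hv

lemma Vbig_ncard_le {n : ℕ} (r : ℝ) (G : SimpleGraph (Fin n)) : (Vbig G r).ncard ≤ n := by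
  have := Set.ncard_le_ncard (Set.subset_univ (Vbig G r)) (Set.toFinite _)
  simpa [Set.ncard_univ] using this

lemma Pf_event (n : ℕ) (p q t r : ℝ) :
    Pf p (fun k => if r < (k : ℝ) then t ^ k * q else q) (Fin n) =
      ∑ m ∈ Finset.range (n + 1), ZP n p q {G | (Vbig G r).ncard = m} * t ^ m := by
  classical
  have := Fintype.ofFinite (SimpleGraph (Fin n))
  unfold Pf ZP
  simp only [cw_event]
  rw [finsum_eq_sum_of_fintype]
  have h2 : ∀ m, (∑ᶠ G ∈ {G : SimpleGraph (Fin n) | (Vbig G r).ncard = m}, rcW n p q G) =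
      ∑ G : SimpleGraph (Fin n), if (Vbig G r).ncard = m then rcW n p q G else 0 := by
    intro m
    rw [finsum_mem_eq_finite_toFinset_sum _ (Set.toFinite _), ← Finset.sum_filter]
    refine Finset.sum_congr ?_ (fun _ _ => rfl)
    ext G; simp
  simp only [h2, Finset.sum_mul]
  rw [Finset.sum_comm]
  refine Finset.sum_congr rfl (fun G _ => ?_)
  have : ∀ m ∈ Finset.range (n+1), (if (Vbig G r).ncard = m then rcW n p q G else 0) * t ^ m
      = if (Vbig G r).ncard = m then rcW n p q G * t ^ (Vbig G r).ncard else 0 := by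
    intro m _
    split_ifs with h
    · rw [h]
    · simp
  rw [Finset.sum_congr rfl this, Finset.sum_ite_eq, if_pos]
  · unfold ew rcW
    rw [Nat.card_fin]; ring
  · have := Vbig_ncard_le r G
    simp; omega

/-- small part (scaled) -/
def aq (lam q : ℝ) (n k : ℕ) : ℝ := q * ((n : ℝ) ^ k * al (lam / n) k)

def SS (lam q : ℝ) (n : ℕ) (r : ℝ) (l : ℕ) : ℝ :=
  expC (fun k => if (k : ℝ) ≤ r then aq lam q n k else 0) l

def BB (lam q : ℝ) (n : ℕ) (r : ℝ) (m : ℕ) : ℝ :=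
  expC (fun k => if r < (k : ℝ) then aq lam q n k else 0) m

def pre (lam : ℝ) (n : ℕ) : ℝ := (n.factorial : ℝ) / (eh (lam / n) n * (n : ℝ) ^ n)

lemma Pf_event2 (n : ℕ) (hn : 1 ≤ n) (lam q t r : ℝ) (h : lam / n < 1) :
    Pf (lam / n) (fun k => if r < (k : ℝ) then t ^ k * q else q) (Fin n) =
      ∑ m ∈ Finset.range (n + 1), (pre lam n * BB lam q n r m * SS lam q n r (n - m)) * t ^ m := by
  have h0 := Pf_expC h (fun k => if r < (k : ℝ) then t ^ k * q else q) n
  have hn' : (n : ℝ) ≠ 0 := by positivity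
  have h1 := expC_scale (fun k => al (lam/n) k * (if r < (k : ℝ) then t ^ k * q else q)) (n:ℝ) n
  have h2 : expC (fun k => (n:ℝ)^k * (al (lam/n) k * (if r < (k : ℝ) then t ^ k * q else q))) n =
    expC (fun k => t ^ k * (if r < (k : ℝ) then aq lam q n k else 0) +
      (if (k : ℝ) ≤ r then aq lam q n k else 0)) n := by
    congr 1
    funext k
    unfold aq
    by_cases hk : r < (k : ℝ)
    · rw [if_pos hk, if_pos hk, if_neg (not_le.2 hk)]; ring
    · rw [if_neg hk, if_neg hk, if_pos (not_lt.1 hk)]; ring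
  rw [h2, expC_add, ← h0] at h1
  simp only [← expC_scale] at h1
  have e := (eh_pos (lam/n) n).ne'
  have h3 : Pf (lam / n) (fun k => if r < (k : ℝ) then t ^ k * q else q) (Fin n) =
    pre lam n * ((n:ℝ)^n * (Pf (lam / n) (fun k => if r < (k : ℝ) then t ^ k * q else q) (Fin n) *
      eh (lam/n) n / (n.factorial : ℝ))) := by
    unfold pre
    generalize Pf (lam / n) (fun k => if r < (k : ℝ) then t ^ k * q else q) (Fin n) = X
    field_simp
  rw [h3, h1, Finset.mul_sum]
  refine Finset.sum_congr rfl (fun m _ => ?_)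
  unfold BB SS
  ring

lemma ZP_event (n : ℕ) (hn : 1 ≤ n) (lam q r : ℝ) (h : lam / n < 1) (m : ℕ) (hm : m ≤ n) :
    Zrc n lam q {G | (Vbig G r).ncard = m} =
      pre lam n * BB lam q n r m * SS lam q n r (n - m) := by
  have key : (∑ m ∈ Finset.range (n + 1), Polynomial.monomial m
      (ZP n (lam/n) q {G | (Vbig G r).ncard = m})) = ∑ m ∈ Finset.range (n + 1),
        Polynomial.monomial m (pre lam n * BB lam q n r m * SS lam q n r (n - m)) := by
    apply Polynomial.funext
    intro t
    simp only [Polynomial.eval_finsetSum, Polynomial.eval_monomial]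
    rw [← Pf_event, Pf_event2 n hn lam q t r h]
  have := congrArg (fun P => P.coeff m) key
  simp only [Polynomial.finsetSum_coeff, Polynomial.coeff_monomial, Finset.sum_ite_eq',
    Finset.mem_range, Nat.lt_succ_of_le hm, if_true] at this
  exact this

lemma Ztot_event (n : ℕ) (hn : 1 ≤ n) (lam q r : ℝ) (h : lam / n < 1) :
    Ztot n lam q =
      ∑ m ∈ Finset.range (n + 1), pre lam n * BB lam q n r m * SS lam q n r (n - m) := by
  have h1 := Pf_event n (lam/n) q 1 r
  have h2 := Pf_event2 n hn lam q 1 r h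
  simp only [one_pow, mul_one] at h1 h2
  rw [← h2]
  unfold Ztot Zrc ZP Pf
  simp only [Set.mem_univ, finsum_true]
  refine finsum_congr (fun G => ?_)
  have := cw_event q 1 r G
  simp only [one_pow, mul_one] at this
  rw [this]
  unfold ew rcW
  rw [Nat.card_fin]

-- PART 5

lemma hasSum_cg {f g : ℕ → ℝ} {a b : ℝ} (h : HasSum f a) (hfg : ∀ n, g n = f n) (hab : b = a) :
    HasSum g b := by
  have : g = f := funext hfg
  rw [this, hab]; exact h

lemma expC_single (K : ℕ) (c : ℝ) (n : ℕ) :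
    expC (fun k => if k = K + 1 then c else 0) n =
      if (K + 1) ∣ n then c ^ (n / (K + 1)) / ((n / (K + 1)).factorial : ℝ) else 0 := by
  symm
  apply expC_unique _ (fun n => if (K + 1) ∣ n then c ^ (n / (K + 1)) /
    ((n / (K + 1)).factorial : ℝ) else 0)
  · simp
  · intro n
    have h1 : ∀ k ∈ Finset.range (n + 1), ((k : ℝ) + 1) * (if k + 1 = K + 1 then c else 0) *
        (if (K + 1) ∣ (n - k) then c ^ ((n - k) / (K + 1)) /
          (((n - k) / (K + 1)).factorial : ℝ) else 0) =
        if k = K then ((K : ℝ) + 1) * c * (if (K + 1) ∣ (n - K) then c ^ ((n - K) / (K + 1)) /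
          (((n - K) / (K + 1)).factorial : ℝ) else 0) else 0 := by
      intro k _
      by_cases hk : k = K
      · subst hk; simp
      · rw [if_neg hk, if_neg (by omega)]; simp
    rw [Finset.sum_congr rfl h1, Finset.sum_ite_eq']
    by_cases hK : K ≤ n
    · rw [if_pos (Finset.mem_range.2 (by omega))]
      have e : n + 1 = (n - K) + (K + 1) := by omega
      by_cases hd : (K + 1) ∣ (n - K)
      · rw [if_pos hd, if_pos (by rw [e]; exact Dvd.dvd.add hd (dvd_refl _))]
        obtain ⟨m, hm⟩ := hd
        have e2 : n + 1 = (K + 1) * (m + 1) := by rw [e, hm]; ring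
        rw [e2, hm, Nat.mul_div_cancel_left _ (Nat.succ_pos K),
          Nat.mul_div_cancel_left _ (Nat.succ_pos K), Nat.factorial_succ]
        have e3 : (n : ℝ) + 1 = ((K : ℝ) + 1) * (m + 1) := by exact_mod_cast e2
        rw [e3]
        push_cast
        have : ((m : ℝ) + 1) ≠ 0 := by positivity
        field_simp
        ring
      · rw [if_neg hd, if_neg]
        · ring
        · rw [e, Nat.dvd_add_left (dvd_refl _)]; exact hd
    · have hnd : ¬ (K + 1) ∣ (n + 1) := by
        intro h
        have := Nat.le_of_dvd (by omega) h
        omega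
      have hr : K ∉ Finset.range (n + 1) := by
        rw [Finset.mem_range]; omega
      rw [if_neg hnd, if_neg hr, mul_zero]

lemma expC_single_hasSum (K : ℕ) (c : ℝ) :
    HasSum (expC (fun k => if k = K + 1 then c else 0)) (Real.exp c) := by
  have hi : Function.Injective (fun m : ℕ => (K + 1) * m) := by
    intro a b h
    exact Nat.eq_of_mul_eq_mul_left (Nat.succ_pos K) h
  rw [← hi.hasSum_iff]
  · have : (expC (fun k => if k = K + 1 then c else 0)) ∘ (fun m : ℕ => (K + 1) * m) =
      fun m : ℕ => c ^ m / (m.factorial : ℝ) := by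
      funext m
      simp only [Function.comp]
      rw [expC_single, if_pos (dvd_mul_right _ _), Nat.mul_div_cancel_left _ (Nat.succ_pos K)]
    rw [this, Real.exp_eq_exp_ℝ]
    exact NormedSpace.expSeries_div_hasSum_exp c
  · intro n hn
    rw [expC_single, if_neg]
    rintro ⟨m, rfl⟩
    exact hn ⟨m, rfl⟩

lemma expC_hasSum {b : ℕ → ℝ} (hb : ∀ k, 0 ≤ b k) (K : ℕ) :
    HasSum (expC (fun k => if k ≤ K then b k else 0))
      (Real.exp (∑ k ∈ Finset.range K, b (k + 1))) := by
  induction K with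
  | zero =>
    have : expC (fun k => if k ≤ 0 then b k else 0) = fun n => if n = 0 then 1 else 0 := by
      funext n
      rw [expC_congr (b := fun _ => 0) (by intro k hk; rw [if_neg (by omega)])]
      symm
      apply expC_unique (fun _ => 0) (fun n => if n = 0 then 1 else 0)
      · simp
      · intro n; simp
    rw [this]
    simpa using hasSum_ite_eq (0:ℕ) (1:ℝ)
  | succ K ih =>
    have h1 := expC_single_hasSum K (b (K + 1))
    have hn1 : ∀ n, 0 ≤ expC (fun k => if k ≤ K then b k else 0) n := fun n =>
      expC_nonneg (by intro k; split_ifs; exacts [hb k, le_rfl]) n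
    have hn2 : ∀ n, 0 ≤ expC (fun k => if k = K + 1 then b (K + 1) else 0) n := fun n =>
      expC_nonneg (by intro k; split_ifs; exacts [hb _, le_rfl]) n
    have h2 := hasSum_sum_range_mul_of_summable_norm ih.summable.norm h1.summable.norm
    rw [ih.tsum_eq, h1.tsum_eq, ← Real.exp_add] at h2
    rw [Finset.sum_range_succ]
    refine hasSum_cg h2 (fun n => ?_) rfl
    rw [← expC_add]
    congr 1
    funext k
    by_cases h : k = K + 1
    · subst h; simp
    · by_cases h' : k ≤ K
      · rw [if_pos h', if_pos (by omega), if_neg h, add_zero]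
      · rw [if_neg h', if_neg (by omega), if_neg h, add_zero]

lemma expC_chernoff {a : ℕ → ℝ} (ha : ∀ k, 0 ≤ a k) (K : ℕ) (hK : ∀ k, K < k → a k = 0)
    (y : ℝ) (hy : 0 ≤ y) (l : ℕ) :
    y ^ l * expC a l ≤ Real.exp (∑ k ∈ Finset.range K, a (k + 1) * y ^ (k + 1)) := by
  rw [expC_scale]
  have hb : ∀ k, 0 ≤ a k * y ^ k := fun k => mul_nonneg (ha k) (pow_nonneg hy k)
  have h := expC_hasSum hb K
  have e : expC (fun k => y ^ k * a k) l = expC (fun k => if k ≤ K then a k * y ^ k else 0) l := by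
    congr 1; funext k
    split_ifs with h
    · ring
    · rw [hK k (not_le.1 h), mul_zero]
  rw [e]
  exact le_hasSum h l (fun j _ => expC_nonneg (by intro k; split_ifs; exacts [hb k, le_rfl]) j)

/-- tree coefficients -/
def tw : ℕ → ℝ
  | 0 => 1
  | n + 1 => (∑ k : Fin (n + 1), ((k : ℕ) + 1 : ℝ) * tw k * tw (n - k)) / (n + 1)

lemma tw_zero : tw 0 = 1 := by rw [tw]

lemma tw_succ (n : ℕ) : ((n : ℝ) + 1) * tw (n + 1) =
    ∑ k ∈ Finset.range (n + 1), ((k : ℝ) + 1) * tw k * tw (n - k) := by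
  rw [tw, Finset.sum_range]
  field_simp

lemma tw_pos (n : ℕ) : 0 < tw n := by
  induction n using Nat.strong_induction_on with
  | _ n ih =>
    cases n with
    | zero => rw [tw_zero]; norm_num
    | succ n =>
      have h := tw_succ n
      have : 0 < ∑ k ∈ Finset.range (n + 1), ((k : ℝ) + 1) * tw k * tw (n - k) := by
        apply Finset.sum_pos
        · intro k hk
          have := ih k (Finset.mem_range.1 hk)
          have := ih (n - k) (by omega)
          positivity
        · simp
      rw [← h] at this
      exact pos_of_mul_pos_right this (by positivity)

def wt (k : ℕ) : ℝ := if k = 0 then 0 else tw (k - 1)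

lemma wt_nonneg (k : ℕ) : 0 ≤ wt k := by
  unfold wt; split_ifs; exacts [le_rfl, (tw_pos _).le]

lemma tw_expC (n : ℕ) : tw n = expC wt n := by
  apply expC_unique
  · exact tw_zero
  · intro n
    rw [tw_succ]
    simp [wt]

lemma expC_trunc (a : ℕ → ℝ) (K n : ℕ) (h : n ≤ K) :
    expC (fun k => if k ≤ K then a k else 0) n = expC a n := by
  induction n using Nat.strong_induction_on with
  | _ n ih =>
    cases n with
    | zero => rw [expC_zero, expC_zero]
    | succ n =>
      have h1 := expC_succ a n
      have h2 := expC_succ (fun k => if k ≤ K then a k else 0) n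
      have : ((n : ℝ) + 1) ≠ 0 := by positivity
      apply mul_left_cancel₀ this
      rw [h1, h2]
      refine Finset.sum_congr rfl (fun k hk => ?_)
      have hk := Finset.mem_range.1 hk
      rw [if_pos (by omega), ih (n - k) (by omega) (by omega)]

/-- partial sums of tree function -/
lemma tw_partial {τ : ℝ} (h0 : 0 ≤ τ) (K : ℕ) :
    ∑ k ∈ Finset.range K, tw k * (τ * Real.exp (-τ)) ^ (k + 1) ≤ τ := by
  set z := τ * Real.exp (-τ) with hz
  have hz0 : 0 ≤ z := by positivity
  induction K with
  | zero => simpa using h0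
  | succ K ih =>
    have hb : ∀ k, 0 ≤ wt k * z ^ k := fun k => mul_nonneg (wt_nonneg k) (pow_nonneg hz0 k)
    have h := expC_hasSum hb K
    have e : ∀ k ∈ Finset.range (K + 1), tw k * z ^ (k + 1) =
        z * expC (fun k => if k ≤ K then wt k * z ^ k else 0) k := by
      intro k hk
      rw [expC_trunc _ _ _ (by have := Finset.mem_range.1 hk; omega), tw_expC]
      have := expC_scale wt z k
      rw [show (fun k => wt k * z ^ k) = fun k => z ^ k * wt k by funext k; ring, ← this]
      ring
    rw [Finset.sum_congr rfl e, ← Finset.mul_sum]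
    have h1 : ∑ k ∈ Finset.range (K + 1), expC (fun k => if k ≤ K then wt k * z ^ k else 0) k ≤
        Real.exp (∑ k ∈ Finset.range K, wt (k + 1) * z ^ (k + 1)) :=
      sum_le_hasSum _ (fun j _ => expC_nonneg (by intro k; split_ifs; exacts [hb k, le_rfl]) j) h
    have h2 : ∑ k ∈ Finset.range K, wt (k + 1) * z ^ (k + 1) ≤ τ := by
      simpa [wt] using ih
    calc z * _ ≤ z * Real.exp τ := by
          apply mul_le_mul_of_nonneg_left _ hz0
          exact h1.trans (Real.exp_le_exp.2 h2)
      _ = τ := by rw [hz, mul_assoc, ← Real.exp_add]; simp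

lemma tw_hasSum {τ : ℝ} (h0 : 0 ≤ τ) (h1 : τ ≤ 1) :
    HasSum (fun k => tw k * (τ * Real.exp (-τ)) ^ (k + 1)) τ := by
  set z := τ * Real.exp (-τ) with hz
  have hz0 : 0 ≤ z := by positivity
  have hnn : ∀ k, 0 ≤ tw k * z ^ (k + 1) := fun k => mul_nonneg (tw_pos k).le (pow_nonneg hz0 _)
  have hs : Summable (fun k => tw k * z ^ (k + 1)) :=
    summable_of_sum_range_le hnn (tw_partial h0)
  obtain ⟨W, hW⟩ := hs
  have hW1 : W ≤ τ := le_of_tendsto' hW.tendsto_sum_nat (tw_partial h0)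
  have hW0 : 0 ≤ W := hW.nonneg hnn
  have hb : ∀ k, 0 ≤ wt k * z ^ k := fun k => mul_nonneg (wt_nonneg k) (pow_nonneg hz0 k)
  have h2 : ∀ K, z * Real.exp (∑ k ∈ Finset.range K, tw k * z ^ (k + 1)) ≤ W := by
    intro K
    have h := (expC_hasSum hb K).mul_left z
    have e : ∑ k ∈ Finset.range K, wt (k + 1) * z ^ (k + 1) =
      ∑ k ∈ Finset.range K, tw k * z ^ (k + 1) := by simp [wt]
    rw [e] at h
    refine hasSum_le (fun k => ?_) h hW
    have := expC_scale wt z k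
    rw [tw_expC, show expC wt k * z ^ (k + 1) = z * (z ^ k * expC wt k) by ring, this]
    apply mul_le_mul_of_nonneg_left _ hz0
    apply expC_mono
    · intro k; split_ifs; exacts [hb k, le_rfl]
    · intro k; split_ifs
      · exact le_of_eq (by ring)
      · rw [mul_comm]; exact hb k
  have h3 : z * Real.exp W ≤ W := by
    have : Tendsto (fun K => z * Real.exp (∑ k ∈ Finset.range K, tw k * z ^ (k + 1))) atTop
      (𝓝 (z * Real.exp W)) :=
      ((Real.continuous_exp.tendsto W).comp hW.tendsto_sum_nat).const_mul z
    exact le_of_tendsto' this h2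
  have : W = τ := by
    by_contra hne
    have hlt : W < τ := lt_of_le_of_ne hW1 hne
    have hd : 1 - (τ - W) < Real.exp (-(τ - W)) := by
      have := Real.add_one_lt_exp (x := -(τ - W)) (by linarith)
      linarith
    have h4 : z * Real.exp W = τ * Real.exp (-(τ - W)) := by
      rw [hz, mul_assoc, ← Real.exp_add]; congr 2; ring
    rw [h4] at h3
    have : τ * (1 - (τ - W)) < W := lt_of_lt_of_le (mul_lt_mul_of_pos_left hd (by linarith)) h3
    nlinarith
  rwa [this] at hW

lemma tw_conv (n : ℕ) : ∑ k ∈ Finset.range (n + 1), tw k * tw (n - k) =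
    2 * ((n : ℝ) + 1) / (n + 2) * tw (n + 1) := by
  have h1 := tw_succ n
  have h2 := Finset.sum_range_reflect (fun k => ((k : ℝ) + 1) * tw k * tw (n - k)) (n + 1)
  rw [← h1] at h2
  have h3 : ∀ k ∈ Finset.range (n+1), (((n + 1 - 1 - k : ℕ) : ℝ) + 1) * tw (n + 1 - 1 - k) *
      tw (n - (n + 1 - 1 - k)) = ((n : ℝ) - k + 1) * (tw k * tw (n - k)) := by
    intro k hk
    have hk := Finset.mem_range.1 hk
    rw [show n + 1 - 1 - k = n - k by omega, show n - (n - k) = k by omega,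
      Nat.cast_sub (by omega)]
    ring
  rw [Finset.sum_congr rfl h3] at h2
  have h4 : ((n : ℝ) + 2) * ∑ k ∈ Finset.range (n + 1), tw k * tw (n - k) =
      2 * (((n : ℝ) + 1) * tw (n + 1)) := by
    rw [two_mul]
    nth_rewrite 1 [h1]
    rw [← h2, ← Finset.sum_add_distrib, Finset.mul_sum]
    refine Finset.sum_congr rfl (fun k _ => ?_)
    ring
  have : (n : ℝ) + 2 ≠ 0 := by positivity
  field_simp
  linarith

lemma tv_hasSum {τ : ℝ} (h0 : 0 ≤ τ) (h1 : τ ≤ 1) :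
    HasSum (fun k : ℕ => tw k / (k + 1) * (τ * Real.exp (-τ)) ^ (k + 1)) (τ - τ ^ 2 / 2) := by
  have hW := tw_hasSum h0 h1
  set z := τ * Real.exp (-τ) with hz
  have hz0 : 0 ≤ z := by positivity
  have hc := hasSum_sum_range_mul_of_summable_norm hW.summable.norm hW.summable.norm
  rw [hW.tsum_eq] at hc
  have hc2 : ∀ n : ℕ, ∑ k ∈ Finset.range (n + 1), tw k * z ^ (k + 1) * (tw (n - k) * z ^ (n - k + 1)) =
      2 * ((n : ℝ) + 1) / (n + 2) * tw (n + 1) * z ^ (n + 2) := by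
    intro n
    rw [← tw_conv, Finset.sum_mul]
    refine Finset.sum_congr rfl (fun k hk => ?_)
    have hk := Finset.mem_range.1 hk
    rw [show n + 2 = (k + 1) + (n - k + 1) by omega, pow_add]
    ring
  simp only [hc2] at hc
  have hc3 : HasSum (fun n : ℕ => (n : ℝ) / (n + 1) * tw n * z ^ (n + 1)) (τ ^ 2 / 2) := by
    rw [← hasSum_nat_add_iff' 1]
    simp only [Finset.range_one, Finset.sum_singleton, Nat.cast_zero, zero_div, zero_mul, sub_zero]
    have := hc.div_const 2
    refine hasSum_cg this (fun n => ?_) ?_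
    · push_cast
      have : (n : ℝ) + 2 ≠ 0 := by positivity
      have : (n : ℝ) + 1 + 1 ≠ 0 := by positivity
      field_simp
      ring
    · ring
  refine hasSum_cg (hW.sub hc3) (fun n => ?_) rfl
  have : (n : ℝ) + 1 ≠ 0 := by positivity
  field_simp
  ring

lemma cc_micro_upper {p : ℝ} (h0 : 0 ≤ p) (h1 : p < 1) (k : ℕ) :
    cc p (k + 1) ≤ (k.factorial : ℝ) * tw k * p ^ k := by
  induction k using Nat.strong_induction_on with
  | _ k ih =>
    cases k with
    | zero => simp [cc_one, tw_zero]
    | succ n =>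
      have h := cc_rec h1 n
      have hp : 0 ≤ 1 - p := by linarith
      have hf : ∀ j : ℕ, (0:ℝ) < j.factorial := fun j => by positivity
      have h2 : cc p (n + 2) / (n.factorial : ℝ) ≤ ((n : ℝ) + 1) * tw (n + 1) * p ^ (n + 1) := by
        rw [h, tw_succ, Finset.sum_mul]
        refine Finset.sum_le_sum (fun i hi => ?_)
        have hi := Finset.mem_range.1 hi
        have a1 : cc p (i + 1) / (i.factorial : ℝ) ≤ tw i * p ^ i := by
          rw [div_le_iff₀ (hf i)]; linarith [ih i hi]
        have a2 : cc p (n - i + 1) / ((n - i).factorial : ℝ) ≤ tw (n - i) * p ^ (n - i) := by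
          rw [div_le_iff₀ (hf _)]; linarith [ih (n - i) (by omega)]
        have a3 : 1 - (1 - p) ^ (i + 1) ≤ ((i : ℝ) + 1) * p := by
          have := one_add_mul_le_pow (a := -p) (by linarith) (i + 1)
          push_cast at this
          rw [← sub_eq_add_neg] at this
          linarith
        have a3' : 0 ≤ 1 - (1 - p) ^ (i + 1) := by
          have := pow_le_one₀ hp (by linarith : 1 - p ≤ 1) (n := i + 1)
          linarith
        have a4 : (1 - p) ^ ((i + 1) * (n - i)) ≤ 1 := pow_le_one₀ hp (by linarith)
        have a5 : 0 ≤ (1 - p) ^ ((i + 1) * (n - i)) := pow_nonneg hp _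
        have b1 : 0 ≤ cc p (i + 1) / (i.factorial : ℝ) := div_nonneg (cc_nonneg h0 h1.le _) (hf _).le
        have b2 : 0 ≤ cc p (n - i + 1) / ((n - i).factorial : ℝ) :=
          div_nonneg (cc_nonneg h0 h1.le _) (hf _).le
        have b3 := (tw_pos i).le
        have b4 := (tw_pos (n - i)).le
        calc _ ≤ (((i : ℝ) + 1) * p) * 1 * (tw i * p ^ i) * (tw (n - i) * p ^ (n - i)) := by
              gcongr
          _ = ((i : ℝ) + 1) * tw i * tw (n - i) * p ^ (n + 1) := by
              rw [show n + 1 = i + (n - i) + 1 by omega, pow_succ, pow_add]; ring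
      rw [div_le_iff₀ (hf n)] at h2
      rw [Nat.factorial_succ]
      push_cast
      linarith

lemma cc_micro_limit (k : ℕ) :
    Tendsto (fun p => cc p (k + 1) / p ^ k) (𝓝[>] 0) (𝓝 ((k.factorial : ℝ) * tw k)) := by
  induction k using Nat.strong_induction_on with
  | _ k ih =>
    cases k with
    | zero => simp [cc_one, tw_zero]
    | succ n =>
      have hid : Tendsto (fun p : ℝ => p) (𝓝[>] 0) (𝓝 0) := tendsto_nhdsWithin_of_tendsto_nhds tendsto_id
      have hpw : ∀ m : ℕ, Tendsto (fun p : ℝ => (1 - p) ^ m) (𝓝[>] 0) (𝓝 1) := by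
        intro m
        have := (hid.const_sub 1).pow m
        simpa using this
      have h : Tendsto (fun p : ℝ => (n.factorial : ℝ) * ∑ i ∈ Finset.range (n + 1),
          (∑ j ∈ Finset.range (i + 1), (1 - p) ^ j) * (1 - p) ^ ((i + 1) * (n - i)) *
            ((cc p (i + 1) / p ^ i) / (i.factorial : ℝ)) *
            ((cc p (n - i + 1) / p ^ (n - i)) / ((n - i).factorial : ℝ))) (𝓝[>] 0)
          (𝓝 ((n.factorial : ℝ) * ∑ i ∈ Finset.range (n + 1),
          (∑ j ∈ Finset.range (i + 1), 1) * 1 *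
            (((i.factorial : ℝ) * tw i) / (i.factorial : ℝ)) *
            ((((n - i).factorial : ℝ) * tw (n - i)) / ((n - i).factorial : ℝ)))) := by
        apply Tendsto.const_mul
        apply tendsto_finsetSum
        intro i hi
        have hi := Finset.mem_range.1 hi
        refine ((Tendsto.mul (tendsto_finsetSum _ (fun j _ => hpw j)) (hpw _)).mul
          ((ih i hi).div_const _)).mul ((ih (n - i) (by omega)).div_const _)
      have e : (n.factorial : ℝ) * ∑ i ∈ Finset.range (n + 1),
          (∑ j ∈ Finset.range (i + 1), (1:ℝ)) * 1 *
            (((i.factorial : ℝ) * tw i) / (i.factorial : ℝ)) *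
            ((((n - i).factorial : ℝ) * tw (n - i)) / ((n - i).factorial : ℝ)) =
          ((n + 1).factorial : ℝ) * tw (n + 1) := by
        rw [Nat.factorial_succ]
        push_cast
        rw [show ((n : ℝ) + 1) * (n.factorial : ℝ) * tw (n + 1) =
          (n.factorial : ℝ) * (((n : ℝ) + 1) * tw (n + 1)) by ring, tw_succ]
        congr 1
        refine Finset.sum_congr rfl (fun i _ => ?_)
        have : (i.factorial : ℝ) ≠ 0 := by positivity
        have : ((n - i).factorial : ℝ) ≠ 0 := by positivity
        simp
        field_simp
      rw [e] at h
      refine h.congr' ?_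
      have hmem : ∀ᶠ p in 𝓝[>] (0:ℝ), p < 1 := hid.eventually (gt_mem_nhds one_pos)
      filter_upwards [self_mem_nhdsWithin, hmem] with p hp0 hp1
      have hp0 : 0 < p := hp0
      have hr := cc_rec hp1 n
      have : (n.factorial : ℝ) ≠ 0 := by positivity
      rw [div_eq_iff this] at hr
      rw [hr, mul_comm, Finset.sum_mul, Finset.sum_mul, Finset.sum_div]
      refine Finset.sum_congr rfl (fun i hi => ?_)
      have hi := Finset.mem_range.1 hi
      have hg : 1 - (1 - p) ^ (i + 1) = p * ∑ j ∈ Finset.range (i + 1), (1 - p) ^ j := by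
        have := mul_neg_geom_sum (1 - p) (i + 1)
        rw [← this]; ring
      rw [hg, show n + 1 = i + (n - i) + 1 by omega, pow_succ, pow_add]
      field_simp

-- PART 6

lemma cc_giant {p : ℝ} (h0 : 0 ≤ p) (h1 : p < 1) (k : ℕ) (hk : 1 ≤ k) {ζ : ℝ} (hζ0 : 0 < ζ)
    (hζ1 : ζ < 1) : cc p k ≤ (1 - ζ * (1 - p) ^ k) ^ k / (1 - ζ) := by
  obtain ⟨j, rfl⟩ : ∃ j, k = j + 1 := ⟨k - 1, by omega⟩
  have hp : 0 ≤ 1 - p := by linarith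
  set z := (1 - p) ^ (j + 1) with hz
  have hz0 : 0 ≤ z := pow_nonneg hp _
  have hz1 : z ≤ 1 := pow_le_one₀ hp (by linarith)
  have hr : ‖ζ * z‖ < 1 := by
    rw [Real.norm_of_nonneg (by positivity)]
    nlinarith
  have hr' : ζ * z < 1 := by nlinarith
  have hS := (hasSum_choose_mul_geometric_of_norm_lt_one j hr).mul_left (cc p (j + 1))
  have hG := hasSum_geometric_of_lt_one hζ0.le hζ1
  have hle : cc p (j + 1) * (1 / (1 - ζ * z) ^ (j + 1)) ≤ (1 - ζ)⁻¹ := by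
    refine hasSum_le (fun m => ?_) hS hG
    have hsum := cc_sum p (m + j)
    have h2 : ((m + j).choose j : ℝ) * cc p (j + 1) * (1 - p) ^ ((j + 1) * (m + j - j)) ≤ 1 := by
      refine le_trans ?_ hsum.le
      apply Finset.single_le_sum (f := fun k => ((m + j).choose k : ℝ) * cc p (k + 1) *
        (1 - p) ^ ((k + 1) * (m + j - k))) (s := Finset.range (m + j + 1))
      · intro k _
        have := cc_nonneg h0 h1.le (k + 1)
        positivity
      · rw [Finset.mem_range]; omega
    rw [Nat.add_sub_cancel, pow_mul, ← hz] at h2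
    have h3 : 0 ≤ ζ ^ m := by positivity
    calc cc p (j + 1) * (((m + j).choose j : ℝ) * (ζ * z) ^ m)
        = ζ ^ m * (((m + j).choose j : ℝ) * cc p (j + 1) * z ^ m) := by rw [mul_pow]; ring
      _ ≤ ζ ^ m * 1 := mul_le_mul_of_nonneg_left h2 h3
      _ = ζ ^ m := mul_one _
  have hpos : 0 < (1 - ζ * z) ^ (j + 1) := by
    apply pow_pos; linarith
  have h1ζ : 0 < 1 - ζ := by linarith
  rw [le_div_iff₀ h1ζ]
  rw [mul_one_div, div_le_iff₀ hpos, inv_mul_eq_div, le_div_iff₀ h1ζ] at hle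
  exact hle

lemma neg_log_one_sub_le {p : ℝ} (h0 : 0 ≤ p) (h1 : p ≤ 1 / 2) : -Real.log (1 - p) ≤ p + p ^ 2 := by
  have h2 : 0 < 1 - p := by linarith
  have h := Real.one_sub_inv_le_log_of_pos h2
  -- need a sharper bound
  have hx : 1 ≤ (1 - p) * Real.exp (p + p ^ 2) := by
    have : 1 + (p + p ^ 2) + (p + p ^ 2) ^ 2 / 2 ≤ Real.exp (p + p ^ 2) :=
      Real.quadratic_le_exp_of_nonneg (by positivity)
    have h3 : 1 ≤ (1 - p) * (1 + (p + p ^ 2) + (p + p ^ 2) ^ 2 / 2) := by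
      nlinarith [mul_nonneg h0 h0, mul_nonneg (mul_nonneg h0 h0) h0, mul_nonneg (mul_nonneg h0 h0) (by linarith : 0 ≤ 1/2 - p), mul_nonneg (mul_nonneg (mul_nonneg h0 h0) h0) (by linarith : 0 ≤ 1/2 - p), mul_nonneg (mul_nonneg (mul_nonneg (mul_nonneg h0 h0) h0) h0) (by linarith : 0 ≤ 1/2 - p)]
    nlinarith
  have := Real.log_le_log one_pos hx
  rw [Real.log_one, Real.log_mul h2.ne' (Real.exp_pos _).ne', Real.log_exp] at this
  linarith

lemma le_neg_log_one_sub {p : ℝ} (h1 : p < 1) : p ≤ -Real.log (1 - p) := by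
  have := Real.log_le_sub_one_of_pos (by linarith : 0 < 1 - p)
  linarith

lemma fact_lower (k : ℕ) : Real.exp ((k : ℝ) * Real.log k - k) ≤ (k.factorial : ℝ) := by
  rcases Nat.eq_zero_or_pos k with rfl | hk
  · simp
  have hk' : (0:ℝ) < k := by exact_mod_cast hk
  have h := Real.pow_div_factorial_le_exp (k : ℝ) hk'.le k
  rw [div_le_iff₀ (by positivity)] at h
  rw [Real.exp_sub, Real.exp_nat_mul, Real.exp_log hk', div_le_iff₀ (Real.exp_pos _)]
  linarith

lemma fact_upper (k : ℕ) (hk : 1 ≤ k) :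
    (k.factorial : ℝ) ≤ Real.exp 1 * k * Real.exp ((k : ℝ) * Real.log k - k) := by
  induction k, hk using Nat.le_induction with
  | base => simp [← Real.exp_add]
  | succ k hk ih =>
    have hk' : (0:ℝ) < k := by exact_mod_cast hk
    rw [Nat.factorial_succ]
    push_cast
    have h1 : Real.exp ((k : ℝ) * Real.log k - k) * k ≤
        Real.exp (((k : ℝ) + 1) * Real.log (k + 1) - (k + 1)) := by
      nth_rewrite 4 [← Real.exp_log hk']
      rw [← Real.exp_add, Real.exp_le_exp]
      have h2 := Real.one_sub_inv_le_log_of_pos (x := ((k : ℝ) + 1) / k) (by positivity)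
      rw [Real.log_div (by positivity) hk'.ne'] at h2
      have h3 : 1 ≤ ((k : ℝ) + 1) * (Real.log (k + 1) - Real.log k) := by
        have h4 : 1 - (((k : ℝ) + 1) / k)⁻¹ = 1 / (k + 1) := by field_simp; ring
        rw [h4, div_le_iff₀ (by positivity)] at h2
        linarith
      linarith
    have h5 : (0:ℝ) < k + 1 := by positivity
    have h6 := Real.exp_pos 1
    calc ((k : ℝ) + 1) * (k.factorial : ℝ) ≤
        ((k : ℝ) + 1) * (Real.exp 1 * k * Real.exp ((k : ℝ) * Real.log k - k)) := by gcongr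
      _ = ((k : ℝ) + 1) * Real.exp 1 * (Real.exp ((k : ℝ) * Real.log k - k) * k) := by ring
      _ ≤ ((k : ℝ) + 1) * Real.exp 1 * Real.exp (((k : ℝ) + 1) * Real.log (k + 1) - (k + 1)) := by
        gcongr
      _ = _ := by ring

/-- rate of a macroscopic component -/
def gr (lam x : ℝ) : ℝ :=
  x * Real.log (1 - Real.exp (-(lam * x))) + lam * x ^ 2 / 2 - x * Real.log x + x

lemma pow_eq_exp {p : ℝ} (h1 : p < 1) (k : ℕ) : (1 - p) ^ k = Real.exp (k * Real.log (1 - p)) := by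
  rw [Real.exp_nat_mul, Real.exp_log (by linarith)]

lemma eh_upper {p : ℝ} (h0 : 0 ≤ p) (h1 : p ≤ 1 / 2) (k : ℕ) :
    eh p k ≤ Real.exp ((p + p ^ 2) * (k : ℝ) ^ 2 / 2) := by
  unfold eh
  apply Real.exp_le_exp.2
  have := neg_log_one_sub_le h0 h1
  have : 0 ≤ (k : ℝ) ^ 2 := by positivity
  nlinarith

lemma eh_lower {p : ℝ} (h1 : p < 1) (k : ℕ) :
    Real.exp (p * (k : ℝ) ^ 2 / 2) ≤ eh p k := by
  unfold eh
  apply Real.exp_le_exp.2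
  have := le_neg_log_one_sub h1
  have : 0 ≤ (k : ℝ) ^ 2 := by positivity
  nlinarith

lemma one_sub_exp_pos {x : ℝ} (hx : 0 < x) : 0 < 1 - Real.exp (-x) := by
  have : Real.exp (-x) < 1 := by rw [Real.exp_lt_one_iff]; linarith
  linarith

lemma al_macro_upper {lam : ℝ} (hl : 0 < lam) {δ : ℝ} (hδ : 0 < δ) :
    ∃ C : ℝ, 0 < C ∧ ∀ᶠ n : ℕ in atTop, ∀ k : ℕ, δ * n ≤ k → k ≤ n →
      (n : ℝ) ^ k * al (lam / n) k ≤ C * n * Real.exp (n * gr lam (k / n)) := by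
  set c0 := 1 - Real.exp (-(lam * δ)) with hc0
  have hc0p : 0 < c0 := one_sub_exp_pos (by positivity)
  refine ⟨Real.exp ((lam ^ 2 + 1) / c0) * Real.exp (lam ^ 2 / 2), by positivity, ?_⟩
  obtain ⟨N, hN⟩ := exists_nat_gt (2 * lam)
  filter_upwards [eventually_ge_atTop (max N 2)] with n hn k hk1 hk2
  have hnN : (N : ℝ) ≤ n := by exact_mod_cast (le_max_left _ _).trans hn
  have hn2 : (2 : ℝ) ≤ n := by exact_mod_cast (le_max_right _ _).trans hn
  have hn0 : (0:ℝ) < n := by linarith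
  have hk0 : (0:ℝ) < k := by nlinarith
  have hk1' : 1 ≤ k := by exact_mod_cast (by exact_mod_cast hk0 : 0 < k)
  have hkn : (k : ℝ) ≤ n := by exact_mod_cast hk2
  set p := lam / n with hp
  have hp0 : 0 < p := by positivity
  have hp1 : p ≤ 1 / 2 := by rw [hp, div_le_div_iff₀ hn0 two_pos]; linarith
  have hpl : p < 1 := by linarith
  have hpn : p * n = lam := by rw [hp]; field_simp
  set z := (1 - p) ^ k with hz
  have hz0 : 0 ≤ z := pow_nonneg (by linarith) _
  have hz1 : z ≤ 1 := pow_le_one₀ (by linarith) (by linarith)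
  set E := 1 - Real.exp (-(lam * (k / n))) with hE
  have hpk : p * k = lam * (k / n) := by rw [hp]; ring
  have hEc : c0 ≤ E := by
    rw [hc0, hE]
    have : δ ≤ k / n := by rw [le_div_iff₀ hn0]; exact hk1
    have : Real.exp (-(lam * (k / n))) ≤ Real.exp (-(lam * δ)) := by
      apply Real.exp_le_exp.2; nlinarith
    linarith
  have hE0 : 0 < E := by linarith
  -- cc bound
  have hinv : (0:ℝ) < 1 / n := by positivity
  have hcc := cc_giant hp0.le hpl k hk1' (ζ := 1 - 1 / n)
    (by have : 1 / (n:ℝ) < 1 := by rw [div_lt_one hn0]; linarith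
        linarith) (by linarith)
  have hden : 1 - (1 - 1 / (n:ℝ)) = 1 / n := by ring
  rw [hden, div_div_eq_mul_div, div_one, ← hz] at hcc
  have hzl : Real.exp (-(p * k)) - p ^ 2 * k ≤ z := by
    rw [hz, pow_eq_exp hpl]
    have h1 := neg_log_one_sub_le hp0.le hp1
    have h2 : Real.exp (-(p * k) + -(p ^ 2 * k)) ≤ Real.exp (k * Real.log (1 - p)) := by
      apply Real.exp_le_exp.2; nlinarith
    rw [Real.exp_add] at h2
    have h3 := Real.add_one_le_exp (-(p ^ 2 * k))
    have h4 : Real.exp (-(p * k)) ≤ 1 := by rw [Real.exp_le_one_iff]; nlinarith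
    have h5 := Real.exp_pos (-(p * k))
    have h6 : 0 ≤ p ^ 2 * k := by positivity
    nlinarith
  have hp2k : p ^ 2 * k ≤ lam ^ 2 / n := by
    rw [le_div_iff₀ hn0]
    have : p ^ 2 * k * n ≤ p ^ 2 * n * n := by gcongr
    calc _ ≤ p ^ 2 * n * n := this
      _ = (p * n) ^ 2 := by ring
      _ = lam ^ 2 := by rw [hpn]
  have hbase : 1 - (1 - 1 / (n:ℝ)) * z ≤ E * (1 + (lam ^ 2 + 1) / c0 / n) := by
    have h1 : 1 - (1 - 1 / (n:ℝ)) * z ≤ E + (lam ^ 2 + 1) / n := by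
      have : (1 / (n:ℝ)) * z ≤ 1 / n := by nlinarith
      have e1 : E = 1 - Real.exp (-(p * k)) := by rw [hE, hpk]
      have e2 : (lam ^ 2 + 1) / (n:ℝ) = lam ^ 2 / n + 1 / n := by ring
      rw [e1, e2]
      linarith
    have h2 : (lam ^ 2 + 1) / (n:ℝ) ≤ E * ((lam ^ 2 + 1) / c0 / n) := by
      have : (lam ^ 2 + 1) / (n:ℝ) = c0 * ((lam ^ 2 + 1) / c0 / n) := by field_simp
      rw [this]
      gcongr
    linarith
  have hbase0 : 0 ≤ 1 - (1 - 1 / (n:ℝ)) * z := by nlinarith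
  have hcc2 : cc p k ≤ E ^ k * Real.exp ((lam ^ 2 + 1) / c0) * n := by
    refine hcc.trans ?_
    apply mul_le_mul_of_nonneg_right _ hn0.le
    calc (1 - (1 - 1 / (n:ℝ)) * z) ^ k ≤ (E * (1 + (lam ^ 2 + 1) / c0 / n)) ^ k := by gcongr
      _ = E ^ k * (1 + (lam ^ 2 + 1) / c0 / n) ^ k := mul_pow _ _ _
      _ ≤ E ^ k * Real.exp ((lam ^ 2 + 1) / c0) := by
        gcongr
        calc (1 + (lam ^ 2 + 1) / c0 / (n:ℝ)) ^ k ≤ (Real.exp ((lam ^ 2 + 1) / c0 / n)) ^ k := by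
              gcongr
              rw [add_comm]; exact Real.add_one_le_exp _
          _ = Real.exp (k * ((lam ^ 2 + 1) / c0 / n)) := by rw [Real.exp_nat_mul]
          _ ≤ _ := by
            apply Real.exp_le_exp.2
            have : 0 ≤ (lam ^ 2 + 1) / c0 := by positivity
            calc k * ((lam ^ 2 + 1) / c0 / n) ≤ n * ((lam ^ 2 + 1) / c0 / n) := by gcongr
              _ = _ := by field_simp
  have heh : eh p k ≤ Real.exp (lam * (k:ℝ) ^ 2 / (2 * n)) * Real.exp (lam ^ 2 / 2) := by
    refine (eh_upper hp0.le hp1 k).trans ?_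
    rw [← Real.exp_add]
    apply Real.exp_le_exp.2
    have h1 : p * (k:ℝ) ^ 2 / 2 = lam * (k:ℝ) ^ 2 / (2 * n) := by rw [hp]; ring
    have h2 : p ^ 2 * (k:ℝ) ^ 2 ≤ lam ^ 2 := by
      rw [← hpn, mul_pow]; gcongr
    linarith
  have hf := fact_lower k
  have hEk : E ^ k = Real.exp (k * Real.log E) := by rw [Real.exp_nat_mul, Real.exp_log hE0]
  have hnk : (n:ℝ) ^ k = Real.exp (k * Real.log n) := by rw [Real.exp_nat_mul, Real.exp_log hn0]
  have hcc0 := cc_nonneg hp0.le hpl.le k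
  calc (n : ℝ) ^ k * al p k
      ≤ (n : ℝ) ^ k * ((E ^ k * Real.exp ((lam ^ 2 + 1) / c0) * n) *
        (Real.exp (lam * (k:ℝ) ^ 2 / (2 * n)) * Real.exp (lam ^ 2 / 2)) /
          Real.exp ((k : ℝ) * Real.log k - k)) := by
        unfold al
        have := (eh_pos p k).le
        gcongr
    _ = _ := by
      rw [hEk, hnk, div_eq_mul_inv, ← Real.exp_neg]
      have : Real.exp (n * gr lam (k / n)) = Real.exp (k * Real.log n) * Real.exp (k * Real.log E) *
          Real.exp (lam * (k:ℝ) ^ 2 / (2 * n)) * Real.exp (-((k : ℝ) * Real.log k - k)) := by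
        rw [← Real.exp_add, ← Real.exp_add, ← Real.exp_add]
        congr 1
        unfold gr
        rw [← hE, Real.log_div hk0.ne' hn0.ne']
        field_simp
        ring
      rw [this]
      ring

-- PART 7

lemma binom_term_le_one {a : ℝ} (h0 : 0 ≤ a) (h1 : a ≤ 1) (N k : ℕ) (hk : k ≤ N) :
    (N.choose k : ℝ) * a ^ k * (1 - a) ^ (N - k) ≤ 1 := by
  have h := add_pow a (1 - a) N
  rw [add_sub_cancel, one_pow] at h
  have h1' : 0 ≤ 1 - a := by linarith
  have := Finset.single_le_sum (f := fun m => a ^ m * (1 - a) ^ (N - m) * (N.choose m : ℝ))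
    (s := Finset.range (N + 1)) (fun m _ => by positivity) (Finset.mem_range.2 (by omega : k < N + 1))
  rw [← h] at this
  linarith

lemma binom_term_le {a : ℝ} (h0 : 0 ≤ a) (h1 : a ≤ 1) (N k : ℕ) (hk : k ≤ N) (hN : 1 ≤ N) :
    (N.choose k : ℝ) * a ^ k * (1 - a) ^ (N - k) ≤
      Real.exp (-(N * ((k : ℝ) / N - a) ^ 2 / 4)) := by
  have hN0 : (0:ℝ) < N := by exact_mod_cast hN
  set t := ((k : ℝ) / N - a) / 2 with ht
  have hkN : (k : ℝ) / N ≤ 1 := by rw [div_le_one hN0]; exact_mod_cast hk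
  have hkN0 : 0 ≤ (k : ℝ) / N := by positivity
  have htb : |t| ≤ 1 := by rw [abs_le]; constructor <;> linarith
  have h1' : 0 ≤ 1 - a := by linarith
  have he := Real.abs_exp_sub_one_sub_id_le htb
  have he2 : Real.exp t ≤ 1 + t + t ^ 2 := by have := abs_le.1 he; linarith
  have h := add_pow (a * Real.exp t) (1 - a) N
  have hs := Finset.single_le_sum (f := fun m => (a * Real.exp t) ^ m * (1 - a) ^ (N - m) * (N.choose m : ℝ))
    (s := Finset.range (N + 1)) (fun m _ => by positivity) (Finset.mem_range.2 (by omega : k < N + 1))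
  rw [← h] at hs
  have hb : a * Real.exp t + (1 - a) ≤ Real.exp (a * t + t ^ 2) := by
    have := Real.add_one_le_exp (a * t + t ^ 2)
    have : t ^ 2 * a ≤ t ^ 2 := by nlinarith [sq_nonneg t]
    nlinarith
  have hb0 : 0 ≤ a * Real.exp t + (1 - a) := by positivity
  have h3 : (a * Real.exp t + (1 - a)) ^ N ≤ Real.exp (N * (a * t + t ^ 2)) := by
    rw [Real.exp_nat_mul]; gcongr
  have h4 : (N.choose k : ℝ) * a ^ k * (1 - a) ^ (N - k) * Real.exp (k * t) ≤
      Real.exp (N * (a * t + t ^ 2)) := by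
    rw [Real.exp_nat_mul]
    rw [mul_pow] at hs
    linarith
  have h5 : (N.choose k : ℝ) * a ^ k * (1 - a) ^ (N - k) ≤
      Real.exp (N * (a * t + t ^ 2)) * Real.exp (-(k * t)) := by
    rw [Real.exp_neg, ← div_eq_mul_inv, le_div_iff₀ (Real.exp_pos _)]
    exact h4
  rw [← Real.exp_add] at h5
  refine h5.trans (le_of_eq ?_)
  congr 1
  have e : (k : ℝ) = N * (2 * t + a) := by rw [ht]; field_simp; ring
  have e2 : (k : ℝ) / N - a = 2 * t := by rw [ht]; ring
  rw [e2, e]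
  ring

lemma slope_lt {lam a b : ℝ} (hl : 0 < lam) (ha : 0 < a) (hab : a < b) :
    a * (1 - Real.exp (-(lam * b))) < b * (1 - Real.exp (-(lam * a))) := by
  have hb : 0 < b := ha.trans hab
  have h := strictConvexOn_exp.2 (Set.mem_univ (-(lam * b))) (Set.mem_univ (0:ℝ))
    (by nlinarith [mul_pos hl hb] : -(lam * b) ≠ 0) (div_pos ha hb)
    (by rw [sub_pos, div_lt_one hb]; exact hab : 0 < 1 - a / b) (by ring)
  simp only [smul_eq_mul, Real.exp_zero, mul_zero, add_zero, mul_one] at h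
  rw [show a / b * -(lam * b) = -(lam * a) by field_simp] at h
  have h2 : b * Real.exp (-(lam * a)) < b * (a / b * Real.exp (-(lam * b)) + (1 - a / b)) :=
    mul_lt_mul_of_pos_left h hb
  have h3 : b * (a / b * Real.exp (-(lam * b)) + (1 - a / b)) =
    a * Real.exp (-(lam * b)) + b - a := by field_simp; ring
  rw [h3] at h2
  linarith

lemma micro_sum {p lamδ σ s : ℝ} {N : ℕ} (h0 : 0 < p) (h1 : p < 1) (hσ : σ = N * p)
    (hs : 1 < s) (hsσ : s ≤ σ) (hδ : lamδ = s - 1 - Real.log s) (P : ℕ → Prop) [DecidablePred P]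
    (hP : ∀ k, P k → p * (k + 1) ≤ lamδ) :
    ∑ k ∈ (Finset.range (N + 1)).filter P, (N.choose k : ℝ) * cc p (k + 1) *
      (1 - p) ^ ((k + 1) * (N - k)) ≤ 1 / s := by
  have hs0 : 0 < s := by linarith
  have hσ0 : 0 < σ := by linarith
  have key : σ * Real.exp (-σ + lamδ) ≤ Real.exp (-1) := by
    nth_rewrite 1 [← Real.exp_log hσ0]
    rw [← Real.exp_add]
    apply Real.exp_le_exp.2
    have h := Real.log_le_sub_one_of_pos (div_pos hσ0 hs0)
    rw [Real.log_div hσ0.ne' hs0.ne'] at h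
    have h2 : σ / s - 1 ≤ σ - s := by
      rw [div_sub_one hs0.ne', div_le_iff₀ hs0]; nlinarith
    rw [hδ]; linarith
  have hterm : ∀ k ∈ (Finset.range (N + 1)).filter P, (N.choose k : ℝ) * cc p (k + 1) *
      (1 - p) ^ ((k + 1) * (N - k)) ≤ (1 / s) * (tw k * (1 * Real.exp (-1)) ^ (k + 1)) := by
    intro k hk
    rw [Finset.mem_filter, Finset.mem_range] at hk
    have hkN : k ≤ N := by omega
    have hPk := hP k hk.2
    have a1 : (N.choose k : ℝ) ≤ (N : ℝ) ^ k / (k.factorial : ℝ) := Nat.choose_le_pow_div k N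
    have a2 := cc_micro_upper h0.le h1 k
    have a3 : (1 - p) ^ ((k + 1) * (N - k)) ≤ Real.exp (-σ + lamδ) ^ (k + 1) := by
      rw [mul_comm, pow_mul]
      have hp : 0 ≤ 1 - p := by linarith
      apply pow_le_pow_left₀ (pow_nonneg hp _)
      have b1 : 1 - p ≤ Real.exp (-p) := by have := Real.add_one_le_exp (-p); linarith
      calc (1 - p) ^ (N - k) ≤ Real.exp (-p) ^ (N - k) := by gcongr
        _ = Real.exp (((N - k : ℕ) : ℝ) * (-p)) := by rw [Real.exp_nat_mul]
        _ ≤ _ := by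
          apply Real.exp_le_exp.2
          rw [Nat.cast_sub hkN, hσ]
          nlinarith
    have hc0 := cc_nonneg h0.le h1.le (k + 1)
    have htw := (tw_pos k).le
    have hp : 0 ≤ 1 - p := by linarith
    calc (N.choose k : ℝ) * cc p (k + 1) * (1 - p) ^ ((k + 1) * (N - k))
        ≤ ((N : ℝ) ^ k / (k.factorial : ℝ)) * ((k.factorial : ℝ) * tw k * p ^ k) *
          Real.exp (-σ + lamδ) ^ (k + 1) := by gcongr
      _ = (1 / σ) * (tw k * (σ * Real.exp (-σ + lamδ)) ^ (k + 1)) := by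
        have : (k.factorial : ℝ) ≠ 0 := by positivity
        rw [mul_pow, show σ ^ (k + 1) = (N : ℝ) ^ k * p ^ k * σ by rw [pow_succ, hσ, mul_pow]]
        field_simp
      _ ≤ (1 / s) * (tw k * (1 * Real.exp (-1)) ^ (k + 1)) := by
        rw [one_mul]
        gcongr
  refine (Finset.sum_le_sum hterm).trans ?_
  rw [← Finset.mul_sum]
  have h2 : ∑ k ∈ (Finset.range (N + 1)).filter P, tw k * (1 * Real.exp (-1)) ^ (k + 1) ≤ 1 := by
    refine le_trans ?_ (tw_partial (τ := 1) zero_le_one (N + 1))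
    apply Finset.sum_le_sum_of_subset_of_nonneg (Finset.filter_subset _ _)
    intro k _ _
    have := (tw_pos k).le
    positivity
  calc _ ≤ 1 / s * 1 := by gcongr
    _ = _ := mul_one _

lemma gap_exists {lam x0 y y' δ B : ℝ} (hl : 0 < lam) (hx0 : 0 < x0) (hy : y < x0) (hy' : x0 < y')
    (hδ : 0 < δ) :
    ∃ γ : ℝ, 0 < γ ∧ ∀ x, δ ≤ x → x ≤ B → (x ≤ y ∨ y' ≤ x) →
      γ ≤ |x / (x0 / (1 - Real.exp (-(lam * x0)))) - (1 - Real.exp (-(lam * x)))| := by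
  set S := Set.Icc δ B ∩ (Set.Iic y ∪ Set.Ici y') with hS
  have hSc : IsCompact S := isCompact_Icc.inter_right (isClosed_Iic.union isClosed_Ici)
  have hcont : Continuous (fun x : ℝ => |x / (x0 / (1 - Real.exp (-(lam * x0)))) -
    (1 - Real.exp (-(lam * x)))|) := by fun_prop
  have hpos : ∀ x ∈ S, 0 < |x / (x0 / (1 - Real.exp (-(lam * x0)))) -
    (1 - Real.exp (-(lam * x)))| := by
    rintro x ⟨⟨hx1, _⟩, hx⟩
    rw [abs_pos, sub_ne_zero]
    have he := one_sub_exp_pos (mul_pos hl hx0)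
    intro h
    rw [div_div_eq_mul_div, div_eq_iff hx0.ne'] at h
    have hxp : 0 < x := by linarith
    rcases hx with hx | hx
    · have hx : x ≤ y := hx
      have := slope_lt hl hxp (by linarith : x < x0)
      linarith
    · have hx : y' ≤ x := hx
      have := slope_lt hl hx0 (by linarith : x0 < x)
      linarith
  rcases S.eq_empty_or_nonempty with he | hne
  · refine ⟨1, one_pos, fun x h1 h2 h3 => ?_⟩
    exfalso
    have : x ∈ S := ⟨⟨h1, h2⟩, h3⟩
    rw [he] at this
    exact this
  · obtain ⟨x1, hx1, hmin⟩ := hSc.exists_isMinOn hne hcont.continuousOn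
    exact ⟨_, hpos x1 hx1, fun x h1 h2 h3 => hmin (show x ∈ S from ⟨⟨h1, h2⟩, h3⟩)⟩

lemma z_lower {p : ℝ} (hp0 : 0 ≤ p) (hp1 : p ≤ 1 / 2) (k : ℕ) :
    Real.exp (-(p * k)) - p ^ 2 * k ≤ (1 - p) ^ k := by
  rw [pow_eq_exp (by linarith)]
  have h1 := neg_log_one_sub_le hp0 hp1
  have hk : (0:ℝ) ≤ k := Nat.cast_nonneg k
  have h2 : Real.exp (-(p * k) + -(p ^ 2 * k)) ≤ Real.exp (k * Real.log (1 - p)) := by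
    apply Real.exp_le_exp.2; nlinarith
  rw [Real.exp_add] at h2
  have h3 := Real.add_one_le_exp (-(p ^ 2 * k))
  have h4 : Real.exp (-(p * k)) ≤ 1 := by rw [Real.exp_le_one_iff]; nlinarith
  have h5 := Real.exp_pos (-(p * k))
  have h6 : 0 ≤ p ^ 2 * k := by positivity
  nlinarith

lemma z_upper {p : ℝ} (hp1 : p < 1) (k : ℕ) : (1 - p) ^ k ≤ Real.exp (-(p * k)) := by
  rw [pow_eq_exp hp1]
  apply Real.exp_le_exp.2
  have h1 := le_neg_log_one_sub hp1
  have hk : (0:ℝ) ≤ k := Nat.cast_nonneg k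
  nlinarith

set_option maxHeartbeats 1000000 in
lemma cc_window {lam : ℝ} (hl : 0 < lam) {y y' : ℝ} (hy0 : 0 < y) (hyy : y < y') :
    ∃ c : ℝ, 0 < c ∧ ∀ᶠ n : ℕ in atTop, ∃ j : ℕ, y * n ≤ j ∧ (j : ℝ) ≤ y' * n ∧ 1 ≤ j ∧
      c / n * (1 - (1 - lam / n) ^ j) ^ j ≤ cc (lam / n) j := by
  set x0 := (y + y') / 2 with hx0
  have hx0p : 0 < x0 := by rw [hx0]; linarith
  have hE := one_sub_exp_pos (mul_pos hl hx0p)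
  set ν := x0 / (1 - Real.exp (-(lam * x0))) with hν
  have hνp : 0 < ν := by positivity
  have hlν : 1 < lam * ν := by
    rw [hν, ← mul_div_assoc, lt_div_iff₀ hE, one_mul]
    have := Real.add_one_lt_exp (x := -(lam * x0)) (neg_ne_zero.2 (mul_pos hl hx0p).ne')
    linarith
  set s := (1 + lam * ν) / 2 with hs
  have hs1 : 1 < s := by rw [hs]; linarith
  have hs2 : s < lam * ν := by rw [hs]; linarith
  set lamδ := s - 1 - Real.log s with hlδ
  have hlδp : 0 < lamδ := by
    have := Real.log_lt_sub_one_of_pos (by linarith : 0 < s) (by linarith)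
    rw [hlδ]; linarith
  set δ := lamδ / lam with hδ
  have hδp : 0 < δ := by positivity
  obtain ⟨γ, hγ, hgap⟩ := gap_exists (B := ν + 1) hl hx0p (by rw [hx0]; linarith : y < x0)
    (by rw [hx0]; linarith : x0 < y') hδp
  set c := (1 - 1 / s) / (2 * (ν + 1)) with hc
  have hsinv : 1 / s < 1 := by rw [div_lt_one (by linarith)]; exact hs1
  have hcp : 0 < c := by
    rw [hc]; apply div_pos <;> linarith
  refine ⟨c, hcp, ?_⟩
  -- eventual facts
  set D := lam ^ 2 * (ν + 1) + 1 + 2 / ν with hD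
  have hlim : Tendsto (fun n : ℕ => (n : ℝ) ^ 2 * Real.exp (-(ν * γ ^ 2 / 32) * n)) atTop (𝓝 0) := by
    have h1 := Real.tendsto_pow_mul_exp_neg_atTop_nhds_zero 2
    have hb : 0 < ν * γ ^ 2 / 32 := by positivity
    have h2 : Tendsto (fun n : ℕ => (ν * γ ^ 2 / 32) * (n : ℝ)) atTop atTop :=
      tendsto_natCast_atTop_atTop.const_mul_atTop hb
    have h3 := (h1.comp h2).const_mul ((1 / (ν * γ ^ 2 / 32)) ^ 2)
    rw [mul_zero] at h3
    refine h3.congr (fun n => ?_)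
    simp only [Function.comp]
    rw [show -(ν * γ ^ 2 / 32) * (n:ℝ) = -(ν * γ ^ 2 / 32 * n) by ring]
    field_simp
  have hev1 : ∀ᶠ n : ℕ in atTop, (n : ℝ) ^ 2 * Real.exp (-(ν * γ ^ 2 / 32) * n) <
      c / Real.exp (2 * ν) :=
    hlim.eventually (gt_mem_nhds (by positivity))
  have hcast := tendsto_natCast_atTop_atTop (R := ℝ)
  filter_upwards [hev1, hcast.eventually_ge_atTop (2 * lam), hcast.eventually_ge_atTop 2,
    hcast.eventually_ge_atTop (2 / ν), hcast.eventually_ge_atTop (2 * D / γ),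
    hcast.eventually_ge_atTop (lam / (lam * ν - s))] with n hn1 hn2 hn3 hn4 hn5 hn6
  have hn0 : (0:ℝ) < n := by linarith
  set p := lam / n with hp
  have hp0 : 0 < p := by positivity
  have hp1 : p ≤ 1 / 2 := by rw [hp, div_le_div_iff₀ hn0 two_pos]; linarith
  have hpl : p < 1 := by linarith
  have hpn : p * n = lam := by rw [hp]; field_simp
  set N := ⌊ν * n⌋₊ with hN
  have hN1 : (N : ℝ) ≤ ν * n := Nat.floor_le (by positivity)
  have hN2 : ν * n < N + 1 := Nat.lt_floor_add_one _
  have hνn : 2 ≤ ν * n := by rw [div_le_iff₀ hνp] at hn4; linarith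
  have hNh : ν * n / 2 ≤ N := by linarith
  have hNp : (0:ℝ) < N := by linarith
  have hN1' : 1 ≤ N := by exact_mod_cast (by exact_mod_cast hNp : 0 < N)
  have hσ : s ≤ N * p := by
    have h1 : lam ≤ (lam * ν - s) * n := by
      rw [div_le_iff₀ (by linarith)] at hn6; linarith
    have h2 : (ν * n - 1) * p ≤ N * p := by gcongr; linarith
    have h3 : (ν * n - 1) * p = lam * ν - p := by
      rw [sub_mul, one_mul, mul_assoc, mul_comm (n:ℝ) p, hpn]; ring
    have h4 : p ≤ lam * ν - s := by rw [hp, div_le_iff₀ hn0]; exact h1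
    linarith
  by_contra hcon
  push Not at hcon
  have hsum := cc_sum p N
  have hsplit := Finset.sum_filter_add_sum_filter_not (Finset.range (N + 1))
    (fun k : ℕ => p * ((k : ℝ) + 1) ≤ lamδ)
    (fun k => (N.choose k : ℝ) * cc p (k + 1) * (1 - p) ^ ((k + 1) * (N - k)))
  have hmic := micro_sum (N := N) hp0 hpl rfl hs1 hσ hlδ
    (fun k : ℕ => p * ((k : ℝ) + 1) ≤ lamδ) (fun k hk => hk)
  have hmac : ∀ k ∈ (Finset.range (N + 1)).filter (fun k : ℕ => ¬ (p * ((k : ℝ) + 1) ≤ lamδ)),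
      (N.choose k : ℝ) * cc p (k + 1) * (1 - p) ^ ((k + 1) * (N - k)) ≤ c / n := by
    intro k hk
    rw [Finset.mem_filter, Finset.mem_range, not_le] at hk
    obtain ⟨hkN, hkδ⟩ := hk
    have hkN : k ≤ N := by omega
    have hkN' : (k : ℝ) ≤ N := by exact_mod_cast hkN
    rw [pow_mul]
    set z := (1 - p) ^ (k + 1) with hz
    have hz0 : 0 ≤ z := pow_nonneg (by linarith) _
    have hz1 : z ≤ 1 := pow_le_one₀ (by linarith) (by linarith)
    by_cases hwin : y * n ≤ ((k + 1 : ℕ) : ℝ) ∧ ((k + 1 : ℕ) : ℝ) ≤ y' * n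
    · have h1 := hcon (k + 1) hwin.1 hwin.2 (by omega)
      rw [← hz] at h1
      have h2 := binom_term_le_one (a := 1 - z) (by linarith) (by linarith) N k hkN
      rw [sub_sub_cancel] at h2
      have h3 : 0 ≤ (N.choose k : ℝ) := by positivity
      have h4 : 0 ≤ z ^ (N - k) := by positivity
      have h5 : 0 ≤ 1 - z := by linarith
      calc (N.choose k : ℝ) * cc p (k + 1) * z ^ (N - k)
          ≤ (N.choose k : ℝ) * (c / n * (1 - z) ^ (k + 1)) * z ^ (N - k) := by gcongr
        _ = c / n * (((N.choose k : ℝ) * (1 - z) ^ k * z ^ (N - k)) * (1 - z)) := by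
            rw [pow_succ]; ring
        _ ≤ c / n * (1 * 1) := by gcongr; linarith
        _ = c / n := by ring
    · set ζ : ℝ := 1 - 1 / n with hζ
      have hinv : 0 < 1 / (n:ℝ) := by positivity
      have hinv2 : 1 / (n:ℝ) ≤ 1 / 2 := by apply one_div_le_one_div_of_le <;> linarith
      have hζ0 : 0 < ζ := by rw [hζ]; linarith
      have hζ1 : ζ < 1 := by rw [hζ]; linarith
      have hcc := cc_giant hp0.le hpl (k + 1) (by omega) hζ0 hζ1
      rw [← hz, show 1 - ζ = 1 / n by rw [hζ]; ring, div_div_eq_mul_div, div_one] at hcc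
      set a := 1 - ζ * z with ha
      have hζz : ζ * z ≤ 1 := by
        have := mul_le_mul hζ1.le hz1 hz0 zero_le_one
        linarith
      have ha0 : 0 ≤ a := by rw [ha]; linarith
      have ha1 : a ≤ 1 := by
        have : 0 ≤ ζ * z := by positivity
        rw [ha]; linarith
      have hbin := binom_term_le ha0 ha1 N k hkN hN1'
      have hζN : 1 ≤ Real.exp (2 * ν) * ζ ^ (N - k) := by
        have h1 := neg_log_one_sub_le hinv.le hinv2
        have h2 : ζ ^ (N - k) = Real.exp (((N - k : ℕ) : ℝ) * Real.log ζ) := by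
          rw [Real.exp_nat_mul, Real.exp_log hζ0]
        rw [h2, ← Real.exp_add, Real.one_le_exp_iff]
        have h3 : -Real.log ζ ≤ 2 * (1 / n) := by
          have : (1 / (n:ℝ)) ^ 2 ≤ 1 / n := by
            rw [sq]; exact mul_le_of_le_one_left hinv.le (by linarith)
          rw [hζ]; linarith
        have h4 : ((N - k : ℕ) : ℝ) ≤ N := by exact_mod_cast Nat.sub_le _ _
        have h5 : 0 ≤ -Real.log ζ := by
          have := Real.log_nonpos hζ0.le hζ1.le; linarith
        have h6 : ((N - k : ℕ) : ℝ) * -Real.log ζ ≤ (ν * n) * (2 * (1 / n)) := by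
          apply mul_le_mul (h4.trans hN1) h3 h5 (by positivity)
        have h7 : (ν * n) * (2 * (1 / n)) = 2 * ν := by field_simp
        linarith
      have hT : (N.choose k : ℝ) * cc p (k + 1) * z ^ (N - k) ≤
          n * Real.exp (2 * ν) * Real.exp (-(N * ((k : ℝ) / N - a) ^ 2 / 4)) := by
        calc (N.choose k : ℝ) * cc p (k + 1) * z ^ (N - k)
            ≤ (N.choose k : ℝ) * (a ^ (k + 1) * n) * (z ^ (N - k)) * 1 := by
              rw [mul_one]; gcongr
          _ ≤ (N.choose k : ℝ) * (a ^ (k + 1) * n) * (z ^ (N - k)) *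
              (Real.exp (2 * ν) * ζ ^ (N - k)) := by gcongr
          _ = n * Real.exp (2 * ν) * (((N.choose k : ℝ) * a ^ k * (1 - a) ^ (N - k)) * a) := by
              rw [ha, sub_sub_cancel, ← ha, mul_pow, pow_succ]; ring
          _ ≤ n * Real.exp (2 * ν) * (Real.exp (-(N * ((k : ℝ) / N - a) ^ 2 / 4)) * 1) := by
              gcongr
          _ = _ := by rw [mul_one]
      -- gap
      set x := ((k + 1 : ℕ) : ℝ) / n with hx
      have hxn : x * n = (k : ℝ) + 1 := by rw [hx]; push_cast; field_simp
      have hxδ : δ ≤ x := by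
        rw [hδ, div_le_iff₀ hl, ← hpn]
        have : x * (p * n) = p * (k + 1) := by rw [← hxn]; ring
        rw [this]; exact hkδ.le
      have hxB : x ≤ ν + 1 := by
        have : x * n ≤ (ν + 1) * n := by
          rw [hxn, add_mul, one_mul]; linarith
        exact le_of_mul_le_mul_right this hn0
      have hxw : x ≤ y ∨ y' ≤ x := by
        by_contra hh
        push Not at hh
        apply hwin
        push_cast
        rw [← hxn]
        constructor
        · exact mul_le_mul_of_nonneg_right hh.1.le hn0.le
        · exact mul_le_mul_of_nonneg_right hh.2.le hn0.le
      have hg := hgap x hxδ hxB hxw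
      rw [← hν] at hg
      have hpk : p * (k + 1) = lam * x := by rw [← hxn, ← hpn]; ring
      -- compare a
      have hzu : z ≤ Real.exp (-(lam * x)) := by
        have := z_upper hpl (k + 1)
        push_cast at this
        rw [hpk] at this
        exact this
      have hzl : Real.exp (-(lam * x)) - lam ^ 2 * (ν + 1) / n ≤ z := by
        have h1 := z_lower hp0.le hp1 (k + 1)
        push_cast at h1
        rw [hpk] at h1
        have h7 : p ^ 2 * ((k : ℝ) + 1) ≤ lam ^ 2 * (ν + 1) / n := by
          rw [le_div_iff₀ hn0, ← hxn, ← hpn]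
          calc p ^ 2 * (x * n) * n = (p * n) ^ 2 * x := by ring
            _ ≤ (p * n) ^ 2 * (ν + 1) := by gcongr
        linarith
      have hacmp : |a - (1 - Real.exp (-(lam * x)))| ≤ (lam ^ 2 * (ν + 1) + 1) / n := by
        have e1 : a - (1 - Real.exp (-(lam * x))) = Real.exp (-(lam * x)) - z + 1 / n * z := by
          rw [ha, hζ]; ring
        have e2 : (lam ^ 2 * (ν + 1) + 1) / (n:ℝ) = lam ^ 2 * (ν + 1) / n + 1 / n := by ring
        have e3 : 1 / (n:ℝ) * z ≤ 1 / n := mul_le_of_le_one_right hinv.le hz1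
        have e4 : 0 ≤ 1 / (n:ℝ) * z := by positivity
        rw [e1, e2, abs_of_nonneg (by linarith)]
        linarith
      have hkcmp : |(k : ℝ) / N - x / ν| ≤ 2 / ν / n := by
        have hx' : x = ((k : ℝ) + 1) / n := by rw [← hxn]; field_simp
        have e1 : (k : ℝ) / N - x / ν = (k / N * (ν * n - N) - 1) / (ν * n) := by
          rw [hx']; field_simp; ring
        have e2 : (k : ℝ) / N ≤ 1 := by rw [div_le_one hNp]; exact hkN'
        have e3 : 0 ≤ (k : ℝ) / N := by positivity
        have e4 : 0 ≤ ν * n - N := by linarith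
        have e5 : ν * n - N ≤ 1 := by linarith
        have e6 : (k : ℝ) / N * (ν * n - N) ≤ 1 * 1 := mul_le_mul e2 e5 e4 zero_le_one
        have e7 : 0 ≤ (k : ℝ) / N * (ν * n - N) := mul_nonneg e3 e4
        have e8 : |(k : ℝ) / N * (ν * n - N) - 1| ≤ 2 := by rw [abs_le]; constructor <;> linarith
        rw [e1, abs_div, abs_of_pos (by positivity : 0 < ν * n), div_div]
        gcongr
      have hDn : D / n ≤ γ / 2 := by
        rw [div_le_div_iff₀ hn0 two_pos]
        rw [div_le_iff₀ hγ] at hn5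
        linarith
      have hd : γ / 2 ≤ |(k : ℝ) / N - a| := by
        have e1 : x / ν - (1 - Real.exp (-(lam * x))) = ((k : ℝ) / N - a) +
          ((a - (1 - Real.exp (-(lam * x)))) - ((k : ℝ) / N - x / ν)) := by ring
        have e2 := abs_add_le ((k : ℝ) / N - a)
          ((a - (1 - Real.exp (-(lam * x)))) - ((k : ℝ) / N - x / ν))
        have e3 := abs_sub (a - (1 - Real.exp (-(lam * x)))) ((k : ℝ) / N - x / ν)
        rw [← e1] at e2
        have e4 : D / n = (lam ^ 2 * (ν + 1) + 1) / n + 2 / ν / n := by rw [hD]; ring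
        linarith
      have hd2 : γ ^ 2 / 4 ≤ ((k : ℝ) / N - a) ^ 2 := by
        rw [← sq_abs ((k : ℝ) / N - a), show γ ^ 2 / 4 = (γ / 2) ^ 2 by ring]
        gcongr
      have hexp : Real.exp (-(N * ((k : ℝ) / N - a) ^ 2 / 4)) ≤
          Real.exp (-(ν * γ ^ 2 / 32) * n) := by
        apply Real.exp_le_exp.2
        have : ν * n / 2 * (γ ^ 2 / 4) ≤ N * ((k : ℝ) / N - a) ^ 2 := by gcongr
        rw [show -(ν * γ ^ 2 / 32) * (n:ℝ) = -(ν * n / 2 * (γ ^ 2 / 4)) / 4 by ring]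
        linarith
      refine hT.trans ?_
      calc n * Real.exp (2 * ν) * Real.exp (-(N * ((k : ℝ) / N - a) ^ 2 / 4))
          ≤ n * Real.exp (2 * ν) * Real.exp (-(ν * γ ^ 2 / 32) * n) := by gcongr
        _ = (Real.exp (2 * ν) / n) * ((n : ℝ) ^ 2 * Real.exp (-(ν * γ ^ 2 / 32) * n)) := by
            field_simp
        _ ≤ (Real.exp (2 * ν) / n) * (c / Real.exp (2 * ν)) := by gcongr
        _ = c / n := by field_simp
  have hmac2 := Finset.sum_le_card_nsmul _ _ _ hmac
  have hcard : (((Finset.range (N + 1)).filter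
      (fun k : ℕ => ¬ (p * ((k : ℝ) + 1) ≤ lamδ))).card : ℝ) ≤ (ν + 1) * n := by
    have h1 := Finset.card_filter_le (Finset.range (N + 1)) (fun k : ℕ => ¬ (p * ((k : ℝ) + 1) ≤ lamδ))
    rw [Finset.card_range] at h1
    have h2 : (((Finset.range (N + 1)).filter
      (fun k : ℕ => ¬ (p * ((k : ℝ) + 1) ≤ lamδ))).card : ℝ) ≤ N + 1 := by exact_mod_cast h1
    rw [add_mul, one_mul]
    linarith
  rw [nsmul_eq_mul] at hmac2
  have h3 := mul_le_mul_of_nonneg_right hcard (by positivity : 0 ≤ c / (n:ℝ))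
  have h4 : (ν + 1) * n * (c / n) = (1 - 1 / s) / 2 := by
    rw [hc]; field_simp
  linarith

-- PART 8

lemma poly_le_exp (C : ℝ) (d : ℕ) {η : ℝ} (hη : 0 < η) :
    ∀ᶠ n : ℕ in atTop, C * (n : ℝ) ^ d ≤ Real.exp (n * η) := by
  have h := (Real.tendsto_pow_mul_exp_neg_atTop_nhds_zero d).comp
    (tendsto_natCast_atTop_atTop.atTop_mul_const hη : Tendsto (fun n : ℕ => (n : ℝ) * η) atTop atTop)
  have h2 := (h.const_mul (C / η ^ d)).eventually_lt_const (u := 1) (by simp)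
  filter_upwards [h2] with n hn
  simp only [Function.comp] at hn
  rw [Real.exp_neg, ← mul_assoc, ← div_eq_mul_inv, div_lt_one (Real.exp_pos _)] at hn
  refine le_trans (le_of_eq ?_) hn.le
  rw [mul_pow]
  field_simp

lemma cc_extend {p P : ℝ} (h0 : 0 ≤ p) (h1 : p < 1) (hP : 0 ≤ P) {j : ℕ} (hj : 1 ≤ j)
    (hPj : P ≤ 1 - (1 - p) ^ j) (k : ℕ) : P ^ k * cc p j ≤ cc p (j + k) := by
  induction k with
  | zero => simp
  | succ k ih =>
    have h2 := cc_mono h0 h1 (j + k) (by omega)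
    have h3 : (1 - p) ^ (j + k) ≤ (1 - p) ^ j :=
      pow_le_pow_of_le_one (by linarith) (by linarith) (by omega)
    have h4 := cc_nonneg h0 h1.le (j + k)
    calc P ^ (k + 1) * cc p j = (P ^ k * cc p j) * P := by ring
      _ ≤ cc p (j + k) * P := mul_le_mul_of_nonneg_right ih hP
      _ ≤ cc p (j + k) * (1 - (1 - p) ^ (j + k)) := mul_le_mul_of_nonneg_left (by linarith) h4
      _ ≤ _ := h2

lemma ev_lam {lam : ℝ} (hl : 0 < lam) {η : ℝ} (hη : 0 < η) :
    ∀ᶠ n : ℕ in atTop, 0 < lam / n ∧ lam / n < η ∧ 1 ≤ n := by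
  have h := tendsto_const_div_atTop_nhds_zero_nat lam
  filter_upwards [h.eventually_lt_const hη, eventually_ge_atTop 1] with n hn h1
  have : (0:ℝ) < n := by exact_mod_cast h1
  exact ⟨by positivity, hn, h1⟩

lemma al_macro_lower {lam : ℝ} (hl : 0 < lam) {x : ℝ} (hx : 0 < x) {η : ℝ} (hη : 0 < η) :
    ∃ ρ > 0, ∀ᶠ n : ℕ in atTop, ∀ k : ℕ, |(k : ℝ) / n - x| ≤ ρ →
      Real.exp (n * (gr lam x - η)) ≤ (n : ℝ) ^ k * al (lam / n) k := by
  -- continuity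
  have hcont : ContinuousAt (fun z : ℝ × ℝ => z.1 * Real.log (1 - Real.exp (-(lam * z.2))) +
      lam * z.1 ^ 2 / 2 - z.1 * Real.log z.1 + z.1) (x, x) := by
    have h1 : (1 - Real.exp (-(lam * x))) ≠ 0 := (one_sub_exp_pos (by positivity)).ne'
    have h2 : ContinuousAt (fun z : ℝ × ℝ => Real.log (1 - Real.exp (-(lam * z.2)))) (x, x) := by
      apply ContinuousAt.log
      · fun_prop
      · exact h1
    have h3 : ContinuousAt (fun z : ℝ × ℝ => Real.log z.1) (x, x) := by
      apply ContinuousAt.log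
      · fun_prop
      · exact hx.ne'
    fun_prop
  rw [Metric.continuousAt_iff] at hcont
  obtain ⟨δ, hδ, hd⟩ := hcont (η / 2) (by positivity)
  set ρ := min (δ / 4) (x / 4) with hρ
  have hρ0 : 0 < ρ := by positivity
  have hρδ : ρ ≤ δ / 4 := min_le_left _ _
  have hρx : ρ ≤ x / 4 := min_le_right _ _
  refine ⟨ρ, hρ0, ?_⟩
  set y := x - 2 * ρ with hy
  have hy0 : 0 < y := by rw [hy]; linarith
  obtain ⟨c, hc, hw⟩ := cc_window hl hy0 (show y < x - ρ by rw [hy]; linarith)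
  filter_upwards [hw, ev_lam hl one_pos, poly_le_exp (Real.exp 1 * (x + ρ) / c) 2 (half_pos hη)]
    with n hn hlam hpoly k hk
  obtain ⟨hp0, hp1, hn1⟩ := hlam
  obtain ⟨j, hj1, hj2, hj3, hj4⟩ := hn
  have hnpos : (0:ℝ) < n := by exact_mod_cast hn1
  set t := (k : ℝ) / n with ht
  obtain ⟨hk1, hk2⟩ := abs_le.1 hk
  have htk : t * n = k := by rw [ht]; field_simp
  have hjk : j ≤ k := by
    have : (j : ℝ) ≤ k := by
      rw [← htk]; refine hj2.trans ?_
      apply mul_le_mul_of_nonneg_right _ hnpos.le; linarith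
    exact_mod_cast this
  have ht0 : 0 < t := by linarith
  have hdd := hd (x := (t, y)) (by
    rw [Prod.dist_eq, max_lt_iff]
    constructor
    · simp only [Real.dist_eq]; exact lt_of_le_of_lt hk (by linarith)
    · simp only [Real.dist_eq]; rw [abs_lt]; constructor <;> linarith)
  rw [Real.dist_eq, abs_lt] at hdd
  simp only at hdd
  set P := 1 - Real.exp (-(lam * y)) with hP
  have hP0 : 0 < P := one_sub_exp_pos (by positivity)
  have hPj : P ≤ 1 - (1 - lam / n) ^ j := by
    have h1 := z_upper hp1 j
    have h2 : Real.exp (-(lam / n * j)) ≤ Real.exp (-(lam * y)) := by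
      apply Real.exp_le_exp.2
      have : lam * y ≤ lam / n * j := by
        rw [div_mul_eq_mul_div, le_div_iff₀ hnpos, mul_assoc]
        exact mul_le_mul_of_nonneg_left hj1 hl.le
      linarith
    linarith
  have hcc : c / n * P ^ k ≤ cc (lam / n) k := by
    have h1 := cc_extend hp0.le hp1 hP0.le hj3 hPj (k - j)
    rw [Nat.add_sub_cancel' hjk] at h1
    refine le_trans ?_ h1
    have h2 : P ^ j ≤ (1 - (1 - lam / n) ^ j) ^ j := pow_le_pow_left₀ hP0.le hPj _
    have h3 : c / n * P ^ j ≤ cc (lam / n) j :=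
      le_trans (mul_le_mul_of_nonneg_left h2 (by positivity)) hj4
    calc c / n * P ^ k = P ^ (k - j) * (c / n * P ^ j) := by
          rw [show k = (k - j) + j by omega, pow_add]; simp; ring
      _ ≤ _ := mul_le_mul_of_nonneg_left h3 (by positivity)
  have hk0 : 1 ≤ k := le_trans hj3 hjk
  have hkpos : (0:ℝ) < k := by exact_mod_cast hk0
  have heh := eh_lower hp1 k
  have hf := fact_upper k hk0
  unfold al
  have hfpos : (0:ℝ) < k.factorial := by exact_mod_cast k.factorial_pos
  have hmain : (n:ℝ)^k * ((c / n * P ^ k) * Real.exp (lam / n * k^2/2) / (Real.exp 1 * k * Real.exp (k * Real.log k - k))) ≤ (n:ℝ)^k * (cc (lam / n) k * eh (lam / n) k / k.factorial) := by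
    have := cc_nonneg hp0.le hp1.le k
    have := (eh_pos (lam/n) k)
    gcongr
  refine le_trans ?_ hmain
  have e1 : (n:ℝ)^k = Real.exp (k * Real.log n) := by
    rw [mul_comm, ← Real.rpow_natCast, Real.rpow_def_of_pos hnpos]
  have e2 : P^k = Real.exp (k * Real.log P) := by
    rw [mul_comm, ← Real.rpow_natCast, Real.rpow_def_of_pos hP0]
  have e3 : Real.log k = Real.log t + Real.log n := by
    rw [← htk, Real.log_mul ht0.ne' hnpos.ne']
  have e4 : (n:ℝ)^k * ((c / n * P ^ k) * Real.exp (lam / n * k^2/2) / (Real.exp 1 * k * Real.exp (k * Real.log k - k)))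
      = (c / (Real.exp 1 * k * n)) * Real.exp (n * (t * Real.log P + lam * t^2/2 - t * Real.log t + t)) := by
    have : (n:ℝ) * (t * Real.log P + lam * t^2/2 - t * Real.log t + t) = k * Real.log n + k * Real.log P + lam / n * k^2/2 - (k * Real.log k - k) := by
      rw [e3, ← htk]; field_simp; ring
    rw [this, Real.exp_sub (_ + _ + _), Real.exp_add, Real.exp_add, ← e1, ← e2]
    have := Real.exp_pos (k * Real.log k - k)
    field_simp
  rw [e4]
  have h5 : Real.exp (-(n * (η / 2))) ≤ c / (Real.exp 1 * k * n) := by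
    rw [Real.exp_neg, inv_le_comm₀ (Real.exp_pos _) (by positivity), inv_div]
    refine le_trans ?_ hpoly
    have : (k:ℝ) ≤ (x + ρ) * n := by rw [← htk]; apply mul_le_mul_of_nonneg_right _ hnpos.le; linarith
    calc Real.exp 1 * k * n / c ≤ Real.exp 1 * ((x + ρ) * n) * n / c := by gcongr
      _ = _ := by ring
  calc Real.exp (n * (gr lam x - η)) ≤ Real.exp (-(n * (η / 2))) * Real.exp (n * (t * Real.log P + lam * t^2/2 - t * Real.log t + t)) := by
        rw [← Real.exp_add]
        apply Real.exp_le_exp.2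
        have : gr lam x - η ≤ -(η/2) + (t * Real.log P + lam * t^2/2 - t * Real.log t + t) := by
          unfold gr; linarith [hdd.1]
        calc (n:ℝ) * (gr lam x - η) ≤ n * (-(η/2) + (t * Real.log P + lam * t^2/2 - t * Real.log t + t)) := mul_le_mul_of_nonneg_left this hnpos.le
          _ = _ := by ring
    _ ≤ _ := mul_le_mul_of_nonneg_right h5 (Real.exp_pos _).le

lemma pre_pos {lam : ℝ} (n : ℕ) (hn : 1 ≤ n) (h : lam / n < 1) : 0 < pre lam n := by
  have hnpos : (0:ℝ) < n := by exact_mod_cast hn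
  have := eh_lower h n
  have h2 : 0 < eh (lam / n) n := lt_of_lt_of_le (Real.exp_pos _) this
  unfold pre
  positivity

lemma pre_limit {lam : ℝ} (hl : 0 < lam) :
    Tendsto (fun n : ℕ => 1 / (n : ℝ) * Real.log (pre lam n)) atTop (𝓝 (-1 - lam / 2)) := by
  have hlog : Tendsto (fun n : ℕ => Real.log n / n) atTop (𝓝 0) := by
    have := Real.isLittleO_log_id_atTop.tendsto_div_nhds_zero
    exact this.comp tendsto_natCast_atTop_atTop
  have hup : Tendsto (fun n : ℕ => -1 - lam / 2 + (1 / (n:ℝ) + Real.log n / n)) atTop (𝓝 (-1 - lam / 2)) := by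
    have := (tendsto_const_nhds (x := -1 - lam/2) (f := (atTop : Filter ℕ))).add (tendsto_one_div_atTop_nhds_zero_nat.add hlog)
    simpa using this
  have hlo : Tendsto (fun n : ℕ => -1 - lam / 2 - lam ^ 2 / 2 / n) atTop (𝓝 (-1 - lam / 2)) := by
    have := (tendsto_const_nhds (x := -1 - lam/2) (f := (atTop : Filter ℕ))).sub (tendsto_const_div_atTop_nhds_zero_nat (lam^2/2))
    simpa using this
  refine tendsto_of_tendsto_of_tendsto_of_le_of_le' hlo hup ?_ ?_
  · filter_upwards [ev_lam hl (show (0:ℝ) < 1/2 by norm_num)] with n hn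
    obtain ⟨hp0, hp1, hn1⟩ := hn
    have hnpos : (0:ℝ) < n := by exact_mod_cast hn1
    have h1 := fact_lower n
    have h2 := eh_upper hp0.le hp1.le n
    have h3 : 0 < eh (lam / n) n := lt_of_lt_of_le (Real.exp_pos _) (eh_lower (by linarith) n)
    have h4 := Real.log_le_log (Real.exp_pos _) h1
    have h5 := Real.log_le_log h3 h2
    rw [Real.log_exp] at h4 h5
    unfold pre
    rw [Real.log_div (by positivity) (by positivity), Real.log_mul h3.ne' (by positivity), Real.log_pow]
    rw [one_div_mul_eq_div, le_div_iff₀ hnpos]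
    have e : (lam / n + (lam / n)^2) * n^2/2 = lam / 2 * n + lam^2/2 := by field_simp
    have e2 : (-1 - lam / 2 - lam ^ 2 / 2 / n) * n = -n - lam/2 * n - lam^2/2 := by field_simp
    rw [e2]; linarith
  · filter_upwards [ev_lam hl (show (0:ℝ) < 1/2 by norm_num)] with n hn
    obtain ⟨hp0, hp1, hn1⟩ := hn
    have hnpos : (0:ℝ) < n := by exact_mod_cast hn1
    have h1 := fact_upper n hn1
    have h2 := eh_lower (p := lam/n) (by linarith) n
    have h3 : 0 < eh (lam / n) n := lt_of_lt_of_le (Real.exp_pos _) h2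
    have hf : (0:ℝ) < n.factorial := by exact_mod_cast n.factorial_pos
    have h4 := Real.log_le_log hf h1
    have h5 := Real.log_le_log (Real.exp_pos _) h2
    rw [Real.log_mul (by positivity) (by positivity), Real.log_mul (by positivity) (by positivity), Real.log_exp, Real.log_exp] at h4
    rw [Real.log_exp] at h5
    unfold pre
    rw [Real.log_div (by positivity) (by positivity), Real.log_mul h3.ne' (by positivity), Real.log_pow]
    rw [one_div_mul_eq_div, div_le_iff₀ hnpos]
    have e : lam / n * n^2/2 = lam / 2 * n := by field_simp
    have e2 : (-1 - lam / 2 + (1/(n:ℝ) + Real.log n / n)) * n = -n - lam/2 * n + 1 + Real.log n := by field_simp; ring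
    rw [e2]; linarith

-- PART 9

lemma gr_zero (lam : ℝ) : gr lam 0 = 0 := by simp [gr]

/-- `g(x)/x`. -/
def hr (lam x : ℝ) : ℝ := Real.log (2 * Real.sinh (lam * x / 2)) - Real.log x + 1

lemma gr_eq_hr {lam x : ℝ} (hl : 0 < lam) (hx : 0 ≤ x) : gr lam x = x * hr lam x := by
  rcases hx.eq_or_lt with rfl | hx
  · simp [gr]
  have hs : 0 < Real.sinh (lam * x / 2) := Real.sinh_pos_iff.2 (by positivity)
  have e : 1 - Real.exp (-(lam * x)) = 2 * Real.sinh (lam * x / 2) * Real.exp (-(lam * x / 2)) := by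
    have h1 : Real.exp (lam * x / 2) * Real.exp (-(lam * x / 2)) = 1 := by
      rw [← Real.exp_add]; simp
    have h2 : Real.exp (-(lam * x)) = Real.exp (-(lam * x / 2)) * Real.exp (-(lam * x / 2)) := by
      rw [← Real.exp_add]; ring_nf
    rw [Real.sinh_eq, h2]; linear_combination -h1
  unfold gr hr
  rw [e, Real.log_mul (by positivity) (Real.exp_pos _).ne', Real.log_exp]
  ring

lemma sinh_scale {a b : ℝ} (ha : 0 ≤ a) (hb : 0 < b) (hab : a ≤ b) :
    b * Real.sinh a ≤ a * Real.sinh b := by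
  have hconv : ConvexOn ℝ (Set.Ici 0) Real.sinh := by
    apply MonotoneOn.convexOn_of_deriv (convex_Ici 0) Real.continuous_sinh.continuousOn
      Real.differentiable_sinh.differentiableOn
    rw [Real.deriv_sinh]
    exact (Real.cosh_strictMonoOn.monotoneOn).mono interior_subset
  have h := hconv.2 (show (0:ℝ) ∈ Set.Ici 0 by simp) (show b ∈ Set.Ici (0:ℝ) from hb.le)
    (show 0 ≤ 1 - a / b by rw [sub_nonneg, div_le_one hb]; exact hab)
    (show 0 ≤ a / b by positivity) (by ring)
  simp only [smul_eq_mul, mul_zero, Real.sinh_zero, zero_add] at h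
  rw [div_mul_cancel₀ _ hb.ne', div_mul_eq_mul_div, le_div_iff₀ hb] at h
  linarith

lemma hr_mono {lam a b : ℝ} (hl : 0 < lam) (ha : 0 < a) (hab : a ≤ b) : hr lam a ≤ hr lam b := by
  have hb : 0 < b := lt_of_lt_of_le ha hab
  have hs : 0 < Real.sinh (lam * a / 2) := Real.sinh_pos_iff.2 (by positivity)
  have hs2 : 0 < Real.sinh (lam * b / 2) := Real.sinh_pos_iff.2 (by positivity)
  have h := sinh_scale (a := lam * a / 2) (b := lam * b / 2) (by positivity) (by positivity) (by gcongr)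
  have h2 : b * Real.sinh (lam * a / 2) ≤ a * Real.sinh (lam * b / 2) := by
    have h3 : lam / 2 * (b * Real.sinh (lam * a / 2)) ≤ lam / 2 * (a * Real.sinh (lam * b / 2)) := by
      calc _ = lam * b / 2 * Real.sinh (lam * a / 2) := by ring
        _ ≤ _ := h
        _ = _ := by ring
    exact le_of_mul_le_mul_left h3 (by positivity)
  have h4 := Real.log_le_log (by positivity) h2
  rw [Real.log_mul hb.ne' hs.ne', Real.log_mul ha.ne' hs2.ne'] at h4
  unfold hr
  rw [Real.log_mul two_ne_zero hs.ne', Real.log_mul two_ne_zero hs2.ne']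
  linarith

lemma hr_lower {lam b : ℝ} (hl : 0 < lam) (hb : 0 < b) : 1 + Real.log lam ≤ hr lam b := by
  have h := Real.self_le_sinh_iff.2 (show 0 ≤ lam * b / 2 by positivity)
  have h2 : Real.log (lam * b) ≤ Real.log (2 * Real.sinh (lam * b / 2)) :=
    Real.log_le_log (by positivity) (by linarith)
  rw [Real.log_mul hl.ne' hb.ne'] at h2
  unfold hr; linarith

lemma gr_list {lam : ℝ} (hl : 0 < lam) (L : List ℝ) (hL : ∀ b ∈ L, 0 < b) :
    (L.map (gr lam)).sum ≤ gr lam L.sum := by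
  have hs : 0 ≤ L.sum := List.sum_nonneg fun b hb => (hL b hb).le
  rw [gr_eq_hr hl hs]
  suffices h : ∀ S, ∀ M : List ℝ, (∀ b ∈ M, 0 < b ∧ b ≤ S) → (M.map (gr lam)).sum ≤ M.sum * hr lam S by
    apply h
    intro b hb
    exact ⟨hL b hb, List.single_le_sum (fun x hx => (hL x hx).le) b hb⟩
  intro S M hM
  induction M with
  | nil => simp
  | cons b M ih =>
    simp only [List.map_cons, List.sum_cons]
    have hb := hM b (by simp)
    have h1 := ih (fun c hc => hM c (by simp [hc]))
    rw [gr_eq_hr hl hb.1.le, add_mul]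
    have := mul_le_mul_of_nonneg_left (hr_mono hl hb.1 hb.2) hb.1.le
    linarith

lemma gr_continuousAt {lam x : ℝ} (hl : 0 < lam) (hx : 0 < x) : ContinuousAt (gr lam) x := by
  have h1 : (1 - Real.exp (-(lam * x))) ≠ 0 := (one_sub_exp_pos (by positivity)).ne'
  have h2 : ContinuousAt (fun z : ℝ => Real.log (1 - Real.exp (-(lam * z)))) x := by
    apply ContinuousAt.log
    · fun_prop
    · exact h1
  have h3 : ContinuousAt (fun z : ℝ => Real.log z) x := by
    apply ContinuousAt.log
    · fun_prop
    · exact hx.ne'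
  unfold gr
  fun_prop

lemma gr_bdd {lam x : ℝ} (hl : 0 < lam) (hx : 0 ≤ x) (hx1 : x ≤ 1) : gr lam x ≤ lam / 2 + 1 := by
  rcases hx.eq_or_lt with rfl | hx
  · rw [gr_zero]; positivity
  have h1 : Real.log (1 - Real.exp (-(lam * x))) ≤ 0 := by
    apply Real.log_nonpos (one_sub_exp_pos (by positivity)).le
    linarith [Real.exp_pos (-(lam * x))]
  have h2 := mul_nonneg hx.le (neg_nonneg.2 h1)
  have h3 : x * (1 - x⁻¹) ≤ x * Real.log x := mul_le_mul_of_nonneg_left (Real.one_sub_inv_le_log_of_pos hx) hx.le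
  rw [mul_sub, mul_inv_cancel₀ hx.ne'] at h3
  have h4 : x ^ 2 ≤ 1 := pow_le_one₀ hx.le hx1
  have h5 := mul_le_mul_of_nonneg_left h4 hl.le
  unfold gr
  linarith

/-- Rate function of the part made of small components. -/
def FF (lam q s : ℝ) : ℝ :=
  if lam * s ≤ q then s - s * Real.log s + lam * s ^ 2 / (2 * q) + s * Real.log q
  else s + s * Real.log lam + q / (2 * lam)

lemma FF_continuous {lam q : ℝ} (hl : 0 < lam) (hq : 0 < q) : Continuous (FF lam q) := by
  unfold FF
  apply Continuous.if_le
  · have := Real.continuous_mul_log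
    fun_prop
  · fun_prop
  · fun_prop
  · fun_prop
  · intro s hs
    have hs' : s = q / lam := by field_simp; linarith
    have : Real.log s = Real.log q - Real.log lam := by rw [hs', Real.log_div hq.ne' hl.ne']
    rw [this]
    rw [hs']
    field_simp
    ring

lemma FF_zero {lam q : ℝ} (hq : 0 < q) : FF lam q 0 = 0 := by
  simp [FF, hq.le]

/-- the tilting parameter -/
def tauF (lam q s : ℝ) : ℝ := min (lam * s / q) 1

lemma FF_tau {lam q s : ℝ} (hl : 0 < lam) (hq : 0 < q) (hs : 0 < s) :
    FF lam q s = q / lam * (tauF lam q s - tauF lam q s ^ 2 / 2) -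
      s * (Real.log (tauF lam q s) - tauF lam q s - Real.log lam) := by
  unfold FF tauF
  split_ifs with h
  · have h2 : lam * s / q ≤ 1 := by rwa [div_le_one hq]
    rw [min_eq_left h2, Real.log_div (by positivity) hq.ne', Real.log_mul hl.ne' hs.ne']
    field_simp
    ring
  · have h2 : 1 ≤ lam * s / q := by rw [le_div_iff₀ hq]; linarith
    rw [min_eq_right h2, Real.log_one]
    field_simp
    ring

lemma FF_super {lam q s : ℝ} (hl : 0 < lam) (hq : 0 < q) (hs : q / lam ≤ s) :
    FF lam q s = FF lam q (q / lam) + (s - q / lam) * (1 + Real.log lam) := by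
  have e : lam * (q / lam) = q := by field_simp
  have h1 : FF lam q (q / lam) = 3 * q / (2 * lam) + q / lam * Real.log lam := by
    unfold FF
    rw [if_pos e.le, Real.log_div hq.ne' hl.ne']
    field_simp; ring
  rcases hs.eq_or_lt with rfl | hs
  · simp
  rw [h1]
  unfold FF
  rw [if_neg]
  · field_simp; ring
  · rw [not_le]; rw [div_lt_iff₀ hl] at hs; linarith

lemma Psi_of_le {x : ℝ} (h0 : 0 < x) (h1 : x ≤ 1) : Psi x = 0 := by
  unfold Psi
  apply min_eq_right
  have h := Real.sinh_log h0
  have h2 : Real.sinh (Real.log x) ≤ Real.log x := Real.sinh_le_self_iff.2 (Real.log_nonpos h0.le h1)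
  rw [h] at h2
  rw [one_div]; linarith

lemma Psi_of_ge {x : ℝ} (h1 : 1 ≤ x) : Psi x = Real.log x - (x - 1 / x) / 2 := by
  unfold Psi
  apply min_eq_left
  have h0 : 0 < x := by linarith
  have h := Real.sinh_log h0
  have h2 : Real.log x ≤ Real.sinh (Real.log x) := Real.self_le_sinh_iff.2 (Real.log_nonneg h1)
  rw [h] at h2
  rw [one_div]; linarith

lemma Phi_eq {lam q θ : ℝ} (hl : 0 < lam) (hq : 0 < q) (h0 : 0 ≤ θ) (h1 : θ ≤ 1) :
    Phi θ lam q = -1 - lam / 2 + gr lam θ + FF lam q (1 - θ) := by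
  unfold Phi Sent pi1 gr
  have e : Real.log (1 - (1 - Real.exp (-(lam * θ)))) = -(lam * θ) := by
    rw [sub_sub_cancel, Real.log_exp]
  rw [e]
  rcases h1.eq_or_lt with rfl | h1
  · rw [sub_self, FF_zero hq]; simp; ring
  obtain ⟨s, rfl⟩ : ∃ s, θ = 1 - s := ⟨1 - θ, by ring⟩
  have hs : 0 < s := by linarith
  rw [sub_sub_cancel]
  unfold FF
  split_ifs with h
  · rw [Psi_of_le (by positivity) (by rwa [div_le_one hq])]
    field_simp
    ring
  · have h2 : 1 ≤ lam * s / q := by rw [le_div_iff₀ hq]; linarith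
    rw [Psi_of_ge h2, Real.log_div (by positivity) hq.ne', Real.log_mul hl.ne' hs.ne']
    field_simp
    ring

lemma Phi_bdd {lam q : ℝ} (hl : 0 < lam) (hq : 0 < q) :
    BddAbove ((fun θ' => Phi θ' lam q) '' Set.Icc (0:ℝ) 1) := by
  obtain ⟨C, hC⟩ := (isCompact_Icc (a := (0:ℝ)) (b := 1)).bddAbove_image
    (FF_continuous hl hq).continuousOn
  refine ⟨C, ?_⟩
  rintro _ ⟨θ, hθ, rfl⟩
  have h1 := hC ⟨1 - θ, ⟨by linarith [hθ.2], by linarith [hθ.1]⟩, rfl⟩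
  have h2 := gr_bdd hl hθ.1 hθ.2
  simp only
  rw [Phi_eq hl hq hθ.1 hθ.2]
  linarith

-- PART 10

lemma aq_nonneg {lam q : ℝ} (hq : 0 ≤ q) {n : ℕ} (h0 : 0 ≤ lam / n) (h1 : lam / n ≤ 1) (k : ℕ) :
    0 ≤ aq lam q n k := by
  have := al_nonneg h0 h1 k
  unfold aq; positivity

lemma aq_micro_upper {lam q δ : ℝ} (hl : 0 < lam) (hq : 0 < q) {n : ℕ} (hn : 1 ≤ n)
    (hp : lam / n ≤ 1 / 2) (k : ℕ) (hk : ((k + 1 : ℕ) : ℝ) ≤ δ * n) :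
    aq lam q n (k + 1) ≤ q * n / lam * (tw k / (k + 1) * (lam * Real.exp (lam * δ)) ^ (k + 1)) := by
  have hnpos : (0:ℝ) < n := by exact_mod_cast hn
  have hp0 : 0 < lam / n := by positivity
  have h1 := cc_micro_upper hp0.le (by linarith) k
  have h2 := eh_upper hp0.le hp (k + 1)
  have h3 : Real.exp ((lam / n + (lam / n) ^ 2) * ((k + 1 : ℕ) : ℝ) ^ 2 / 2) ≤ Real.exp (lam * δ) ^ (k + 1) := by
    rw [← Real.exp_nat_mul]
    apply Real.exp_le_exp.2
    have e1 : (lam / n) ^ 2 ≤ lam / n := by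
      rw [sq]; exact mul_le_of_le_one_left hp0.le (by linarith)
    have hk0 : (0:ℝ) ≤ ((k + 1 : ℕ) : ℝ) := by positivity
    calc (lam / n + (lam / n) ^ 2) * ((k + 1 : ℕ) : ℝ) ^ 2 / 2
        ≤ (lam / n + lam / n) * ((k + 1 : ℕ) : ℝ) ^ 2 / 2 := by gcongr
      _ = lam / n * (((k + 1 : ℕ) : ℝ) * ((k + 1 : ℕ) : ℝ)) := by ring
      _ ≤ lam / n * (((k + 1 : ℕ) : ℝ) * (δ * n)) := by gcongr
      _ = _ := by field_simp
  have h4 := cc_nonneg hp0.le (by linarith : lam / n ≤ 1) (k + 1)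
  have h5 := (eh_pos (lam / n) (k + 1)).le
  have h6 := (tw_pos k).le
  unfold aq al
  calc q * ((n:ℝ) ^ (k + 1) * (cc (lam / n) (k + 1) * eh (lam / n) (k + 1) / ((k + 1).factorial : ℝ)))
      ≤ q * ((n:ℝ) ^ (k + 1) * ((k.factorial * tw k * (lam / n) ^ k) * Real.exp (lam * δ) ^ (k + 1) / ((k + 1).factorial : ℝ))) := by
        have := h2.trans h3
        gcongr
    _ = _ := by
        rw [Nat.factorial_succ, mul_pow, div_pow]
        push_cast
        have : (k.factorial : ℝ) ≠ 0 := by positivity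
        field_simp
        ring

lemma SS_zero (lam q : ℝ) (n : ℕ) (r : ℝ) : SS lam q n r 0 = 1 := expC_zero _

lemma SS_upper {lam q δ : ℝ} (hl : 0 < lam) (hq : 0 < q) {n : ℕ} (hn : 1 ≤ n)
    (hp : lam / n ≤ 1 / 2) (l : ℕ) :
    SS lam q n (δ * n) l ≤ Real.exp (n * FF lam q (l / n) + l * (lam * δ)) := by
  have hnpos : (0:ℝ) < n := by exact_mod_cast hn
  have hp0 : 0 < lam / n := by positivity
  rcases Nat.eq_zero_or_pos l with rfl | hlp
  · rw [SS_zero]; simp [FF_zero hq]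
  have hlpos : (0:ℝ) < l := by exact_mod_cast hlp
  set s := (l : ℝ) / n with hs
  have hs0 : 0 < s := by positivity
  set τ := tauF lam q s with hτ
  have hτ0 : 0 < τ := by rw [hτ]; unfold tauF; positivity
  have hτ1 : τ ≤ 1 := min_le_right _ _
  set y := τ * Real.exp (-τ) / (lam * Real.exp (lam * δ)) with hy
  have hy0 : 0 < y := by positivity
  have hch := expC_chernoff (a := fun k => if (k : ℝ) ≤ δ * n then aq lam q n k else 0)
    (fun k => by
      split_ifs
      · exact aq_nonneg hq.le hp0.le (by linarith) k
      · exact le_rfl) ⌊δ * n⌋₊ (fun k hk => by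
      rw [if_neg]
      rw [not_le]
      exact Nat.lt_of_floor_lt hk) y hy0.le l
  have hsum : ∑ k ∈ Finset.range ⌊δ * n⌋₊, (if ((k + 1 : ℕ) : ℝ) ≤ δ * n then aq lam q n (k + 1) else 0) * y ^ (k + 1) ≤ q * n / lam * (τ - τ ^ 2 / 2) := by
    have ht := tv_hasSum hτ0.le hτ1
    have hle : ∑ k ∈ Finset.range ⌊δ * n⌋₊, tw k / ((k:ℝ) + 1) * (τ * Real.exp (-τ)) ^ (k + 1) ≤ τ - τ ^ 2 / 2 := by
      apply sum_le_hasSum _ _ ht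
      intro k _
      have := (tw_pos k).le
      positivity
    refine le_trans ?_ (mul_le_mul_of_nonneg_left hle (by positivity))
    rw [Finset.mul_sum]
    apply Finset.sum_le_sum
    intro k _
    have htw := (tw_pos k).le
    split_ifs with h
    · have h1 := aq_micro_upper hl hq hn hp k h
      refine le_trans (mul_le_mul_of_nonneg_right h1 (by positivity)) (le_of_eq ?_)
      have : τ * Real.exp (-τ) = (lam * Real.exp (lam * δ)) * y := by
        rw [hy]; field_simp
      rw [this, mul_pow]; ring
    · rw [zero_mul]; positivity
  have h2 := hch.trans (Real.exp_le_exp.2 hsum)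
  unfold SS
  have ey : y ^ l = Real.exp (l * (Real.log τ - τ - Real.log lam - lam * δ)) := by
    have : Real.log y = Real.log τ - τ - Real.log lam - lam * δ := by
      rw [hy, Real.log_div (by positivity) (by positivity), Real.log_mul hτ0.ne' (Real.exp_pos _).ne',
        Real.log_mul hl.ne' (Real.exp_pos _).ne', Real.log_exp, Real.log_exp]; ring
    rw [← this, mul_comm, ← Real.rpow_natCast, Real.rpow_def_of_pos hy0]
  rw [FF_tau hl hq hs0]
  rw [ey] at h2
  rw [mul_comm, ← le_div_iff₀ (Real.exp_pos _), ← Real.exp_sub] at h2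
  refine h2.trans (le_of_eq ?_)
  congr 1
  rw [hs]
  field_simp
  ring

-- PART 11

lemma fact_upper' (m : ℕ) : (m.factorial : ℝ) ≤ Real.exp 1 * (m + 1) * Real.exp (m * Real.log m - m) := by
  rcases Nat.eq_zero_or_pos m with rfl | hm
  · simp
  · refine (fact_upper m hm).trans ?_
    gcongr
    linarith

lemma pois_lower {α x η : ℝ} (hα : 0 < α) (hx : 0 ≤ x) (hη : 0 < η) :
    ∃ ρ > 0, ∀ᶠ n : ℕ in atTop, ∀ m : ℕ, ∀ a : ℝ, |(m : ℝ) / n - x| ≤ ρ → n * (α - ρ) ≤ a →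
      Real.exp (n * (x * (1 + Real.log α - Real.log x) - η)) ≤ a ^ m / m.factorial := by
  have hcont : ContinuousAt (fun z : ℝ × ℝ => z.1 * Real.log z.2 - z.1 * Real.log z.1 + z.1) (x, α) := by
    have h2 : ContinuousAt (fun z : ℝ × ℝ => Real.log z.2) (x, α) := by
      apply ContinuousAt.log
      · fun_prop
      · exact hα.ne'
    have h3 : ContinuousAt (fun z : ℝ × ℝ => z.1 * Real.log z.1) (x, α) := by
      have : Continuous (fun z : ℝ × ℝ => z.1 * Real.log z.1) :=
        Real.continuous_mul_log.comp continuous_fst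
      exact this.continuousAt
    fun_prop
  rw [Metric.continuousAt_iff] at hcont
  obtain ⟨δ, hδ, hd⟩ := hcont (η / 2) (by positivity)
  set ρ := min (δ / 2) (α / 2) with hρ
  have hρ0 : 0 < ρ := by positivity
  have hρδ : ρ ≤ δ / 2 := min_le_left _ _
  have hρx : ρ ≤ α / 2 := min_le_right _ _
  refine ⟨ρ, hρ0, ?_⟩
  filter_upwards [eventually_ge_atTop 1, poly_le_exp (Real.exp 1 * (x + ρ + 1)) 1 (half_pos hη)]
    with n hn1 hpoly m a hm ha
  have hnpos : (0:ℝ) < n := by exact_mod_cast hn1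
  have hn1' : (1:ℝ) ≤ n := by exact_mod_cast hn1
  set t := (m : ℝ) / n with ht
  have htm : t * n = m := by rw [ht]; field_simp
  have ht0 : 0 ≤ t := by positivity
  obtain ⟨hk1, hk2⟩ := abs_le.1 hm
  have hdd := hd (x := (t, α - ρ)) (by
    rw [Prod.dist_eq, max_lt_iff]
    constructor
    · simp only [Real.dist_eq]; exact lt_of_le_of_lt hm (by linarith)
    · simp only [Real.dist_eq]; rw [abs_lt]; constructor <;> linarith)
  rw [Real.dist_eq, abs_lt] at hdd
  simp only at hdd
  have hb0 : 0 < α - ρ := by linarith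
  have hfpos : (0:ℝ) < m.factorial := by exact_mod_cast m.factorial_pos
  have hf := fact_upper' m
  have h1 : (n * (α - ρ)) ^ m / (Real.exp 1 * (m + 1) * Real.exp (m * Real.log m - m)) ≤ a ^ m / m.factorial := by
    have : 0 ≤ n * (α - ρ) := by positivity
    have : 0 ≤ a := this.trans ha
    gcongr
  refine le_trans ?_ h1
  have e1 : (n * (α - ρ)) ^ m = Real.exp (m * (Real.log n + Real.log (α - ρ))) := by
    rw [← Real.log_mul hnpos.ne' hb0.ne', mul_comm (m:ℝ), ← Real.rpow_natCast, Real.rpow_def_of_pos (by positivity)]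
  have e2 : (m:ℝ) * Real.log m = m * (Real.log t + Real.log n) := by
    rcases ht0.eq_or_lt with h | h
    · have : (m:ℝ) = 0 := by rw [← htm, ← h, zero_mul]
      rw [this]; simp
    · rw [← Real.log_mul h.ne' hnpos.ne', htm]
  have e3 : (n * (α - ρ)) ^ m / (Real.exp 1 * (m + 1) * Real.exp (m * Real.log m - m)) =
      (Real.exp 1 * (m + 1))⁻¹ * Real.exp (n * (t * Real.log (α - ρ) - t * Real.log t + t)) := by
    have : (n:ℝ) * (t * Real.log (α - ρ) - t * Real.log t + t) =
        m * (Real.log n + Real.log (α - ρ)) - (m * Real.log m - m) := by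
      rw [e2, ← htm]; ring
    rw [this, Real.exp_sub (m * (Real.log n + Real.log (α - ρ))), e1]
    have := Real.exp_pos (m * Real.log m - m)
    field_simp
  rw [e3]
  have h5 : Real.exp (-(n * (η / 2))) ≤ (Real.exp 1 * (m + 1))⁻¹ := by
    rw [Real.exp_neg]
    apply inv_anti₀ (by positivity)
    refine le_trans ?_ hpoly
    have h6 : (m:ℝ) + 1 ≤ (x + ρ + 1) * n := by
      have : (m:ℝ) ≤ (x + ρ) * n := by rw [← htm]; apply mul_le_mul_of_nonneg_right _ hnpos.le; linarith
      linarith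
    rw [pow_one, mul_assoc]
    exact mul_le_mul_of_nonneg_left h6 (Real.exp_pos 1).le
  calc Real.exp (n * (x * (1 + Real.log α - Real.log x) - η))
      ≤ Real.exp (-(n * (η / 2))) * Real.exp (n * (t * Real.log (α - ρ) - t * Real.log t + t)) := by
        rw [← Real.exp_add]
        apply Real.exp_le_exp.2
        have : x * (1 + Real.log α - Real.log x) - η ≤ -(η/2) + (t * Real.log (α - ρ) - t * Real.log t + t) := by
          linarith [hdd.1]
        calc _ ≤ n * (-(η/2) + (t * Real.log (α - ρ) - t * Real.log t + t)) := mul_le_mul_of_nonneg_left this hnpos.le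
          _ = _ := by ring
    _ ≤ _ := mul_le_mul_of_nonneg_right h5 (Real.exp_pos _).le

/-- limiting coefficients, `alp k` is for component size `k+1`. -/
def alp (lam q : ℝ) (k : ℕ) : ℝ := q * lam ^ k * tw k / (k + 1)

lemma alp_pos {lam q : ℝ} (hl : 0 < lam) (hq : 0 < q) (k : ℕ) : 0 < alp lam q k := by
  have := tw_pos k
  unfold alp; positivity

lemma aq_micro_lower {lam q : ℝ} (hl : 0 < lam) (hq : 0 < q) (k : ℕ) {ρ : ℝ} (hρ : 0 < ρ) :
    ∀ᶠ n : ℕ in atTop, n * (alp lam q k - ρ) ≤ aq lam q n (k + 1) := by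
  have ht : Tendsto (fun n : ℕ => lam / n) atTop (𝓝[>] 0) := by
    apply tendsto_nhdsWithin_of_tendsto_nhds_of_eventually_within
    · exact tendsto_const_div_atTop_nhds_zero_nat lam
    · filter_upwards [ev_lam hl one_pos] with n hn
      exact hn.1
  have h := ((cc_micro_limit k).comp ht).const_mul (q * lam ^ k / ((k + 1).factorial : ℝ))
  have e : q * lam ^ k / ((k + 1).factorial : ℝ) * (k.factorial * tw k) = alp lam q k := by
    unfold alp
    rw [Nat.factorial_succ]; push_cast
    have : (k.factorial : ℝ) ≠ 0 := by positivity
    field_simp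
  rw [e] at h
  filter_upwards [h.eventually_const_lt (show alp lam q k - ρ < alp lam q k by linarith), ev_lam hl one_pos]
    with n h1 h2
  obtain ⟨hp0, hp1, hn1⟩ := h2
  have hnpos : (0:ℝ) < n := by exact_mod_cast hn1
  have he : 1 ≤ eh (lam / n) (k + 1) :=
    le_trans (Real.one_le_exp (by positivity)) (eh_lower hp1 (k + 1))
  have hcc := cc_nonneg hp0.le hp1.le (k + 1)
  simp only [Function.comp] at h1
  refine (mul_le_mul_of_nonneg_left h1.le hnpos.le).trans ?_
  unfold aq al
  calc n * (q * lam ^ k / ((k + 1).factorial : ℝ) * (cc (lam / n) (k + 1) / (lam / n) ^ k))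
      = q * (n ^ (k + 1) * (cc (lam / n) (k + 1) * 1 / ((k + 1).factorial : ℝ))) := by
        rw [div_pow]; field_simp; ring
    _ ≤ _ := by gcongr

/-- lower-bound predicate for truncated coefficients -/
def LBK (lam q : ℝ) (K : ℕ) (s v : ℝ) : Prop :=
  ∀ η > 0, ∃ ρ > 0, ∀ᶠ n : ℕ in atTop, ∀ l : ℕ, |(l : ℝ) / n - s| ≤ ρ →
    Real.exp (n * (v - η)) ≤ expC (fun k => if k ≤ K then aq lam q n k else 0) l

lemma LBK_one {lam q : ℝ} (hl : 0 < lam) (hq : 0 < q) {s : ℝ} (hs : 0 ≤ s) :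
    LBK lam q 1 s (s * (1 + Real.log q - Real.log s)) := by
  intro η hη
  obtain ⟨ρ, hρ, h⟩ := pois_lower (alp_pos hl hq 0) hs hη
  refine ⟨ρ, hρ, ?_⟩
  filter_upwards [h, aq_micro_lower hl hq 0 hρ] with n h1 h2 l hl'
  have h3 := h1 l _ hl' h2
  have e : alp lam q 0 = q := by simp [alp, tw_zero]
  rw [e] at h3
  refine h3.trans (le_of_eq ?_)
  have h4 := expC_single 0 (aq lam q n (0 + 1)) l
  simp at h4
  rw [zero_add, ← h4]
  apply expC_congr
  intro k hk
  by_cases h : k = 1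
  · simp [h]
  · rw [if_neg h, if_neg (by omega)]

lemma LBK_step {lam q : ℝ} (hl : 0 < lam) (hq : 0 < q) {K : ℕ} {s v μ : ℝ} (hs : 0 < s) (hμ : 0 < μ)
    (h : LBK lam q K s v) :
    LBK lam q (K + 1) (s + (K + 1) * μ) (v + μ * (1 + Real.log (alp lam q K) - Real.log μ)) := by
  intro η hη
  obtain ⟨ρ1, hρ1, h1⟩ := pois_lower (alp_pos hl hq K) hμ.le (half_pos hη)
  obtain ⟨ρ2, hρ2, h2⟩ := h (η / 2) (half_pos hη)
  refine ⟨min (ρ2 / 2) s, by positivity, ?_⟩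
  have hlim := tendsto_const_div_atTop_nhds_zero_nat ((K : ℝ) + 1)
  have hlim1 := tendsto_const_div_atTop_nhds_zero_nat (1 : ℝ)
  filter_upwards [h1, h2, aq_micro_lower hl hq K hρ1, ev_lam hl one_pos,
    hlim.eventually_lt_const (half_pos hρ2), hlim1.eventually_lt_const hρ1] with n h1 h2 h3 h4 h5 h6 l hl'
  obtain ⟨hp0, hp1, hn1⟩ := h4
  have hnpos : (0:ℝ) < n := by exact_mod_cast hn1
  set m := ⌊μ * n⌋₊ with hm
  have hm1 : (m:ℝ) ≤ μ * n := Nat.floor_le (by positivity)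
  have hm2 : μ * n < m + 1 := Nat.lt_floor_add_one _
  have hm1' : (m:ℝ) / n ≤ μ := by rwa [div_le_iff₀ hnpos]
  have hm2' : μ ≤ (m:ℝ) / n + 1 / n := by rw [← add_div, le_div_iff₀ hnpos]; exact hm2.le
  obtain ⟨ha, hb⟩ := abs_le.1 hl'
  have hmin1 := min_le_left (ρ2 / 2) s
  have hmin2 := min_le_right (ρ2 / 2) s
  have hKm : (K + 1) * m ≤ l := by
    have : ((K:ℝ) + 1) * m ≤ l := by
      have h7 : ((K:ℝ) + 1) * μ ≤ (l:ℝ) / n := by linarith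
      rw [le_div_iff₀ hnpos] at h7
      refine le_trans ?_ h7
      rw [mul_assoc]
      exact mul_le_mul_of_nonneg_left hm1 (by positivity)
    exact_mod_cast this
  have e1 := h1 m _ (by rw [abs_le]; constructor <;> linarith) h3
  have hcast : ((l - (K + 1) * m : ℕ) : ℝ) / n = (l : ℝ) / n - (K + 1) * (m / n) := by
    rw [Nat.cast_sub hKm]; push_cast; ring
  have hK1 := mul_le_mul_of_nonneg_left hm1' (show (0:ℝ) ≤ K + 1 by positivity)
  have hK2 := mul_le_mul_of_nonneg_left hm2' (show (0:ℝ) ≤ K + 1 by positivity)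
  rw [mul_add, mul_one_div] at hK2
  have e2 := h2 (l - (K + 1) * m) (by
    rw [hcast, abs_le]; constructor <;> linarith)
  have hcongr : expC (fun k => if k ≤ K + 1 then aq lam q n k else 0) l =
      expC (fun k => (if k ≤ K then aq lam q n k else 0) + (if k = K + 1 then aq lam q n (K + 1) else 0)) l := by
    apply expC_congr
    intro k hk
    by_cases h : k = K + 1
    · simp [h]
    · rw [if_neg h, add_zero]
      by_cases h' : k ≤ K
      · rw [if_pos h', if_pos (by omega)]
      · rw [if_neg h', if_neg (by omega)]
  rw [hcongr, expC_add]
  have hnn1 : ∀ k, 0 ≤ (if k ≤ K then aq lam q n k else 0) := by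
    intro k; split_ifs
    · exact aq_nonneg hq.le hp0.le hp1.le k
    · exact le_rfl
  have hnn2 : ∀ k, 0 ≤ (if k = K + 1 then aq lam q n (K + 1) else 0) := by
    intro k; split_ifs
    · exact aq_nonneg hq.le hp0.le hp1.le _
    · exact le_rfl
  have hsingle := Finset.single_le_sum (f := fun j => expC (fun k => if k ≤ K then aq lam q n k else 0) j *
      expC (fun k => if k = K + 1 then aq lam q n (K + 1) else 0) (l - j)) (s := Finset.range (l + 1))
      (fun j _ => mul_nonneg (expC_nonneg hnn1 _) (expC_nonneg hnn2 _))
      (show l - (K + 1) * m ∈ Finset.range (l + 1) by rw [Finset.mem_range]; omega)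
  refine le_trans ?_ hsingle
  rw [show l - (l - (K + 1) * m) = (K + 1) * m by omega, expC_single,
    if_pos (Dvd.intro _ rfl), Nat.mul_div_cancel_left _ (Nat.succ_pos K)]
  calc _ = Real.exp (n * (v - η / 2)) * Real.exp (n * (μ * (1 + Real.log (alp lam q K) - Real.log μ) - η / 2)) := by
        rw [← Real.exp_add]; ring_nf
    _ ≤ _ := mul_le_mul e2 e1 (Real.exp_pos _).le (expC_nonneg hnn1 _)

/-- lower-bound predicate for small components -/
def LB (lam q ε : ℝ) (s v : ℝ) : Prop :=
  ∀ η > 0, ∃ ρ > 0, ∀ᶠ n : ℕ in atTop, ∀ l : ℕ, |(l : ℝ) / n - s| ≤ ρ →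
    Real.exp (n * (v - η)) ≤ SS lam q n (ε * n) l

lemma LB_of_LBK {lam q ε : ℝ} (hl : 0 < lam) (hq : 0 < q) (hε : 0 < ε) {s v : ℝ}
    (h : ∀ η > 0, ∃ K v', v - η ≤ v' ∧ LBK lam q K s v') : LB lam q ε s v := by
  intro η hη
  obtain ⟨K, v', hv, hK⟩ := h (η / 2) (half_pos hη)
  obtain ⟨ρ, hρ, h1⟩ := hK (η / 2) (half_pos hη)
  refine ⟨ρ, hρ, ?_⟩
  have hlim := tendsto_const_div_atTop_nhds_zero_nat (K : ℝ)
  filter_upwards [h1, ev_lam hl one_pos, hlim.eventually_lt_const hε] with n h1 h4 h5 l hl'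
  obtain ⟨hp0, hp1, hn1⟩ := h4
  have hnpos : (0:ℝ) < n := by exact_mod_cast hn1
  refine le_trans ?_ ((h1 l hl').trans ?_)
  · apply Real.exp_le_exp.2
    apply mul_le_mul_of_nonneg_left _ hnpos.le
    linarith
  · unfold SS
    apply expC_mono
    · intro k; split_ifs
      · exact aq_nonneg hq.le hp0.le hp1.le k
      · exact le_rfl
    · intro k
      have := aq_nonneg (lam := lam) hq.le hp0.le hp1.le k
      by_cases h : k ≤ K
      · rw [if_pos h, if_pos]
        rw [div_lt_iff₀ hnpos] at h5
        have : (k:ℝ) ≤ K := by exact_mod_cast h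
        linarith
      · rw [if_neg h]; split_ifs <;> linarith

-- PART 12

lemma LBK_chain {lam q y : ℝ} (hl : 0 < lam) (hq : 0 < q) (hy : 0 < y) {s1 : ℝ} (hs1 : 0 < s1) (N : ℕ) :
    LBK lam q (N + 1)
      (s1 + ∑ i ∈ Finset.range N, q / lam * (tw (i + 1) * (lam * y) ^ (i + 2)))
      (s1 * (1 + Real.log q - Real.log s1) +
        ∑ i ∈ Finset.range N, (q / lam * (tw (i + 1) / ((i + 1 : ℕ) + 1) * (lam * y) ^ (i + 2)) -
          Real.log y * (q / lam * (tw (i + 1) * (lam * y) ^ (i + 2))))) := by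
  induction N with
  | zero => simpa using LBK_one hl hq hs1.le
  | succ N ih =>
    have htw := tw_pos (N + 1)
    have ha := alp_pos hl hq (N + 1)
    have hs : 0 < s1 + ∑ i ∈ Finset.range N, q / lam * (tw (i + 1) * (lam * y) ^ (i + 2)) := by
      apply add_pos_of_pos_of_nonneg hs1
      apply Finset.sum_nonneg
      intro i _
      have := tw_pos (i + 1)
      positivity
    have h := LBK_step hl hq hs (mul_pos ha (pow_pos hy (N + 2))) ih
    have e1 : ((N + 1 : ℕ) + 1 : ℝ) * (alp lam q (N + 1) * y ^ (N + 2)) = q / lam * (tw (N + 1) * (lam * y) ^ (N + 2)) := by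
      unfold alp
      rw [mul_pow]
      field_simp
      ring
    have e2 : alp lam q (N + 1) * y ^ (N + 2) = q / lam * (tw (N + 1) / ((N + 1 : ℕ) + 1) * (lam * y) ^ (N + 2)) := by
      unfold alp
      rw [mul_pow]
      field_simp
      ring
    have e3 : (alp lam q (N + 1) * y ^ (N + 2)) * (1 + Real.log (alp lam q (N + 1)) - Real.log (alp lam q (N + 1) * y ^ (N + 2)))
      = q / lam * (tw (N + 1) / ((N + 1 : ℕ) + 1) * (lam * y) ^ (N + 2)) - Real.log y * (q / lam * (tw (N + 1) * (lam * y) ^ (N + 2))) := by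
      rw [← e1, ← e2, Real.log_mul ha.ne' (pow_pos hy _).ne', Real.log_pow]
      push_cast
      ring
    rw [e1, e3] at h
    rw [Finset.sum_range_succ, Finset.sum_range_succ, ← add_assoc, ← add_assoc]
    exact h

lemma LB_sub {lam q ε : ℝ} (hl : 0 < lam) (hq : 0 < q) (hε : 0 < ε) {s : ℝ} (hs : 0 ≤ s) (hs1 : lam * s ≤ q) :
    LB lam q ε s (FF lam q s) := by
  apply LB_of_LBK hl hq hε
  intro η hη
  rcases hs.eq_or_lt with rfl | hs
  · refine ⟨1, _, ?_, LBK_one hl hq le_rfl⟩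
    rw [FF_zero hq]; simp; exact hη.le
  set τ := lam * s / q with hτ
  have hτ0 : 0 < τ := by positivity
  have hτ1 : τ ≤ 1 := by rw [hτ, div_le_one hq]; exact hs1
  set y := τ * Real.exp (-τ) / lam with hy
  have hy0 : 0 < y := by positivity
  have hly : lam * y = τ * Real.exp (-τ) := by rw [hy]; field_simp
  have hU := (hasSum_nat_add_iff' 1).2 (tw_hasSum hτ0.le hτ1)
  have hW := (hasSum_nat_add_iff' 1).2 (tv_hasSum hτ0.le hτ1)
  simp only [Finset.sum_range_one, tw_zero, zero_add, pow_one, one_mul, Nat.cast_zero, div_one] at hU hW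
  rw [← hly] at hU hW
  have hU2 := (hU.mul_left (q / lam)).tendsto_sum_nat
  have hW2 := (hW.mul_left (q / lam)).tendsto_sum_nat
  have eτ : q / lam * τ = s := by rw [hτ]; field_simp
  have hlim0 : Tendsto (fun N => s - ∑ i ∈ Finset.range N, q / lam * (tw (i + 1) * (lam * y) ^ (i + 2))) atTop (𝓝 (q * y)) := by
    have := hU2.const_sub s
    have e : s - q / lam * (τ - lam * y) = q * y := by
      rw [mul_sub, eτ]; field_simp; ring
    rw [e] at this
    exact this
  have hpos : ∀ N, 0 < s - ∑ i ∈ Finset.range N, q / lam * (tw (i + 1) * (lam * y) ^ (i + 2)) := by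
    intro N
    have h1 : ∑ i ∈ Finset.range N, q / lam * (tw (i + 1) * (lam * y) ^ (i + 2)) ≤ q / lam * (τ - lam * y) := by
      apply sum_le_hasSum _ _ (hU.mul_left (q / lam))
      intro i _
      have := tw_pos (i + 1)
      positivity
    have e : q / lam * (τ - lam * y) = s - q * y := by
      rw [mul_sub, eτ]; field_simp
    rw [e] at h1
    have : 0 < q * y := by positivity
    linarith
  have hcont : ContinuousAt (fun x : ℝ => x * (1 + Real.log q - Real.log x)) (q * y) := by
    have h3 : ContinuousAt (fun z : ℝ => Real.log z) (q * y) := by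
      apply ContinuousAt.log
      · fun_prop
      · exact (mul_pos hq hy0).ne'
    fun_prop
  have hlim1 := (hcont.tendsto.comp hlim0).add (hW2.sub (hU2.const_mul (Real.log y)))
  have elim : q * y * (1 + Real.log q - Real.log (q * y)) + (q / lam * (τ - τ ^ 2 / 2 - lam * y) -
      Real.log y * (q / lam * (τ - lam * y))) = FF lam q s := by
    rw [FF_tau hl hq hs]
    have : tauF lam q s = τ := min_eq_left hτ1
    rw [this]
    have ely : Real.log y = Real.log τ - τ - Real.log lam := by
      rw [hy, Real.log_div (by positivity) hl.ne', Real.log_mul hτ0.ne' (Real.exp_pos _).ne', Real.log_exp]; ring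
    rw [← ely, Real.log_mul hq.ne' hy0.ne']
    have : s = q / lam * τ := eτ.symm
    rw [this]
    field_simp
    ring
  rw [elim] at hlim1
  obtain ⟨N, hN⟩ := (hlim1.eventually_const_lt (show FF lam q s - η < FF lam q s by linarith)).exists
  have hchain := LBK_chain hl hq hy0 (hpos N) N
  rw [sub_add_cancel] at hchain
  refine ⟨N + 1, _, hN.le, ?_⟩
  rw [Finset.sum_sub_distrib, ← Finset.mul_sum (a := Real.log y)] at hchain
  exact hchain

lemma expC_term_le {a : ℕ → ℝ} (ha : ∀ k, 0 ≤ a k) {k l : ℕ} (hk : 1 ≤ k) (hkl : k ≤ l) :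
    a k * expC a (l - k) ≤ l * expC a l := by
  obtain ⟨j, rfl⟩ : ∃ j, k = j + 1 := ⟨k - 1, by omega⟩
  obtain ⟨m, rfl⟩ : ∃ m, l = m + 1 := ⟨l - 1, by omega⟩
  have h := expC_succ a m
  push_cast
  rw [h]
  have h1 := Finset.single_le_sum (f := fun k : ℕ => ((k : ℝ) + 1) * a (k + 1) * expC a (m - k)) (s := Finset.range (m + 1))
    (fun i _ => mul_nonneg (mul_nonneg (by positivity) (ha _)) (expC_nonneg ha _))
    (show j ∈ Finset.range (m + 1) by rw [Finset.mem_range]; omega)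
  refine le_trans ?_ h1
  apply mul_le_mul_of_nonneg_right _ (expC_nonneg ha _)
  have := ha (j + 1)
  have h2 : (0:ℝ) ≤ j := by positivity
  have := mul_nonneg h2 this
  linarith

lemma LB_giant {lam q ε : ℝ} (hl : 0 < lam) (hq : 1 ≤ q) {s v b : ℝ} (hs : 0 ≤ s) (hb : 0 < b) (hbε : b ≤ ε)
    (h : LB lam q ε s v) : LB lam q ε (s + b) (v + gr lam b) := by
  intro η hη
  obtain ⟨ρ1, hρ1, h1⟩ := al_macro_lower hl hb (show 0 < η / 3 by positivity)
  obtain ⟨ρ2, hρ2, h2⟩ := h (η / 3) (by positivity)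
  set σ := min (min (ρ1 / 2) (ρ2 / 4)) (b / 2) with hσ
  have hσ0 : 0 < σ := by positivity
  have hσ1 : σ ≤ ρ1 / 2 := (min_le_left _ _).trans (min_le_left _ _)
  have hσ2 : σ ≤ ρ2 / 4 := (min_le_left _ _).trans (min_le_right _ _)
  have hσ3 : σ ≤ b / 2 := min_le_right _ _
  refine ⟨σ, hσ0, ?_⟩
  have hlim1 := tendsto_const_div_atTop_nhds_zero_nat (1 : ℝ)
  filter_upwards [h1, h2, ev_lam hl one_pos, hlim1.eventually_lt_const hσ0,
    poly_le_exp (s + b + σ) 1 (show 0 < η / 3 by positivity)] with n h1 h2 h4 h6 hpoly l hl'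
  obtain ⟨hp0, hp1, hn1⟩ := h4
  have hnpos : (0:ℝ) < n := by exact_mod_cast hn1
  set k := ⌊(b - σ) * n⌋₊ with hk
  have hk1 : (k:ℝ) ≤ (b - σ) * n := Nat.floor_le (mul_nonneg (by linarith) hnpos.le)
  have hk2 : (b - σ) * n < k + 1 := Nat.lt_floor_add_one _
  have hk1' : (k:ℝ) / n ≤ b - σ := by rwa [div_le_iff₀ hnpos]
  have hk2' : b - σ ≤ (k:ℝ) / n + 1 / n := by rw [← add_div, le_div_iff₀ hnpos]; exact hk2.le
  obtain ⟨ha, hb'⟩ := abs_le.1 hl'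
  have hkpos : 1 ≤ k := by
    by_contra hc
    have : k = 0 := by omega
    rw [this] at hk2'
    simp at hk2'
    rw [one_div] at h6
    linarith
  have hkl : k ≤ l := by
    have : (k:ℝ) ≤ l := by
      have h7 : b - σ ≤ (l:ℝ) / n := by linarith
      rw [le_div_iff₀ hnpos] at h7
      linarith
    exact_mod_cast this
  have hcast : ((l - k : ℕ) : ℝ) / n = (l : ℝ) / n - k / n := by
    rw [Nat.cast_sub hkl]; ring
  have e1 := h1 k (by rw [abs_le]; constructor <;> linarith)
  have e2 := h2 (l - k) (by rw [hcast, abs_le]; constructor <;> linarith)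
  have hnn : ∀ k : ℕ, 0 ≤ (if (k:ℝ) ≤ ε * n then aq lam q n k else 0) := by
    intro k; split_ifs
    · exact aq_nonneg (by linarith) hp0.le hp1.le k
    · exact le_rfl
  have hmain := expC_term_le hnn hkpos hkl
  rw [if_pos (by
    refine hk1.trans (mul_le_mul_of_nonneg_right ?_ hnpos.le); linarith)] at hmain
  have hSS : SS lam q n (ε * n) l = expC (fun k : ℕ => if (k:ℝ) ≤ ε * n then aq lam q n k else 0) l := rfl
  rw [← hSS] at hmain
  have hSS0 : 0 ≤ SS lam q n (ε * n) l := expC_nonneg hnn l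
  have hln : (l:ℝ) ≤ Real.exp (n * (η / 3)) := by
    refine le_trans ?_ hpoly
    have : (l:ℝ) / n ≤ s + b + σ := by linarith
    rw [div_le_iff₀ hnpos] at this
    simpa using this
  have hal : Real.exp (n * (gr lam b - η / 3)) ≤ aq lam q n k := by
    refine e1.trans ?_
    unfold aq
    have := al_nonneg hp0.le hp1.le k
    have h0 : 0 ≤ (n:ℝ) ^ k * al (lam / n) k := by positivity
    exact le_mul_of_one_le_left h0 hq
  have hfin : Real.exp (n * (gr lam b - η / 3)) * Real.exp (n * (v - η / 3)) ≤ Real.exp (n * (η / 3)) * SS lam q n (ε * n) l :=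
    calc _ ≤ _ := mul_le_mul hal e2 (Real.exp_pos _).le ((Real.exp_pos _).le.trans hal)
      _ ≤ l * SS lam q n (ε * n) l := hmain
      _ ≤ _ := mul_le_mul_of_nonneg_right hln hSS0
  rw [mul_comm (Real.exp (n * (η / 3))), ← div_le_iff₀ (Real.exp_pos _), ← Real.exp_add, ← Real.exp_sub] at hfin
  refine le_trans (le_of_eq ?_) hfin
  congr 1
  ring

lemma LB_mono {lam q ε s v w : ℝ} (h : LB lam q ε s v) (hw : w ≤ v) : LB lam q ε s w := by
  intro η hη
  obtain ⟨ρ, hρ, h1⟩ := h η hη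
  refine ⟨ρ, hρ, ?_⟩
  filter_upwards [h1] with n h1 l hl
  refine le_trans ?_ (h1 l hl)
  apply Real.exp_le_exp.2
  apply mul_le_mul_of_nonneg_left _ (by positivity)
  linarith

lemma LB_full {lam q ε : ℝ} (hl : 0 < lam) (hq : 1 ≤ q) (hε : 0 < ε) {s : ℝ} (hs : 0 ≤ s) :
    LB lam q ε s (FF lam q s) := by
  have hq0 : 0 < q := by linarith
  by_cases hc : lam * s ≤ q
  · exact LB_sub hl hq0 hε hs hc
  have hc' : q / lam < s := by rw [div_lt_iff₀ hl]; linarith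
  rw [FF_super hl hq0 hc'.le]
  obtain ⟨N, hN⟩ := exists_nat_gt ((s - q / lam) / ε)
  have hpos : 0 < s - q / lam := by linarith
  have hNpos : (0:ℝ) < N := lt_trans (by positivity) hN
  set b := (s - q / lam) / N with hb
  have hb0 : 0 < b := by positivity
  have hbε : b ≤ ε := by
    rw [hb, div_le_iff₀ hNpos]
    rw [div_lt_iff₀ hε] at hN
    linarith
  have key : ∀ j : ℕ, LB lam q ε (q / lam + j * b) (FF lam q (q / lam) + j * b * (1 + Real.log lam)) := by
    intro j
    induction j with
    | zero => simpa using LB_sub hl hq0 hε (s := q / lam) (by positivity) (le_of_eq (by field_simp))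
    | succ j ih =>
      have h := LB_giant hl hq (by positivity) hb0 hbε ih
      have e : q / lam + ((j + 1 : ℕ) : ℝ) * b = q / lam + j * b + b := by push_cast; ring
      rw [e]
      refine LB_mono h ?_
      have h2 := mul_le_mul_of_nonneg_left (hr_lower hl hb0) hb0.le
      rw [← gr_eq_hr hl hb0.le] at h2
      push_cast
      linarith
  have h := key N
  have e : (N:ℝ) * b = s - q / lam := by rw [hb]; field_simp
  rw [e] at h
  simpa using h

-- PART 13

lemma expC_exists_list {b : ℕ → ℝ} (hb : ∀ k, 0 ≤ b k) {N : ℝ} (hN : 0 ≤ N) (m : ℕ) :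
    (m : ℝ) ≤ N → 0 < expC b m → ∃ ks : List ℕ, ks.sum = m ∧ (∀ k ∈ ks, 1 ≤ k ∧ 0 < b k) ∧
      expC b m ≤ (ks.map (fun k => N * b k)).prod := by
  induction m using Nat.strong_induction_on with
  | _ m ih =>
    intro hmN hpos
    rcases Nat.eq_zero_or_pos m with rfl | hm
    · exact ⟨[], by simp, by simp, by simp [expC_zero]⟩
    obtain ⟨j, rfl⟩ : ∃ j, m = j + 1 := ⟨m - 1, by omega⟩
    have hrec := expC_succ b j
    have hj : (0:ℝ) < (j:ℝ) + 1 := by positivity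
    have hle : ∃ k ∈ Finset.range (j + 1), expC b (j + 1) ≤ N * b (k + 1) * expC b (j - k) := by
      by_contra hcon
      push Not at hcon
      have h1 : ∑ k ∈ Finset.range (j + 1), ((k : ℝ) + 1) * b (k + 1) * expC b (j - k) ≤
          ∑ k ∈ Finset.range (j + 1), N * b (k + 1) * expC b (j - k) := by
        apply Finset.sum_le_sum
        intro k hk
        rw [Finset.mem_range] at hk
        have : (k:ℝ) + 1 ≤ N := by
          refine le_trans ?_ hmN
          push_cast
          have : (k:ℝ) ≤ j := by exact_mod_cast (by omega : k ≤ j)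
          linarith
        have h2 := hb (k + 1)
        have h3 := expC_nonneg hb (j - k)
        gcongr
      have h2 : ∑ k ∈ Finset.range (j + 1), N * b (k + 1) * expC b (j - k) <
          ∑ k ∈ Finset.range (j + 1), expC b (j + 1) :=
        Finset.sum_lt_sum_of_nonempty ⟨0, by simp⟩ hcon
      rw [Finset.sum_const, Finset.card_range, nsmul_eq_mul] at h2
      push_cast at h2
      linarith
    obtain ⟨k, hk, hle⟩ := hle
    rw [Finset.mem_range] at hk
    have hprod : 0 < N * b (k + 1) * expC b (j - k) := lt_of_lt_of_le hpos hle
    have hE := expC_nonneg hb (j - k)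
    have hE' : 0 < expC b (j - k) := by
      rcases hE.eq_or_lt with h | h
      · rw [← h, mul_zero] at hprod; exact absurd hprod (lt_irrefl _)
      · exact h
    have hb' : 0 < b (k + 1) := by
      rcases (hb (k + 1)).eq_or_lt with h | h
      · rw [← h, mul_zero, zero_mul] at hprod; exact absurd hprod (lt_irrefl _)
      · exact h
    have hjk : ((j - k : ℕ) : ℝ) ≤ N := by
      refine le_trans ?_ hmN
      exact_mod_cast (by omega : j - k ≤ j + 1)
    obtain ⟨ks, h1, h2, h3⟩ := ih (j - k) (by omega) hjk hE'
    refine ⟨(k + 1) :: ks, ?_, ?_, ?_⟩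
    · rw [List.sum_cons, h1]; omega
    · intro x hx
      rcases List.mem_cons.1 hx with rfl | hx
      · exact ⟨by omega, hb'⟩
      · exact h2 x hx
    · rw [List.map_cons, List.prod_cons]
      exact hle.trans (mul_le_mul_of_nonneg_left h3 (by positivity))

lemma list_len {δ : ℝ} {n : ℕ} (ks : List ℕ) (h : ∀ k ∈ ks, δ * n < (k:ℝ)) :
    (ks.length : ℝ) * (δ * n) ≤ (ks.sum : ℝ) := by
  induction ks with
  | nil => simp
  | cons k ks ih =>
    simp only [List.length_cons, List.sum_cons]
    have h1 := h k (by simp)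
    have h2 := ih (fun x hx => h x (by simp [hx]))
    rw [Nat.cast_add, Nat.cast_add, Nat.cast_one]
    linarith

lemma list_prod_le {W G : ℝ} {c g : ℕ → ℝ} (ks : List ℕ) (hW : 1 ≤ W)
    (h : ∀ k ∈ ks, 0 ≤ c k ∧ c k ≤ W * Real.exp (G * g k)) :
    (ks.map c).prod ≤ W ^ ks.length * Real.exp (G * (ks.map g).sum) := by
  induction ks with
  | nil => simp
  | cons k ks ih =>
    simp only [List.map_cons, List.prod_cons, List.sum_cons, List.length_cons]
    have h1 := h k (by simp)
    have h2 := ih (fun x hx => h x (by simp [hx]))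
    have h3 : 0 ≤ (ks.map c).prod := by
      apply List.prod_nonneg
      intro x hx
      obtain ⟨y, hy, rfl⟩ := List.mem_map.1 hx
      exact (h y (by simp [hy])).1
    calc c k * (ks.map c).prod ≤ (W * Real.exp (G * g k)) * (W ^ ks.length * Real.exp (G * (ks.map g).sum)) :=
          mul_le_mul h1.2 h2 h3 (h1.1.trans h1.2)
      _ = _ := by rw [mul_add, Real.exp_add]; ring

lemma list_mem_le_sum (ks : List ℕ) {k : ℕ} (hk : k ∈ ks) : k ≤ ks.sum :=
  List.single_le_sum (fun _ _ => Nat.zero_le _) k hk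

lemma big_list {lam q δ η : ℝ} (hl : 0 < lam) (hq : 0 < q) (hδ : 0 < δ) (hη : 0 < η) :
    ∀ᶠ n : ℕ in atTop, ∀ m : ℕ, m ≤ n → ∀ b : ℕ → ℝ, (∀ k, 0 ≤ b k) → (∀ k, b k ≤ aq lam q n k) →
      (∀ k, 0 < b k → δ * n < (k:ℝ)) → 0 < expC b m →
      ∃ ks : List ℕ, ks.sum = m ∧ (∀ k ∈ ks, 1 ≤ k ∧ 0 < b k) ∧
        expC b m ≤ Real.exp (n * (η + (ks.map (fun k : ℕ => gr lam ((k:ℝ) / n))).sum)) := by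
  obtain ⟨C, hC, hal⟩ := al_macro_upper hl hδ
  set J := ⌊1 / δ⌋₊ with hJ
  filter_upwards [hal, poly_le_exp ((q * C + 1) ^ J) (2 * J) hη, eventually_ge_atTop 1]
    with n hal hpoly hn1 m hm b hb0 hb1 hb2 hpos
  have hnpos : (0:ℝ) < n := by exact_mod_cast hn1
  have hn1' : (1:ℝ) ≤ n := by exact_mod_cast hn1
  obtain ⟨ks, h1, h2, h3⟩ := expC_exists_list hb0 hnpos.le m (by exact_mod_cast hm) hpos
  refine ⟨ks, h1, h2, h3.trans ?_⟩
  have hW : 1 ≤ (q * C + 1) * (n:ℝ) ^ 2 := by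
    have e1 : 1 ≤ (n:ℝ) ^ 2 := one_le_pow₀ hn1'
    have e2 : 1 ≤ q * C + 1 := by have := mul_pos hq hC; linarith
    exact one_le_mul_of_one_le_of_one_le e2 e1
  have hlen : ks.length ≤ J := by
    rw [hJ]
    apply Nat.le_floor
    have h4 := list_len (δ := δ) (n := n) ks (fun k hk => hb2 k (h2 k hk).2)
    rw [le_div_iff₀ hδ]
    have h5 : (ks.sum : ℝ) ≤ n := by rw [h1]; exact_mod_cast hm
    have h6 : (ks.length * δ) * n ≤ 1 * n := by linarith
    exact le_of_mul_le_mul_right h6 hnpos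
  have hp := list_prod_le (W := (q * C + 1) * (n:ℝ) ^ 2) (G := n) (c := fun k => n * b k)
    (g := fun k : ℕ => gr lam ((k:ℝ) / n)) ks hW (by
    intro k hk
    refine ⟨mul_nonneg hnpos.le (hb0 k), ?_⟩
    have hkn : k ≤ n := by
      have := list_mem_le_sum ks hk
      omega
    have h7 := hal k (hb2 k (h2 k hk).2).le hkn
    have hE := Real.exp_pos (n * gr lam ((k:ℝ) / n))
    calc n * b k ≤ n * (q * (C * n * Real.exp (n * gr lam ((k:ℝ) / n)))) := by
          apply mul_le_mul_of_nonneg_left _ hnpos.le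
          refine (hb1 k).trans ?_
          unfold aq
          exact mul_le_mul_of_nonneg_left h7 hq.le
      _ = (q * C) * (n:ℝ) ^ 2 * Real.exp (n * gr lam ((k:ℝ) / n)) := by ring
      _ ≤ _ := by gcongr; linarith)
  refine hp.trans ?_
  rw [mul_add, Real.exp_add]
  apply mul_le_mul_of_nonneg_right _ (Real.exp_pos _).le
  refine le_trans (pow_le_pow_right₀ hW hlen) (le_trans (le_of_eq ?_) hpoly)
  rw [mul_pow, ← pow_mul]

lemma BB_nonneg {lam q : ℝ} (hq : 0 ≤ q) {n : ℕ} (h0 : 0 ≤ lam / n) (h1 : lam / n ≤ 1) (r : ℝ) (m : ℕ) :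
    0 ≤ BB lam q n r m := by
  apply expC_nonneg
  intro k; split_ifs
  · exact aq_nonneg hq h0 h1 k
  · exact le_rfl

lemma SS_nonneg {lam q : ℝ} (hq : 0 ≤ q) {n : ℕ} (h0 : 0 ≤ lam / n) (h1 : lam / n ≤ 1) (r : ℝ) (m : ℕ) :
    0 ≤ SS lam q n r m := by
  apply expC_nonneg
  intro k; split_ifs
  · exact aq_nonneg hq h0 h1 k
  · exact le_rfl

lemma BB_upper {lam q ε η : ℝ} (hl : 0 < lam) (hq : 0 < q) (hε : 0 < ε) (hη : 0 < η) :
    ∀ᶠ n : ℕ in atTop, ∀ m : ℕ, m ≤ n →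
      BB lam q n (ε * n) m ≤ Real.exp (n * (η + gr lam ((m:ℝ) / n))) := by
  filter_upwards [big_list hl hq hε hη, ev_lam hl one_pos] with n h hlam m hm
  obtain ⟨hp0, hp1, hn1⟩ := hlam
  have hnpos : (0:ℝ) < n := by exact_mod_cast hn1
  rcases (BB_nonneg hq.le hp0.le hp1.le (ε * n) m).eq_or_lt with h0 | hpos
  · rw [← h0]; exact (Real.exp_pos _).le
  have haq := fun k => aq_nonneg hq.le hp0.le hp1.le k
  obtain ⟨ks, h1, h2, h3⟩ := h m hm (fun k => if ε * n < (k:ℝ) then aq lam q n k else 0)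
    (by intro k; split_ifs; exacts [haq k, le_rfl])
    (by intro k; split_ifs; exacts [le_rfl, haq k])
    (by
      intro k hk
      by_contra hc
      rw [if_neg hc] at hk
      exact lt_irrefl _ hk) hpos
  refine h3.trans ?_
  apply Real.exp_le_exp.2
  apply mul_le_mul_of_nonneg_left _ hnpos.le
  have h4 := gr_list hl (ks.map (fun k : ℕ => (k:ℝ) / n)) (by
    intro b hb
    obtain ⟨k, hk, rfl⟩ := List.mem_map.1 hb
    have : (0:ℝ) < k := by exact_mod_cast (h2 k hk).1
    positivity)
  have h5 : ∀ L : List ℕ, (L.map (fun k : ℕ => (k:ℝ) / n)).sum = (L.sum : ℝ) / n := by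
    intro L
    induction L with
    | nil => simp
    | cons a L ih => simp only [List.map_cons, List.sum_cons, ih]; push_cast; ring
  rw [h5, h1, List.map_map] at h4
  have h6 : (ks.map (gr lam ∘ fun k : ℕ => (k:ℝ) / n)).sum = (ks.map (fun k : ℕ => gr lam ((k:ℝ) / n))).sum := rfl
  rw [h6] at h4
  linarith

lemma BB_lower {lam q ε η θ : ℝ} (hl : 0 < lam) (hq : 1 ≤ q) (hε : 0 < ε) (hη : 0 < η)
    (hθ : ε < θ) :
    ∀ᶠ n : ℕ in atTop, Real.exp (n * (gr lam θ - η)) ≤ BB lam q n (ε * n) ⌊θ * n⌋₊ := by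
  have hθ0 : 0 < θ := hε.trans hθ
  obtain ⟨ρ, hρ, h⟩ := al_macro_lower hl hθ0 (half_pos hη)
  have hlim1 := tendsto_const_div_atTop_nhds_zero_nat (1 : ℝ)
  filter_upwards [h, ev_lam hl one_pos, hlim1.eventually_lt_const hρ,
    hlim1.eventually_lt_const (show 0 < θ - ε by linarith), poly_le_exp θ 1 (half_pos hη)] with n h hlam h1 h2 hpoly
  obtain ⟨hp0, hp1, hn1⟩ := hlam
  have hnpos : (0:ℝ) < n := by exact_mod_cast hn1
  set m := ⌊θ * n⌋₊ with hm
  have hm1 : (m:ℝ) ≤ θ * n := Nat.floor_le (by positivity)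
  have hm2 : θ * n < m + 1 := Nat.lt_floor_add_one _
  have hm1' : (m:ℝ) / n ≤ θ := by rwa [div_le_iff₀ hnpos]
  have hm2' : θ ≤ (m:ℝ) / n + 1 / n := by rw [← add_div, le_div_iff₀ hnpos]; exact hm2.le
  have hεm : ε * n < m := by
    have : ε < (m:ℝ) / n := by linarith
    rwa [lt_div_iff₀ hnpos] at this
  have hmpos : 1 ≤ m := by
    have : (0:ℝ) < m := lt_of_le_of_lt (by positivity) hεm
    exact_mod_cast this
  have e1 := h m (by rw [abs_le]; constructor <;> linarith)
  have hnn : ∀ k : ℕ, 0 ≤ (if ε * n < (k:ℝ) then aq lam q n k else 0) := by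
    intro k; split_ifs
    · exact aq_nonneg (by linarith) hp0.le hp1.le k
    · exact le_rfl
  have hmain := expC_term_le hnn hmpos le_rfl
  rw [if_pos hεm, Nat.sub_self, expC_zero, mul_one] at hmain
  have hBB : BB lam q n (ε * n) m = expC (fun k : ℕ => if ε * n < (k:ℝ) then aq lam q n k else 0) m := rfl
  rw [← hBB] at hmain
  have hBB0 : 0 ≤ BB lam q n (ε * n) m := expC_nonneg hnn m
  have hal : Real.exp (n * (gr lam θ - η / 2)) ≤ aq lam q n m := by
    refine e1.trans ?_
    unfold aq
    have := al_nonneg hp0.le hp1.le m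
    have h0 : 0 ≤ (n:ℝ) ^ m * al (lam / n) m := by positivity
    exact le_mul_of_one_le_left h0 hq
  have hmn : (m:ℝ) ≤ Real.exp (n * (η / 2)) := by
    refine le_trans ?_ hpoly
    rw [pow_one]; exact hm1
  have hfin : Real.exp (n * (gr lam θ - η / 2)) ≤ Real.exp (n * (η / 2)) * BB lam q n (ε * n) m :=
    (hal.trans hmain).trans (mul_le_mul_of_nonneg_right hmn hBB0)
  rw [mul_comm (Real.exp (n * (η / 2))), ← div_le_iff₀ (Real.exp_pos _), ← Real.exp_sub] at hfin
  refine le_trans (le_of_eq ?_) hfin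
  congr 1
  ring

-- PART 14

/-- values achieved by finitely many mesoscopic components -/
def LamSet (lam q ε s : ℝ) : Set ℝ :=
  {v | ∃ L : List ℝ, (∀ b ∈ L, 0 < b ∧ b ≤ ε) ∧ L.sum ≤ s ∧
    v = FF lam q (s - L.sum) + (L.map (gr lam)).sum}

def Lam (lam q ε s : ℝ) : ℝ := sSup (LamSet lam q ε s)

lemma LamSet_nil {lam q ε s : ℝ} (hs : 0 ≤ s) : FF lam q s ∈ LamSet lam q ε s :=
  ⟨[], by simp, by simpa using hs, by simp⟩

lemma LamSet_bdd {lam q ε s : ℝ} (hl : 0 < lam) (hq : 0 < q) (hs1 : s ≤ 1) :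
    BddAbove (LamSet lam q ε s) := by
  obtain ⟨C, hC⟩ := (isCompact_Icc (a := (0:ℝ)) (b := 1)).bddAbove_image
    (FF_continuous hl hq).continuousOn
  refine ⟨C + (lam / 2 + 1), ?_⟩
  rintro _ ⟨L, hL, hsum, rfl⟩
  have h0 : 0 ≤ L.sum := List.sum_nonneg fun b hb => (hL b hb).1.le
  have h1 := hC ⟨s - L.sum, ⟨by linarith, by linarith⟩, rfl⟩
  have h2 := gr_list hl L (fun b hb => (hL b hb).1)
  have h3 := gr_bdd hl h0 (by linarith)
  linarith

lemma LB_list {lam q ε : ℝ} (hl : 0 < lam) (hq : 1 ≤ q) (hε : 0 < ε) {s0 : ℝ} (hs0 : 0 ≤ s0)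
    (L : List ℝ) (hL : ∀ b ∈ L, 0 < b ∧ b ≤ ε) :
    LB lam q ε (s0 + L.sum) (FF lam q s0 + (L.map (gr lam)).sum) := by
  induction L with
  | nil => simpa using LB_full hl hq hε hs0
  | cons b L ih =>
    have h1 := ih (fun x hx => hL x (by simp [hx]))
    have hb := hL b (by simp)
    have h0 : 0 ≤ L.sum := List.sum_nonneg fun b hb => (hL b (by simp [hb])).1.le
    have h2 := LB_giant hl hq (by positivity) hb.1 hb.2 h1
    have e1 : s0 + (b :: L).sum = s0 + L.sum + b := by rw [List.sum_cons]; ring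
    have e2 : FF lam q s0 + ((b :: L).map (gr lam)).sum = FF lam q s0 + (L.map (gr lam)).sum + gr lam b := by
      rw [List.map_cons, List.sum_cons]; ring
    rw [e1, e2]
    exact h2

lemma LB_LamSet {lam q ε s v : ℝ} (hl : 0 < lam) (hq : 1 ≤ q) (hε : 0 < ε) (hv : v ∈ LamSet lam q ε s) :
    LB lam q ε s v := by
  obtain ⟨L, hL, hsum, rfl⟩ := hv
  have h := LB_list hl hq hε (sub_nonneg.2 hsum) L hL
  rwa [sub_add_cancel] at h

lemma resc {lam q s ε δ η : ℝ} (hl : 0 < lam) (hq : 0 < q) (hs : 0 < s) (hs1 : s ≤ 1)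
    (hδ : 0 < δ) (hη : 0 < η) :
    ∀ᶠ n : ℕ in atTop, ∀ l : ℕ, l ≤ n → s * n ≤ l → (l:ℝ) ≤ s * n + 1 → ∀ j : ℕ, ∀ ks : List ℕ,
      ks.sum + j = l → (∀ k ∈ ks, δ * n < (k:ℝ) ∧ (k:ℝ) ≤ ε * n) →
      FF lam q ((j:ℝ) / n) + (ks.map (fun k : ℕ => gr lam ((k:ℝ) / n))).sum ≤ Lam lam q ε s + η := by
  have hFu : UniformContinuousOn (FF lam q) (Set.Icc 0 1) :=
    isCompact_Icc.uniformContinuousOn_of_continuous (FF_continuous hl hq).continuousOn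
  have hgu : UniformContinuousOn (gr lam) (Set.Icc (δ / 2) 1) := by
    apply isCompact_Icc.uniformContinuousOn_of_continuous
    intro x hx
    exact (gr_continuousAt hl (lt_of_lt_of_le (by positivity) hx.1)).continuousWithinAt
  rw [Metric.uniformContinuousOn_iff] at hFu hgu
  obtain ⟨ρ1, hρ1, hF⟩ := hFu (η / 2) (half_pos hη)
  obtain ⟨ρ2, hρ2, hg⟩ := hgu (η / 2 * δ) (by positivity)
  have hlim1 := tendsto_const_div_atTop_nhds_zero_nat (1 : ℝ)
  filter_upwards [eventually_ge_atTop 1, hlim1.eventually_lt_const hρ1, hlim1.eventually_lt_const hρ2,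
    hlim1.eventually_lt_const (half_pos hδ)] with n hn1 hn2 hn3 hn4 l hln hsl hls j ks hsum hks
  have hnpos : (0:ℝ) < n := by exact_mod_cast hn1
  have hlpos : (0:ℝ) < l := lt_of_lt_of_le (by positivity) hsl
  -- the comparison
  have hcmp : ∀ k : ℕ, k ≤ l → s * k / l ≤ (k:ℝ) / n ∧ (k:ℝ) / n ≤ s * k / l + 1 / n := by
    intro k hk
    have hk' : (k:ℝ) ≤ l := by exact_mod_cast hk
    have hk0 : (0:ℝ) ≤ k := by positivity
    constructor
    · rw [div_le_div_iff₀ hlpos hnpos]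
      calc s * k * n = k * (s * n) := by ring
        _ ≤ k * l := mul_le_mul_of_nonneg_left hsl hk0
    · have : (k:ℝ) / n ≤ s * k / l + (k / l) * (1 / n) := by
        have : (k:ℝ) / n = (k / l) * (l / n) := by field_simp
        rw [this]
        have e : s * k / l + (k / l : ℝ) * (1 / n) = (k / l) * ((s * n + 1) / n) := by field_simp
        rw [e]
        gcongr
      refine this.trans ?_
      have h1 : (k:ℝ) / l ≤ 1 := by rwa [div_le_one hlpos]
      have := mul_le_of_le_one_left (show (0:ℝ) ≤ 1 / n by positivity) h1
      linarith
  have hkl : ∀ k ∈ ks, k ≤ l := by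
    intro k hk
    have := list_mem_le_sum ks hk
    omega
  have hjl : j ≤ l := by omega
  -- FF part
  have hFF : FF lam q ((j:ℝ) / n) ≤ FF lam q (s * j / l) + η / 2 := by
    obtain ⟨h1, h2⟩ := hcmp j hjl
    have hj1 : (j:ℝ) / n ≤ 1 := by
      rw [div_le_one hnpos]; exact_mod_cast hjl.trans hln
    have := hF ((j:ℝ) / n) ⟨by positivity, hj1⟩ (s * j / l) ⟨by positivity, h1.trans hj1⟩ (by
      rw [Real.dist_eq, abs_lt]; constructor <;> linarith)
    rw [Real.dist_eq, abs_lt] at this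
    linarith [this.2]
  have hgg : ∀ k ∈ ks, gr lam ((k:ℝ) / n) ≤ gr lam (s * k / l) + η / 2 * δ := by
    intro k hk
    obtain ⟨h1, h2⟩ := hcmp k (hkl k hk)
    have hk1 : (k:ℝ) / n ≤ 1 := by
      rw [div_le_one hnpos]; exact_mod_cast (hkl k hk).trans hln
    have hk2 : δ < (k:ℝ) / n := by
      rw [lt_div_iff₀ hnpos]; exact (hks k hk).1
    have := hg ((k:ℝ) / n) ⟨by linarith, hk1⟩ (s * k / l) ⟨by linarith, h1.trans hk1⟩ (by
      rw [Real.dist_eq, abs_lt]; constructor <;> linarith)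
    rw [Real.dist_eq, abs_lt] at this
    linarith [this.2]
  have hsumle : ∀ M : List ℕ, (∀ k ∈ M, gr lam ((k:ℝ) / n) ≤ gr lam (s * k / l) + η / 2 * δ) →
      (M.map (fun k : ℕ => gr lam ((k:ℝ) / n))).sum ≤
        (M.map (fun k : ℕ => gr lam (s * k / l))).sum + M.length * (η / 2 * δ) := by
    intro M hM
    induction M with
    | nil => simp
    | cons a M ih =>
      have h1 := ih (fun x hx => hM x (by simp [hx]))
      have h2 := hM a (by simp)
      simp only [List.map_cons, List.sum_cons, List.length_cons]
      rw [Nat.cast_add, Nat.cast_one]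
      linarith
  have h1 := hsumle ks hgg
  have hlen : (ks.length : ℝ) * δ ≤ 1 := by
    have h4 := list_len (δ := δ) (n := n) ks (fun k hk => (hks k hk).1)
    have h5 : (ks.sum : ℝ) ≤ n := by exact_mod_cast (by omega : ks.sum ≤ n)
    have h6 : (ks.length * δ) * n ≤ 1 * n := by linarith
    exact le_of_mul_le_mul_right h6 hnpos
  have h2 : (ks.length : ℝ) * (η / 2 * δ) ≤ η / 2 := by
    calc (ks.length : ℝ) * (η / 2 * δ) = (ks.length * δ) * (η / 2) := by ring
      _ ≤ 1 * (η / 2) := mul_le_mul_of_nonneg_right hlen (by positivity)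
      _ = _ := one_mul _
  have hmapsum : ∀ M : List ℕ, (M.map (fun k : ℕ => s * k / l)).sum = s * (M.sum : ℝ) / l := by
    intro M
    induction M with
    | nil => simp
    | cons a M ih =>
      simp only [List.map_cons, List.sum_cons, ih]
      rw [Nat.cast_add]; ring
  have hval : (ks.sum : ℝ) + j = l := by exact_mod_cast hsum
  have hsj : s - s * (ks.sum : ℝ) / l = s * j / l := by
    rw [← hval] at hlpos ⊢
    field_simp
    ring
  have hmem : FF lam q (s * j / l) + (ks.map (fun k : ℕ => gr lam (s * k / l))).sum ∈ LamSet lam q ε s := by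
    refine ⟨ks.map (fun k : ℕ => s * k / l), ?_, ?_, ?_⟩
    · intro b hb
      obtain ⟨k, hk, rfl⟩ := List.mem_map.1 hb
      obtain ⟨h3, h4⟩ := hks k hk
      have hk0 : (0:ℝ) < k := lt_of_le_of_lt (by positivity) h3
      refine ⟨by positivity, (hcmp k (hkl k hk)).1.trans ?_⟩
      rwa [div_le_iff₀ hnpos]
    · rw [hmapsum]
      have : 0 ≤ s * j / l := by positivity
      linarith
    · rw [hmapsum, hsj, List.map_map]; rfl
  have h3 := le_csSup (LamSet_bdd hl hq hs1) hmem
  unfold Lam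
  linarith

lemma SS_upper_lim {lam q s ε η : ℝ} (hl : 0 < lam) (hq : 0 < q) (hs : 0 < s) (hs1 : s ≤ 1)
    (hε : 0 < ε) (hη : 0 < η) :
    ∀ᶠ n : ℕ in atTop, ∀ l : ℕ, l ≤ n → s * n ≤ l → (l:ℝ) ≤ s * n + 1 →
      SS lam q n (ε * n) l ≤ Real.exp (n * (Lam lam q ε s + η)) := by
  set δ := min ε (η / (4 * lam)) with hδ
  have hδ0 : 0 < δ := by positivity
  have hδε : δ ≤ ε := min_le_left _ _
  have hδη : lam * δ ≤ η / 4 := by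
    have h := mul_le_mul_of_nonneg_left (min_le_right ε (η / (4 * lam))) hl.le
    rw [← hδ] at h
    refine h.trans (le_of_eq ?_)
    field_simp
  have hη4 : 0 < η / 4 := by positivity
  filter_upwards [resc (ε := ε) hl hq hs hs1 hδ0 hη4, big_list hl hq hδ0 hη4, ev_lam hl (show (0:ℝ) < 1 / 2 by norm_num),
    poly_le_exp 2 1 hη4] with n hresc hbig hlam hpoly l hln hsl hls
  obtain ⟨hp0, hp1, hn1⟩ := hlam
  have hnpos : (0:ℝ) < n := by exact_mod_cast hn1
  have hn1' : (1:ℝ) ≤ n := by exact_mod_cast hn1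
  have haq := fun k => aq_nonneg (lam := lam) hq.le hp0.le (by linarith : lam / n ≤ 1) k
  have hcongr : SS lam q n (ε * n) l =
      expC (fun k => (if (k:ℝ) ≤ δ * n then aq lam q n k else 0) +
        (if δ * n < (k:ℝ) ∧ (k:ℝ) ≤ ε * n then aq lam q n k else 0)) l := by
    unfold SS
    apply expC_congr
    intro k hk
    by_cases h1 : (k:ℝ) ≤ δ * n
    · have h2 : (k:ℝ) ≤ ε * n := h1.trans (mul_le_mul_of_nonneg_right hδε hnpos.le)
      rw [if_pos h1, if_pos h2, if_neg (by rintro ⟨h, _⟩; linarith), add_zero]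
    · rw [if_neg h1, zero_add]
      by_cases h2 : (k:ℝ) ≤ ε * n
      · rw [if_pos h2, if_pos ⟨not_le.1 h1, h2⟩]
      · rw [if_neg h2, if_neg (fun h => h2 h.2)]
  rw [hcongr, expC_add]
  set b : ℕ → ℝ := fun k => if δ * n < (k:ℝ) ∧ (k:ℝ) ≤ ε * n then aq lam q n k else 0 with hb
  have hb0 : ∀ k, 0 ≤ b k := by
    intro k; rw [hb]; dsimp only; split_ifs; exacts [haq k, le_rfl]
  have hb1 : ∀ k, b k ≤ aq lam q n k := by
    intro k; rw [hb]; dsimp only; split_ifs; exacts [le_rfl, haq k]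
  have hb2 : ∀ k : ℕ, 0 < b k → δ * n < (k:ℝ) ∧ (k:ℝ) ≤ ε * n := by
    intro k hk
    by_contra hc
    rw [hb] at hk; dsimp only at hk
    rw [if_neg hc] at hk
    exact lt_irrefl _ hk
  have hterm : ∀ j ∈ Finset.range (l + 1),
      expC (fun k : ℕ => if (k:ℝ) ≤ δ * n then aq lam q n k else 0) j * expC b (l - j) ≤
        Real.exp (n * (Lam lam q ε s + 3 * (η / 4))) := by
    intro j hj
    rw [Finset.mem_range] at hj
    have hjl : j ≤ l := by omega
    rcases (expC_nonneg hb0 (l - j)).eq_or_lt with h0 | hpos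
    · rw [← h0, mul_zero]; exact (Real.exp_pos _).le
    obtain ⟨ks, h1, h2, h3⟩ := hbig (l - j) (by omega) b hb0 hb1 (fun k hk => (hb2 k hk).1) hpos
    have hr := hresc l hln hsl hls j ks (by omega) (fun k hk => hb2 k (h2 k hk).2)
    have hS := SS_upper (δ := δ) hl hq hn1 hp1.le j
    refine (mul_le_mul hS h3 (expC_nonneg hb0 _) (Real.exp_pos _).le).trans ?_
    rw [← Real.exp_add]
    apply Real.exp_le_exp.2
    have hjn : (j:ℝ) ≤ n := by exact_mod_cast hjl.trans hln
    have h5 : (j:ℝ) * (lam * δ) ≤ n * (η / 4) := by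
      apply mul_le_mul hjn hδη (by positivity) hnpos.le
    have h6 := mul_le_mul_of_nonneg_left hr hnpos.le
    linarith
  refine (Finset.sum_le_sum hterm).trans ?_
  rw [Finset.sum_const, Finset.card_range, nsmul_eq_mul]
  have h7 : ((l + 1 : ℕ) : ℝ) ≤ Real.exp (n * (η / 4)) := by
    refine le_trans ?_ hpoly
    have : (l:ℝ) ≤ n := by exact_mod_cast hln
    push_cast
    linarith
  refine (mul_le_mul_of_nonneg_right h7 (Real.exp_pos _).le).trans (le_of_eq ?_)
  rw [← Real.exp_add]
  congr 1
  ring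

-- PART 15

/-- `X n` grows like `exp (n L)` up to subexponential factors. -/
def EX (X : ℕ → ℝ) (L : ℝ) : Prop :=
  ∀ η : ℝ, 0 < η → ∀ᶠ n : ℕ in atTop,
    Real.exp (n * (L - η)) ≤ X n ∧ X n ≤ Real.exp (n * (L + η))

lemma EX_tendsto {X : ℕ → ℝ} {L : ℝ} (h : EX X L) :
    Tendsto (fun n : ℕ => 1 / (n:ℝ) * Real.log (X n)) atTop (𝓝 L) := by
  rw [Metric.tendsto_nhds]
  intro η hη
  filter_upwards [h (η / 2) (by linarith), eventually_ge_atTop 1] with n hn hn1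
  have hnpos : (0:ℝ) < n := by exact_mod_cast hn1
  have hX : 0 < X n := lt_of_lt_of_le (Real.exp_pos _) hn.1
  have h1 : n * (L - η / 2) ≤ Real.log (X n) := (Real.le_log_iff_exp_le hX).2 hn.1
  have h2 : Real.log (X n) ≤ n * (L + η / 2) := (Real.log_le_iff_le_exp hX).2 hn.2
  have h3 : 1 / (n:ℝ) * Real.log (X n) = Real.log (X n) / n := by ring
  rw [Real.dist_eq, h3, abs_lt]
  have h4 : L - η / 2 ≤ Real.log (X n) / n := by
    rw [le_div_iff₀ hnpos]; linarith
  have h5 : Real.log (X n) / n ≤ L + η / 2 := by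
    rw [div_le_iff₀ hnpos]; linarith
  constructor <;> linarith

lemma EX_of_tendsto {X : ℕ → ℝ} {L : ℝ} (hX : ∀ᶠ n : ℕ in atTop, 0 < X n)
    (h : Tendsto (fun n : ℕ => 1 / (n:ℝ) * Real.log (X n)) atTop (𝓝 L)) : EX X L := by
  intro η hη
  rw [Metric.tendsto_nhds] at h
  filter_upwards [h η hη, hX, eventually_ge_atTop 1] with n hn hX hn1
  have hnpos : (0:ℝ) < n := by exact_mod_cast hn1
  have h3 : 1 / (n:ℝ) * Real.log (X n) = Real.log (X n) / n := by ring
  rw [Real.dist_eq, h3, abs_lt] at hn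
  have h4 : L - η ≤ Real.log (X n) / n := by linarith [hn.1]
  have h5 : Real.log (X n) / n ≤ L + η := by linarith [hn.2]
  rw [le_div_iff₀ hnpos] at h4
  rw [div_le_iff₀ hnpos] at h5
  constructor
  · rw [← Real.le_log_iff_exp_le hX]; linarith
  · rw [← Real.log_le_iff_le_exp hX]; linarith

lemma EX_mul {X Y : ℕ → ℝ} {L M : ℝ} (hX : EX X L) (hY : EX Y M) :
    EX (fun n => X n * Y n) (L + M) := by
  intro η hη
  filter_upwards [hX (η / 2) (by linarith), hY (η / 2) (by linarith)] with n h1 h2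
  have hX0 : 0 ≤ X n := (Real.exp_pos _).le.trans h1.1
  constructor
  · refine le_trans (le_of_eq ?_) (mul_le_mul h1.1 h2.1 (Real.exp_pos _).le hX0)
    rw [← Real.exp_add]; congr 1; ring
  · refine (mul_le_mul h1.2 h2.2 ((Real.exp_pos _).le.trans h2.1) (Real.exp_pos _).le).trans
      (le_of_eq ?_)
    rw [← Real.exp_add]; congr 1; ring

lemma EX_inv {X : ℕ → ℝ} {L : ℝ} (hX : EX X L) : EX (fun n => (X n)⁻¹) (-L) := by
  intro η hη
  filter_upwards [hX η hη] with n h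
  have hX0 : 0 < X n := (Real.exp_pos _).trans_le h.1
  constructor
  · have := inv_anti₀ hX0 h.2
    rw [← Real.exp_neg] at this
    refine le_trans (le_of_eq ?_) this
    congr 1; ring
  · have := inv_anti₀ (Real.exp_pos _) h.1
    rw [← Real.exp_neg] at this
    refine this.trans (le_of_eq ?_)
    congr 1; ring

lemma EX_congr {X Y : ℕ → ℝ} {L : ℝ} (hX : EX X L) (h : ∀ᶠ n in atTop, X n = Y n) : EX Y L := by
  intro η hη
  filter_upwards [hX η hη, h] with n h1 h2
  rw [← h2]; exact h1

lemma EX_pre {lam : ℝ} (hl : 0 < lam) : EX (fun n => pre lam n) (-1 - lam / 2) := by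
  apply EX_of_tendsto _ (pre_limit hl)
  filter_upwards [ev_lam hl one_pos] with n h
  exact pre_pos n h.2.2 h.2.1

lemma floor_facts {θ : ℝ} (h0 : 0 ≤ θ) (h1 : θ ≤ 1) (n : ℕ) :
    ⌊θ * (n:ℝ)⌋₊ ≤ n ∧ (1 - θ) * n ≤ ((n - ⌊θ * (n:ℝ)⌋₊ : ℕ) : ℝ) ∧
      ((n - ⌊θ * (n:ℝ)⌋₊ : ℕ) : ℝ) ≤ (1 - θ) * n + 1 := by
  have hn : (0:ℝ) ≤ n := Nat.cast_nonneg n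
  have ha : ⌊θ * (n:ℝ)⌋₊ ≤ n := by
    apply Nat.floor_le_of_le
    nlinarith
  have h2 := Nat.floor_le (mul_nonneg h0 hn)
  have h3 := Nat.lt_floor_add_one (θ * (n:ℝ))
  refine ⟨ha, ?_, ?_⟩
  · rw [Nat.cast_sub ha]; linarith
  · rw [Nat.cast_sub ha]; linarith

lemma floor_lim {θ : ℝ} (h0 : 0 ≤ θ) :
    Tendsto (fun n : ℕ => (⌊θ * (n:ℝ)⌋₊ : ℝ) / n) atTop (𝓝 θ) :=
  (tendsto_nat_floor_mul_div_atTop h0).comp tendsto_natCast_atTop_atTop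

lemma cofloor_lim {θ : ℝ} (h0 : 0 ≤ θ) (h1 : θ ≤ 1) :
    Tendsto (fun n : ℕ => ((n - ⌊θ * (n:ℝ)⌋₊ : ℕ) : ℝ) / n) atTop (𝓝 (1 - θ)) := by
  refine (tendsto_const_nhds.sub (floor_lim h0)).congr' ?_
  filter_upwards [eventually_ge_atTop 1] with n hn1
  have hnpos : (0:ℝ) < n := by exact_mod_cast hn1
  rw [Nat.cast_sub (floor_facts h0 h1 n).1]
  field_simp

lemma LB_ev {lam q ε θ v η : ℝ} (h0 : 0 ≤ θ) (h1 : θ ≤ 1) (h : LB lam q ε (1 - θ) v) (hη : 0 < η) :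
    ∀ᶠ n : ℕ in atTop, Real.exp (n * (v - η)) ≤ SS lam q n (ε * n) (n - ⌊θ * (n:ℝ)⌋₊) := by
  obtain ⟨ρ, hρ, hev⟩ := h η hη
  have hc := cofloor_lim h0 h1
  rw [Metric.tendsto_nhds] at hc
  filter_upwards [hev, hc ρ hρ] with n hn hd
  apply hn
  rw [Real.dist_eq] at hd
  exact hd.le

lemma EX_SS {lam q ε θ : ℝ} (hl : 0 < lam) (hq : 1 ≤ q) (hε : 0 < ε) (h0 : 0 ≤ θ) (h1 : θ < 1) :
    EX (fun n : ℕ => SS lam q n (ε * n) (n - ⌊θ * (n:ℝ)⌋₊)) (Lam lam q ε (1 - θ)) := by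
  intro η hη
  have hq0 : 0 < q := by linarith
  have hne : (LamSet lam q ε (1 - θ)).Nonempty := ⟨_, LamSet_nil (by linarith)⟩
  obtain ⟨v, hv, hvl⟩ := exists_lt_of_lt_csSup hne
    (show Lam lam q ε (1 - θ) - η / 2 < sSup (LamSet lam q ε (1 - θ)) by
      have : Lam lam q ε (1 - θ) = sSup (LamSet lam q ε (1 - θ)) := rfl
      linarith)
  have hL := LB_LamSet hl hq hε hv
  filter_upwards [LB_ev h0 h1.le hL (show 0 < η / 2 by linarith),
    SS_upper_lim hl hq0 (show 0 < 1 - θ by linarith) (by linarith) hε hη] with n ha hb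
  obtain ⟨f1, f2, f3⟩ := floor_facts h0 h1.le n
  refine ⟨le_trans ?_ ha, hb _ (by omega) f2 f3⟩
  apply Real.exp_le_exp.2
  apply mul_le_mul_of_nonneg_left _ (Nat.cast_nonneg n)
  linarith

lemma Lam_bounds {lam q ε θ : ℝ} (hl : 0 < lam) (hq : 1 ≤ q) (hε : 0 < ε) (h0 : 0 ≤ θ) (h1 : θ < 1) :
    FF lam q (1 - θ) ≤ Lam lam q ε (1 - θ) ∧
      Lam lam q ε (1 - θ) ≤ FF lam q (1 - θ) + lam * ε := by
  have hq0 : 0 < q := by linarith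
  refine ⟨le_csSup (LamSet_bdd hl hq0 (by linarith)) (LamSet_nil (by linarith)), ?_⟩
  have hT : Tendsto (fun n : ℕ => FF lam q (((n - ⌊θ * (n:ℝ)⌋₊ : ℕ) : ℝ) / n) + lam * ε) atTop
      (𝓝 (FF lam q (1 - θ) + lam * ε)) :=
    (((FF_continuous hl hq0).tendsto _).comp (cofloor_lim h0 h1.le)).add_const _
  refine le_of_tendsto_of_tendsto (EX_tendsto (EX_SS hl hq hε h0 h1)) hT ?_
  filter_upwards [ev_lam hl (show (0:ℝ) < 1 / 2 by norm_num), EX_SS hl hq hε h0 h1 1 one_pos]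
    with n hn hS
  obtain ⟨hp0, hp1, hn1⟩ := hn
  have hnpos : (0:ℝ) < n := by exact_mod_cast hn1
  have hu := SS_upper (δ := ε) hl hq0 hn1 hp1.le (n - ⌊θ * (n:ℝ)⌋₊)
  have hpos := (Real.exp_pos _).trans_le hS.1
  have hlog := (Real.log_le_iff_le_exp hpos).2 hu
  have hle : ((n - ⌊θ * (n:ℝ)⌋₊ : ℕ) : ℝ) ≤ n := by exact_mod_cast Nat.sub_le _ _
  have h5 := mul_le_mul_of_nonneg_right hle (mul_pos hl hε).le
  rw [one_div, inv_mul_le_iff₀ hnpos]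
  linarith

lemma SS_limit {lam q θ : ℝ} (hl : 0 < lam) (hq : 1 ≤ q) (h0 : 0 ≤ θ) (h1 : θ ≤ 1) :
    ∃ Λ : ℝ → ℝ, (∀ ε, 0 < ε → EX (fun n : ℕ => SS lam q n (ε * n) (n - ⌊θ * (n:ℝ)⌋₊)) (Λ ε)) ∧
      Tendsto Λ (𝓝[>] 0) (𝓝 (FF lam q (1 - θ))) := by
  rcases h1.eq_or_lt with rfl | h1
  · refine ⟨fun _ => 0, ?_, ?_⟩
    · intro ε hε η hη
      refine Eventually.of_forall fun n => ?_
      dsimp only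
      rw [one_mul, Nat.floor_natCast, Nat.sub_self, SS_zero]
      have hn : (0:ℝ) ≤ n := Nat.cast_nonneg n
      constructor
      · rw [Real.exp_le_one_iff]; nlinarith
      · rw [Real.one_le_exp_iff]; positivity
    · rw [sub_self, FF_zero (by linarith)]
      exact tendsto_const_nhds
  · refine ⟨fun ε => Lam lam q ε (1 - θ), fun ε hε => EX_SS hl hq hε h0 h1, ?_⟩
    have hT : Tendsto (fun ε : ℝ => FF lam q (1 - θ) + lam * ε) (𝓝[>] 0)
        (𝓝 (FF lam q (1 - θ))) := by
      have : Continuous (fun ε : ℝ => FF lam q (1 - θ) + lam * ε) := by fun_prop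
      have h := this.tendsto 0
      rw [mul_zero, add_zero] at h
      exact h.mono_left nhdsWithin_le_nhds
    refine tendsto_of_tendsto_of_tendsto_of_le_of_le' tendsto_const_nhds hT ?_ ?_
    · filter_upwards [self_mem_nhdsWithin] with ε hε
      exact (Lam_bounds hl hq hε h0 h1).1
    · filter_upwards [self_mem_nhdsWithin] with ε hε
      exact (Lam_bounds hl hq hε h0 h1).2

lemma BB_low {lam q ε η θ : ℝ} (hl : 0 < lam) (hq : 1 ≤ q) (hε : 0 < ε) (hη : 0 < η)
    (hθ : θ = 0 ∨ ε < θ) :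
    ∀ᶠ n : ℕ in atTop, Real.exp (n * (gr lam θ - η)) ≤ BB lam q n (ε * n) ⌊θ * (n:ℝ)⌋₊ := by
  rcases hθ with rfl | hθ
  · refine Eventually.of_forall fun n => ?_
    have hn : (0:ℝ) ≤ n := Nat.cast_nonneg n
    have hB : BB lam q n (ε * n) 0 = 1 := expC_zero _
    rw [zero_mul, Nat.floor_zero, hB, gr_zero, Real.exp_le_one_iff]
    nlinarith
  · exact BB_lower hl hq hε hη hθ

lemma EX_BB {lam q ε θ : ℝ} (hl : 0 < lam) (hq : 1 ≤ q) (hε : 0 < ε) (h1 : θ ≤ 1)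
    (hθ : θ = 0 ∨ ε < θ) :
    EX (fun n : ℕ => BB lam q n (ε * n) ⌊θ * (n:ℝ)⌋₊) (gr lam θ) := by
  intro η hη
  have hq0 : 0 < q := by linarith
  have hη2 : 0 < η / 2 := by linarith
  have h0 : 0 ≤ θ := by rcases hθ with h | h <;> linarith
  have hg : ∀ᶠ n : ℕ in atTop, gr lam ((⌊θ * (n:ℝ)⌋₊ : ℝ) / n) < gr lam θ + η / 2 := by
    rcases hθ with rfl | hθ
    · refine Eventually.of_forall fun n => ?_
      rw [zero_mul, Nat.floor_zero, Nat.cast_zero, zero_div]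
      linarith
    · have := (gr_continuousAt hl (hε.trans hθ)).tendsto.comp (floor_lim h0)
      exact this.eventually (gt_mem_nhds (by linarith))
  filter_upwards [BB_low hl hq hε hη hθ, BB_upper hl hq0 hε hη2, hg] with n ha hb hc
  refine ⟨ha, (hb _ (floor_facts h0 h1 n).1).trans ?_⟩
  apply Real.exp_le_exp.2
  apply mul_le_mul_of_nonneg_left _ (Nat.cast_nonneg n)
  linarith

lemma EX_Ztot {lam q : ℝ} (hl : 0 < lam) (hq : 1 ≤ q) :
    EX (fun n => Ztot n lam q) (sSup ((fun θ' => Phi θ' lam q) '' Set.Icc (0:ℝ) 1)) := by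
  have hq0 : 0 < q := by linarith
  set M := sSup ((fun θ' => Phi θ' lam q) '' Set.Icc (0:ℝ) 1) with hM
  have hne : ((fun θ' => Phi θ' lam q) '' Set.Icc (0:ℝ) 1).Nonempty :=
    ⟨_, 0, ⟨le_rfl, zero_le_one⟩, rfl⟩
  intro η hη
  apply Filter.Eventually.and
  · obtain ⟨_, ⟨θ, ⟨h0, h1⟩, rfl⟩, hlt⟩ := exists_lt_of_lt_csSup hne
      (show M - η / 4 < sSup _ by linarith)
    dsimp only at hlt
    rw [Phi_eq hl hq0 h0 h1] at hlt
    obtain ⟨ε, hε, hθ⟩ : ∃ ε : ℝ, 0 < ε ∧ (θ = 0 ∨ ε < θ) := by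
      rcases h0.eq_or_lt with h | h
      · exact ⟨1, one_pos, Or.inl h.symm⟩
      · exact ⟨θ / 2, by linarith, Or.inr (by linarith)⟩
    have hη4 : 0 < η / 4 := by linarith
    filter_upwards [EX_pre hl (η / 4) hη4, BB_low hl hq hε hη4 hθ,
      LB_ev h0 h1 (LB_full hl hq hε (show 0 ≤ 1 - θ by linarith)) hη4,
      ev_lam hl one_pos] with n hp hB hS hn
    obtain ⟨hp0, hp1, hn1⟩ := hn
    rw [Ztot_event n hn1 lam q (ε * n) hp1]
    have hnon : ∀ m ∈ Finset.range (n + 1),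
        0 ≤ pre lam n * BB lam q n (ε * n) m * SS lam q n (ε * n) (n - m) := fun m _ =>
      mul_nonneg (mul_nonneg (pre_pos n hn1 hp1).le (BB_nonneg hq0.le hp0.le hp1.le _ _))
        (SS_nonneg hq0.le hp0.le hp1.le _ _)
    have hmem : ⌊θ * (n:ℝ)⌋₊ ∈ Finset.range (n + 1) := by
      have := (floor_facts h0 h1 n).1
      rw [Finset.mem_range]; omega
    refine le_trans ?_ (Finset.single_le_sum hnon hmem)
    have e1 := mul_le_mul hp.1 hB (Real.exp_pos _).le (pre_pos n hn1 hp1).le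
    have e2 := mul_le_mul e1 hS (Real.exp_pos _).le
      (mul_nonneg (pre_pos n hn1 hp1).le (BB_nonneg hq0.le hp0.le hp1.le _ _))
    refine le_trans ?_ e2
    rw [← Real.exp_add, ← Real.exp_add]
    apply Real.exp_le_exp.2
    have hn0 : (0:ℝ) ≤ n := Nat.cast_nonneg n
    have := mul_le_mul_of_nonneg_left hlt.le hn0
    linarith
  · have hη4 : 0 < η / 4 := by linarith
    set ε := η / 4 / lam with hεd
    have hε : 0 < ε := div_pos hη4 hl
    have hlε : lam * ε = η / 4 := by rw [hεd]; field_simp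
    filter_upwards [EX_pre hl (η / 4) hη4, BB_upper hl hq0 hε hη4,
      poly_le_exp 2 1 hη4, ev_lam hl (show (0:ℝ) < 1 / 2 by norm_num)] with n hp hB hpoly hn
    obtain ⟨hp0, hp1, hn1⟩ := hn
    have hnpos : (0:ℝ) < n := by exact_mod_cast hn1
    have hn1' : (1:ℝ) ≤ n := by exact_mod_cast hn1
    have hpl : lam / n < 1 := by linarith
    rw [Ztot_event n hn1 lam q (ε * n) hpl]
    have hterm : ∀ m ∈ Finset.range (n + 1),
        pre lam n * BB lam q n (ε * n) m * SS lam q n (ε * n) (n - m) ≤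
          Real.exp (n * (M + 3 * (η / 4))) := by
      intro m hm
      rw [Finset.mem_range] at hm
      have hmn : m ≤ n := by omega
      have hmn' : (m:ℝ) ≤ n := by exact_mod_cast hmn
      have e1 := mul_le_mul hp.2 (hB m hmn) (BB_nonneg hq0.le hp0.le hpl.le _ _) (Real.exp_pos _).le
      have e2 := mul_le_mul e1 (SS_upper (δ := ε) hl hq0 hn1 hp1.le (n - m))
        (SS_nonneg hq0.le hp0.le hpl.le _ _) (by positivity)
      refine e2.trans ?_
      rw [← Real.exp_add, ← Real.exp_add]
      apply Real.exp_le_exp.2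
      have hx0 : 0 ≤ (m:ℝ) / n := by positivity
      have hx1 : (m:ℝ) / n ≤ 1 := by rw [div_le_one hnpos]; exact hmn'
      have hPhi : Phi ((m:ℝ) / n) lam q ≤ M := le_csSup (Phi_bdd hl hq0) ⟨_, ⟨hx0, hx1⟩, rfl⟩
      rw [Phi_eq hl hq0 hx0 hx1] at hPhi
      have hs : ((n - m : ℕ) : ℝ) / n = 1 - (m:ℝ) / n := by
        rw [Nat.cast_sub hmn]; field_simp
      have hsl : ((n - m : ℕ) : ℝ) * (lam * ε) ≤ n * (η / 4) := by
        rw [hlε]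
        apply mul_le_mul_of_nonneg_right _ hη4.le
        exact_mod_cast Nat.sub_le _ _
      rw [hs]
      have := mul_le_mul_of_nonneg_left hPhi hnpos.le
      linarith
    refine (Finset.sum_le_sum hterm).trans ?_
    rw [Finset.sum_const, Finset.card_range, nsmul_eq_mul]
    have h7 : ((n + 1 : ℕ) : ℝ) ≤ Real.exp (n * (η / 4)) := by
      refine le_trans ?_ hpoly
      push_cast
      linarith
    refine (mul_le_mul_of_nonneg_right h7 (Real.exp_pos _).le).trans (le_of_eq ?_)
    rw [← Real.exp_add]
    congr 1
    ring

/-- Fix `q ≥ 1` and `λ > 0`. For every `θ ∈ [0,1]`,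
`lim_{ε↓0} lim_{n→∞} (1/n) log φ_{n,λ,q}[|V_{εn}| = ⌊θn⌋]
  = Φ(θ,λ,q) − sup_{θ'∈[0,1]} Φ(θ',λ,q)`:
for all sufficiently small `ε > 0` the inner limit in `n` exists, and as `ε ↓ 0`
these limits converge to the stated value. -/
theorem stmt0 (q lam : ℝ) (hq : 1 ≤ q) (hlam : 0 < lam)
    (θ : ℝ) (hθ : θ ∈ Set.Icc (0:ℝ) 1) :
    ∃ f : ℝ → ℝ,
      (∀ᶠ ε in 𝓝[>] (0:ℝ),
        Tendsto (fun n : ℕ => (1 / (n:ℝ)) *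
            Real.log (phiRC n lam q {G | (Vbig G (ε * n)).ncard = ⌊θ * (n:ℝ)⌋₊}))
          atTop (𝓝 (f ε))) ∧
      Tendsto f (𝓝[>] (0:ℝ))
        (𝓝 (Phi θ lam q - sSup ((fun θ' => Phi θ' lam q) '' Set.Icc (0:ℝ) 1))) := by
  obtain ⟨h0, h1⟩ := hθ
  have hq0 : 0 < q := by linarith
  obtain ⟨Λ, hΛ1, hΛ2⟩ := SS_limit hlam hq h0 h1
  set M := sSup ((fun θ' => Phi θ' lam q) '' Set.Icc (0:ℝ) 1) with hM
  refine ⟨fun ε => (-1 - lam / 2) + gr lam θ + Λ ε + -M, ?_, ?_⟩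
  · have hev : ∀ᶠ ε in 𝓝[>] (0:ℝ), 0 < ε ∧ (θ = 0 ∨ ε < θ) := by
      rcases h0.eq_or_lt with h | h
      · filter_upwards [self_mem_nhdsWithin] with ε hε
        exact ⟨hε, Or.inl h.symm⟩
      · filter_upwards [self_mem_nhdsWithin, nhdsWithin_le_nhds (gt_mem_nhds h)] with ε hε hε2
        exact ⟨hε, Or.inr hε2⟩
    filter_upwards [hev] with ε hε
    obtain ⟨hε, hεθ⟩ := hε
    apply EX_tendsto
    refine EX_congr (EX_mul (EX_mul (EX_mul (EX_pre hlam) (EX_BB hlam hq hε h1 hεθ)) (hΛ1 ε hε))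
      (EX_inv (EX_Ztot hlam hq))) ?_
    filter_upwards [ev_lam hlam one_pos] with n hn
    unfold phiRC
    rw [ZP_event n hn.2.2 lam q (ε * n) hn.2.1 _ (floor_facts h0 h1 n).1, div_eq_mul_inv]
  · have hT := ((hΛ2.const_add ((-1 - lam / 2) + gr lam θ)).add_const (-M))
    rw [Phi_eq hlam hq0 h0 h1]
    exact hT
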